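/- arXiv:2107.13246 — 3 statements merged into one kernel-verified Lean document; each statement's English description precedes it below -/
import Mathlib

section
/- The unique solution l̃ : [−1,∞) → ℝ of the initial-value problem l̃''(r) = E(l̃(r))/(r+1)² for r > −1, with l̃(−1) = −1, l̃'(−1) = 0 and l̃''(−1) = 1 (one-sided at −1), exists, is C² on [−1,∞), satisfies l̃'(r) > 0 for all r > −1, and there exists r₊ > −1 with l̃(r₊) > 1. -/
/-- A `C²` solution on `[-1,∞)` of `l'' = E(l)/(r+1)²` for `r > -1` with
`l(-1) = -1`, `l'(-1) = 0`, `l''(-1) = 1` (one-sided derivatives at `-1`, i.e.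
derivatives within `[-1,∞)`). -/
def SolModel (E l : ℝ → ℝ) : Prop :=
  ContDiffOn ℝ 2 l (Set.Ici (-1)) ∧
  (∀ r : ℝ, -1 < r →
    derivWithin (derivWithin l (Set.Ici (-1))) (Set.Ici (-1)) r
      = E (l r) / (r + 1) ^ 2) ∧
  l (-1) = -1 ∧ derivWithin l (Set.Ici (-1)) (-1) = 0 ∧
  derivWithin (derivWithin l (Set.Ici (-1))) (Set.Ici (-1)) (-1) = 1

section
open Set Filter Topology
open scoped Manifold

theorem sm_global_curve (v : ℝ × ℝ → ℝ × ℝ) (K : NNReal) (hv : LipschitzWith K v)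
    (hc : ContDiff ℝ 1 v) (h0 : v 0 = 0) (x0 : ℝ × ℝ) :
    ∃ γ : ℝ → ℝ × ℝ, γ 0 = x0 ∧ ∀ t, HasDerivAt γ (v (γ t)) t := by
  have hε : (0:ℝ) < 1 / (2 * ((K:ℝ) + 1)) := by positivity
  have hbd : ∀ x, ‖v x‖ ≤ K * ‖x‖ := by
    intro x
    have := hv.dist_le_mul x 0
    simpa [h0, dist_eq_norm] using this
  have hv' : ContMDiff 𝓘(ℝ, ℝ × ℝ) (𝓘(ℝ, ℝ × ℝ)).tangent 1
      (fun x : ℝ × ℝ ↦ (⟨x, v x⟩ : TangentBundle 𝓘(ℝ, ℝ × ℝ) (ℝ × ℝ))) := by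
    intro x
    exact contMDiffAt_vectorSpace_iff_contDiffAt.2 hc.contDiffAt
  have hloc : ∀ x : ℝ × ℝ, ∃ γ : ℝ → ℝ × ℝ, γ 0 = x ∧
      ∀ t ∈ Set.Ioo (-(1 / (2 * ((K:ℝ) + 1)))) (1 / (2 * ((K:ℝ) + 1))),
        HasFDerivWithinAt γ ((1 : ℝ →L[ℝ] ℝ).smulRight (v (γ t)))
          (Set.Ioo (-(1 / (2 * ((K:ℝ) + 1)))) (1 / (2 * ((K:ℝ) + 1)))) t := by
    intro x
    set ε := 1 / (2 * ((K:ℝ) + 1)) with hεd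
    have hpl : IsPicardLindelof (fun _ ↦ v) (tmin := -ε) (tmax := ε)
        ⟨0, by constructor <;> linarith⟩ x (1 + ‖x‖₊) 0 (K * (2 * (1 + ‖x‖₊))) K := by
      refine ⟨fun _ _ ↦ hv.lipschitzOnWith, fun _ _ ↦ continuousOn_const, ?_, ?_⟩
      · intro t _ y hy
        refine (hbd y).trans ?_
        push_cast
        have h3 : ‖y - x‖ ≤ 1 + ‖x‖ := by simpa [dist_eq_norm] using hy
        have h4 : ‖y‖ ≤ ‖y - x‖ + ‖x‖ := by
          simpa using norm_add_le (y - x) x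
        gcongr
        linarith [norm_nonneg x]
      · push_cast
        simp only [sub_zero, zero_sub, neg_neg, max_self]
        rw [hεd, mul_one_div, div_le_iff₀ (by positivity)]
        nlinarith [norm_nonneg x, K.2]
    obtain ⟨α, ha, hα⟩ := hpl.exists_eq_forall_mem_Icc_hasDerivWithinAt₀
    refine ⟨α, ha, fun t ht ↦ ?_⟩
    have h5 := (hα t (Set.Ioo_subset_Icc_self ht)).mono Set.Ioo_subset_Icc_self
    exact h5.hasFDerivWithinAt
  obtain ⟨γ, h1, h2⟩ := exists_isMIntegralCurve_of_isMIntegralCurveOn (I := 𝓘(ℝ, ℝ × ℝ))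
    (M := ℝ × ℝ) (v := v) hv' hε (by
      intro x
      obtain ⟨α, ha, hα⟩ := hloc x
      exact ⟨α, ha, fun t ht ↦ (hα t ht).hasMFDerivWithinAt⟩) x0
  refine ⟨γ, h1, fun t ↦ ?_⟩
  have h3 : HasFDerivAt γ ((1 : ℝ →L[ℝ] ℝ).smulRight (v (γ t))) t :=
    hasMFDerivAt_iff_hasFDerivAt.1 (h2 t)
  exact h3.hasDerivAt.congr_deriv (by simp)

/-- The initial value problem in the shifted variable `s = r + 1`. -/
def SolS (E L M : ℝ → ℝ) : Prop :=
  (∀ s, 0 < s → HasDerivAt L (M s) s) ∧ (∀ s, 0 < s → HasDerivAt M (E (L s) / s ^ 2) s) ∧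
  HasDerivWithinAt L 0 (Ici 0) 0 ∧ HasDerivWithinAt M 1 (Ici 0) 0 ∧ L 0 = -1 ∧ M 0 = 0

theorem SolS.contL {E L M : ℝ → ℝ} (h : SolS E L M) : ContinuousOn L (Ici 0) := by
  intro s hs
  rcases eq_or_lt_of_le (show (0:ℝ) ≤ s from hs) with rfl | h0
  · exact h.2.2.1.continuousWithinAt
  · exact (h.1 s h0).continuousAt.continuousWithinAt

theorem SolS.contM {E L M : ℝ → ℝ} (h : SolS E L M) : ContinuousOn M (Ici 0) := by
  intro s hs
  rcases eq_or_lt_of_le (show (0:ℝ) ≤ s from hs) with rfl | h0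
  · exact h.2.2.2.1.continuousWithinAt
  · exact (h.2.1 s h0).continuousAt.continuousWithinAt

theorem sm_mvt (f f' B B' : ℝ → ℝ) (δ : ℝ) (hf : ContinuousOn f (Icc 0 δ))
    (hB : ContinuousOn B (Icc 0 δ)) (f0 : f 0 = 0) (B0 : B 0 = 0)
    (hf' : ∀ s ∈ Ioo 0 δ, HasDerivAt f (f' s) s) (hB' : ∀ s ∈ Ioo 0 δ, HasDerivAt B (B' s) s)
    (hb : ∀ s ∈ Ioo 0 δ, |f' s| ≤ B' s) : ∀ s ∈ Icc 0 δ, |f s| ≤ B s := by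
  intro s hs
  have h0 : (0:ℝ) ∈ Icc 0 δ := ⟨le_rfl, hs.1.trans hs.2⟩
  have h1 : MonotoneOn (fun x ↦ B x - f x) (Icc 0 δ) := by
    apply monotoneOn_of_deriv_nonneg (convex_Icc _ _) (hB.sub hf)
    · intro x hx
      rw [interior_Icc] at hx
      exact ((hB' x hx).sub (hf' x hx)).differentiableAt.differentiableWithinAt
    · intro x hx
      rw [interior_Icc] at hx
      rw [((hB' x hx).sub (hf' x hx)).deriv]
      linarith [le_abs_self (f' x), hb x hx]
  have h2 : MonotoneOn (fun x ↦ B x + f x) (Icc 0 δ) := by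
    apply monotoneOn_of_deriv_nonneg (convex_Icc _ _) (hB.add hf)
    · intro x hx
      rw [interior_Icc] at hx
      exact ((hB' x hx).add (hf' x hx)).differentiableAt.differentiableWithinAt
    · intro x hx
      rw [interior_Icc] at hx
      rw [((hB' x hx).add (hf' x hx)).deriv]
      linarith [neg_abs_le (f' x), hb x hx]
  have a1 := h1 h0 hs hs.1
  have a2 := h2 h0 hs hs.1
  simp only [f0, B0] at a1 a2
  exact abs_le.2 ⟨by linarith, by linarith⟩

theorem SolS.asympM {E L M : ℝ → ℝ} (h : SolS E L M) {ε : ℝ} (hε : 0 < ε) :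
    ∃ δ > 0, ∀ s ∈ Icc 0 δ, |M s - s| ≤ ε * s := by
  have h1 := h.2.2.2.1
  rw [hasDerivWithinAt_iff_isLittleO] at h1
  have h2 := h1.def hε
  obtain ⟨δ, hδ, h3⟩ := Metric.mem_nhdsWithin_iff.1 h2
  refine ⟨δ / 2, by positivity, fun s hs ↦ ?_⟩
  have h4 := h3 (a := s) ⟨by
    rw [Metric.mem_ball, Real.dist_eq, sub_zero, abs_of_nonneg hs.1]; linarith [hs.2], hs.1⟩
  simpa [h.2.2.2.2.2, abs_of_nonneg hs.1] using h4

theorem SolS.asympL {E L M : ℝ → ℝ} (h : SolS E L M) {ε : ℝ} (hε : 0 < ε) :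
    ∃ δ > 0, ∀ s ∈ Icc 0 δ, |L s + 1 - s ^ 2 / 2| ≤ ε * s ^ 2 := by
  obtain ⟨δ, hδ, h1⟩ := h.asympM hε
  refine ⟨δ, hδ, fun s hs ↦ ?_⟩
  refine sm_mvt (fun s ↦ L s + 1 - s ^ 2 / 2) (fun s ↦ M s - s) (fun s ↦ ε * s ^ 2)
    (fun s ↦ 2 * (ε * s)) δ ?_ (by fun_prop) (by simp [h.2.2.2.2.1]) (by simp) ?_ ?_ ?_ s hs
  · have := h.contL.mono (fun x (hx : x ∈ Icc 0 δ) ↦ hx.1)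
    fun_prop
  · intro x hx
    have := ((h.1 x hx.1).add_const 1).sub (((hasDerivAt_id x).pow 2).div_const 2)
    exact this.congr_deriv (by simp)
  · intro x hx
    have := ((hasDerivAt_id x).pow 2).const_mul ε
    exact this.congr_deriv (by simp; ring)
  · intro x hx
    have := h1 x (Ioo_subset_Icc_self hx)
    have h2 : 0 ≤ ε * x := mul_nonneg hε.le hx.1.le
    linarith

theorem SolS.strictMono_of_pos {E L M : ℝ → ℝ} (h : SolS E L M) {b : ℝ}
    (hM : ∀ s ∈ Ioo 0 b, 0 < M s) : StrictMonoOn L (Icc 0 b) := by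
  apply strictMonoOn_of_deriv_pos (convex_Icc _ _) (h.contL.mono Icc_subset_Ici_self)
  intro x hx
  rw [interior_Icc] at hx
  rw [(h.1 x hx.1).deriv]
  exact hM x hx

theorem SolS.energy {E L M : ℝ → ℝ} (h : SolS E L M)
    (hEeq : ∀ x : ℝ, |x| ≤ 2 → E x = x ^ 3 - x) {b : ℝ}
    (hM : ∀ s ∈ Ioo 0 b, 0 < M s) (hL : ∀ s ∈ Icc 0 b, L s ≤ 1) :
    StrictMonoOn (fun s ↦ (s * M s) ^ 2 / 2 - (L s ^ 2 - 1) ^ 2 / 4) (Icc 0 b) := by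
  have hmono := h.strictMono_of_pos hM
  have cL := h.contL.mono (fun x (hx : x ∈ Icc 0 b) ↦ hx.1)
  have cM := h.contM.mono (fun x (hx : x ∈ Icc 0 b) ↦ hx.1)
  apply strictMonoOn_of_deriv_pos (convex_Icc _ _) (by fun_prop)
  intro x hx
  rw [interior_Icc] at hx
  have hx' := Ioo_subset_Icc_self hx
  have l1 := hL x hx'
  have l2 := hmono.monotoneOn ⟨le_rfl, hx.1.le.trans hx.2.le⟩ hx' hx.1.le
  rw [h.2.2.2.2.1] at l2
  have hE := hEeq (L x) (abs_le.2 ⟨by linarith, by linarith⟩)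
  have d1 := (((hasDerivAt_id x).mul (h.2.1 x hx.1)).pow 2).div_const 2
  have d2 := ((((h.1 x hx.1).pow 2).sub_const 1).pow 2).div_const 4
  have d : deriv (fun s ↦ (s * M s) ^ 2 / 2 - (L s ^ 2 - 1) ^ 2 / 4) x = _ := (d1.sub d2).deriv
  rw [d, hE]
  have hx0 : x ≠ 0 := hx.1.ne'
  have : 0 < x * M x ^ 2 := mul_pos hx.1 (pow_pos (hM x hx) 2)
  convert this using 1
  simp
  field_simp
  ring

theorem SolS.pos {E L M : ℝ → ℝ} (h : SolS E L M)
    (hEeq : ∀ x : ℝ, |x| ≤ 2 → E x = x ^ 3 - x)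
    (hEpos : ∀ x : ℝ, 1 < x → 0 ≤ E x) : ∀ s, 0 < s → 0 < M s := by
  obtain ⟨δ, hδ, hn⟩ := h.asympM (ε := 1 / 2) (by norm_num)
  have hn' : ∀ s, 0 < s → s ≤ δ → 0 < M s := by
    intro s h1 h2
    have := (abs_le.1 (hn s ⟨h1.le, h2⟩)).1
    linarith
  by_contra! hcon
  obtain ⟨s1, hs1, hM1⟩ := hcon
  have hS : IsCompact (Icc δ s1 ∩ M ⁻¹' Iic 0) := by
    apply IsCompact.of_isClosed_subset isCompact_Icc _ inter_subset_left
    exact (h.contM.mono (fun x hx ↦ hδ.le.trans hx.1)).preimage_isClosed_of_isClosed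
      isClosed_Icc isClosed_Iic
  have hne : (Icc δ s1 ∩ M ⁻¹' Iic 0).Nonempty := by
    refine ⟨s1, ⟨?_, le_rfl⟩, hM1⟩
    by_contra! hc
    exact absurd (hn' s1 hs1 hc.le) (not_lt.2 hM1)
  obtain ⟨b, hb, hmin⟩ := hS.exists_isLeast hne
  have hb0 : 0 < b := hδ.trans_le hb.1.1
  have hMb : M b ≤ 0 := hb.2
  have hM : ∀ s ∈ Ioo 0 b, 0 < M s := by
    intro s hs
    rcases le_total s δ with h1 | h1
    · exact hn' s hs.1 h1
    · by_contra! hc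
      have := hmin ⟨⟨h1, hs.2.le.trans hb.1.2⟩, hc⟩
      linarith [hs.2]
  have hmono := h.strictMono_of_pos hM
  rcases lt_or_ge 1 (L b) with hL | hL
  · have hev : ∀ᶠ s in 𝓝 b, 1 < L s := (h.1 b hb0).continuousAt.eventually (lt_mem_nhds hL)
    obtain ⟨η, hη, hev⟩ := Metric.eventually_nhds_iff.1 hev
    obtain ⟨c, hc1, hc2⟩ := exists_between (max_lt hb0 (sub_lt_self b hη))
    have hc0 : 0 < c := (le_max_left _ _).trans_lt hc1
    have hcb : b - η < c := (le_max_right _ _).trans_lt hc1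
    have cM := h.contM.mono (fun x (hx : x ∈ Icc c b) ↦ hc0.le.trans hx.1)
    have hp : MonotoneOn (fun s ↦ s * M s) (Icc c b) := by
      have hd : ∀ x, 0 < x → HasDerivAt (fun s ↦ s * M s) (1 * M x + x * (E (L x) / x ^ 2)) x :=
        fun x hx ↦ (hasDerivAt_id x).mul (h.2.1 x hx)
      apply monotoneOn_of_deriv_nonneg (convex_Icc _ _) (by fun_prop)
      · intro x hx
        rw [interior_Icc] at hx
        exact (hd x (hc0.trans hx.1)).differentiableAt.differentiableWithinAt
      · intro x hx
        rw [interior_Icc] at hx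
        have hx0 := hc0.trans hx.1
        rw [(hd x hx0).deriv]
        have e1 : 1 < L x := hev (by rw [Real.dist_eq, abs_lt]; constructor <;> linarith [hx.1, hx.2])
        have e2 := hEpos _ e1
        have e3 := hM x ⟨hx0, hx.2⟩
        positivity
    have h1 := hp ⟨le_rfl, hc2.le⟩ ⟨hc2.le, le_rfl⟩ hc2.le
    have h2 : 0 < c * M c := mul_pos hc0 (hM c ⟨hc0, hc2⟩)
    have h3 : b * M b ≤ 0 := mul_nonpos_of_nonneg_of_nonpos hb0.le hMb
    simp only at h1
    linarith
  · have hMb' : 0 ≤ M b := by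
      have ht : Tendsto M (𝓝[<] b) (𝓝 (M b)) :=
        (h.2.1 b hb0).continuousAt.tendsto.mono_left nhdsWithin_le_nhds
      refine ge_of_tendsto ht ?_
      filter_upwards [Ioo_mem_nhdsLT hb0] with s hs using (hM s hs).le
    have hMb0 : M b = 0 := le_antisymm hMb hMb'
    have hH := h.energy hEeq hM (fun s hs ↦
      (hmono.monotoneOn hs ⟨hb0.le, le_rfl⟩ hs.2).trans hL) ⟨le_rfl, hb0.le⟩ ⟨hb0.le, le_rfl⟩ hb0
    simp [hMb0, h.2.2.2.2.1] at hH
    nlinarith [sq_nonneg (L b ^ 2 - 1)]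

theorem SolS.exceed {E L M : ℝ → ℝ} (h : SolS E L M)
    (hEeq : ∀ x : ℝ, |x| ≤ 2 → E x = x ^ 3 - x)
    (hEpos : ∀ x : ℝ, 1 < x → 0 ≤ E x) : ∃ s, 0 < s ∧ 1 < L s := by
  by_contra! hcon
  have hM := h.pos hEeq hEpos
  have hL1 : ∀ s, 0 ≤ s → L s ≤ 1 := by
    intro s hs
    rcases eq_or_lt_of_le hs with rfl | h0
    · rw [h.2.2.2.2.1]; norm_num
    · exact hcon s h0
  have hen : ∀ a b, 0 ≤ a → a < b → (a * M a) ^ 2 / 2 - (L a ^ 2 - 1) ^ 2 / 4 <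
      (b * M b) ^ 2 / 2 - (L b ^ 2 - 1) ^ 2 / 4 := fun a b ha hab ↦
    h.energy hEeq (b := b) (fun s hs ↦ hM s hs.1) (fun s hs ↦ hL1 s hs.1) ⟨ha, hab.le⟩
      ⟨ha.trans hab.le, le_rfl⟩ hab
  set H := (1 * M 1) ^ 2 / 2 - (L 1 ^ 2 - 1) ^ 2 / 4 with hH
  have hH0 : 0 < H := by
    have := hen 0 1 le_rfl one_pos
    simp only [h.2.2.2.2.1] at this
    norm_num at this
    rw [hH]; linarith
  have hp : ∀ s, 1 < s → √(2 * H) ≤ s * M s := by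
    intro s hs
    apply Real.sqrt_le_iff.2
    refine ⟨(mul_pos (by linarith) (hM s (by linarith))).le, ?_⟩
    nlinarith [hen 1 s zero_le_one hs, sq_nonneg (L s ^ 2 - 1)]
  set c := √(2 * H) with hc
  have hc0 : 0 < c := Real.sqrt_pos.2 (by linarith)
  have cL := h.contL.mono (fun x (hx : x ∈ Ici (1:ℝ)) ↦ mem_Ici.2 (zero_le_one.trans (mem_Ici.1 hx)))
  have hmono : MonotoneOn (fun s ↦ L s - c * Real.log s) (Ici 1) := by
    have hd : ∀ x, 0 < x → HasDerivAt (fun s ↦ L s - c * Real.log s) (M x - c * x⁻¹) x :=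
      fun x hx ↦ (h.1 x hx).sub ((Real.hasDerivAt_log hx.ne').const_mul c)
    apply monotoneOn_of_deriv_nonneg (convex_Ici _)
    · intro x hx
      exact (hd x (zero_lt_one.trans_le hx)).continuousAt.continuousWithinAt
    · intro x hx
      rw [interior_Ici] at hx
      exact (hd x (zero_lt_one.trans hx)).differentiableAt.differentiableWithinAt
    · intro x hx
      rw [interior_Ici] at hx
      have hx0 : 0 < x := zero_lt_one.trans hx
      rw [(hd x hx0).deriv]
      have := hp x hx
      rw [sub_nonneg, ← div_eq_mul_inv, div_le_iff₀ hx0]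
      linarith
  have h3 : 1 ≤ Real.exp (3 / c) := Real.one_le_exp (by positivity)
  have h1 := hmono (mem_Ici.2 le_rfl) (mem_Ici.2 h3) h3
  simp only [Real.log_one, Real.log_exp] at h1
  have h4 : c * (3 / c) = 3 := by field_simp
  have h5 := (h.strictMono_of_pos (b := 1) (fun s hs ↦ hM s hs.1)) ⟨le_rfl, zero_le_one⟩
    ⟨zero_le_one, le_rfl⟩ one_pos
  rw [h.2.2.2.2.1] at h5
  have h6 := hL1 (Real.exp (3 / c)) (by positivity)
  linarith

/-- The autonomous vector field in logarithmic time. -/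
def smV (E : ℝ → ℝ) : ℝ × ℝ → ℝ × ℝ := fun x ↦ (x.2, x.2 + E x.1)

theorem smV_lip {E : ℝ → ℝ} (hE : ContDiff ℝ (⊤ : ℕ∞) E) (hE0 : ∀ x : ℝ, 3 ≤ |x| → E x = 0) :
    ∃ K : NNReal, LipschitzWith K (smV E) := by
  have hs : HasCompactSupport E := by
    apply HasCompactSupport.of_support_subset_isCompact (isCompact_Icc (a := (-3:ℝ)) (b := 3))
    intro x hx
    by_contra hc
    apply hx
    apply hE0
    by_contra! h
    exact hc (abs_le.1 h.le)
  obtain ⟨C, hC⟩ := ContDiff.lipschitzWith_of_hasCompactSupport (𝕂 := ℝ) hs hE (by simp)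
  exact ⟨_, LipschitzWith.prod_snd.prodMk
    (LipschitzWith.prod_snd.add (hC.comp LipschitzWith.prod_fst))⟩

theorem sm_log {E L M : ℝ → ℝ} {t : ℝ} (h1 : HasDerivAt L (M (Real.exp t)) (Real.exp t))
    (h2 : HasDerivAt M (E (L (Real.exp t)) / Real.exp t ^ 2) (Real.exp t)) :
    HasDerivAt (fun t ↦ (L (Real.exp t), Real.exp t * M (Real.exp t)))
      (smV E (L (Real.exp t), Real.exp t * M (Real.exp t))) t := by
  have he := Real.hasDerivAt_exp t
  have d1 := h1.comp t he
  have d2 := he.mul (h2.comp t he)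
  have d := d1.prodMk d2
  refine d.congr_deriv ?_
  have := (Real.exp_pos t).ne'
  simp only [smV, Prod.mk.injEq, Function.comp]
  constructor
  · ring
  · field_simp

theorem SolS.unique_near {E L M L' M' : ℝ → ℝ} (h : SolS E L M) (h' : SolS E L' M')
    (hEeq : ∀ x : ℝ, |x| ≤ 2 → E x = x ^ 3 - x) :
    ∃ δ > 0, ∀ s ∈ Icc 0 δ, L s = L' s := by
  obtain ⟨δ1, hδ1, ha⟩ := h.asympL (ε := 1 / 2) (by norm_num)
  obtain ⟨δ2, hδ2, hb⟩ := h'.asympL (ε := 1 / 2) (by norm_num)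
  obtain ⟨δ, hδ, hd1, hd2, hd3⟩ : ∃ δ > 0, δ ≤ δ1 ∧ δ ≤ δ2 ∧ δ ≤ 1 / 2 :=
    ⟨min δ1 (min δ2 (1 / 2)), by positivity, by simp, by simp, by simp⟩
  have ha' : ∀ s ∈ Icc 0 δ, 0 ≤ L s + 1 ∧ L s + 1 ≤ s ^ 2 := fun s hs ↦ by
    have := abs_le.1 (ha s ⟨hs.1, hs.2.trans hd1⟩)
    constructor <;> linarith
  have hb' : ∀ s ∈ Icc 0 δ, 0 ≤ L' s + 1 ∧ L' s + 1 ≤ s ^ 2 := fun s hs ↦ by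
    have := abs_le.1 (hb s ⟨hs.1, hs.2.trans hd2⟩)
    constructor <;> linarith
  have sub : ∀ x, x ∈ Icc 0 δ → x ∈ Ici (0:ℝ) := fun x hx ↦ hx.1
  have cL := h.contL.mono sub
  have cM := h.contM.mono sub
  have cL' := h'.contL.mono sub
  have cM' := h'.contM.mono sub
  have key : ∀ A : ℝ, 0 ≤ A → (∀ s ∈ Icc 0 δ, |L s - L' s| ≤ A * s ^ 2) →
      ∀ s ∈ Icc 0 δ, |L s - L' s| ≤ A / 2 * s ^ 2 := by
    intro A hA hw
    have hQ : ∀ s ∈ Icc 0 δ, |s ^ 2 * (M s - M' s) - 2 * s * (L s - L' s)| ≤ 7 / 5 * A * s ^ 5 := by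
      apply sm_mvt _ (fun s ↦ E (L s) - E (L' s) - 2 * (L s - L' s)) _ (fun s ↦ 7 * A * s ^ 4) δ
        (by fun_prop) (by fun_prop) (by simp) (by simp)
      · intro x hx
        have d := (((hasDerivAt_id x).pow 2).mul ((h.2.1 x hx.1).sub (h'.2.1 x hx.1))).sub
          (((hasDerivAt_id x).const_mul 2).mul ((h.1 x hx.1).sub (h'.1 x hx.1)))
        refine d.congr_deriv ?_
        have := hx.1.ne'
        simp
        field_simp
        ring
      · intro x hx
        refine (((hasDerivAt_id x).pow 5).const_mul (7 / 5 * A)).congr_deriv ?_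
        simp
        ring
      · intro x hx
        have hx' := Ioo_subset_Icc_self hx
        obtain ⟨a1, a2⟩ := ha' x hx'
        obtain ⟨b1, b2⟩ := hb' x hx'
        have hx2 : x ^ 2 ≤ 1 / 4 := by nlinarith [hx.1, hx.2]
        rw [hEeq (L x) (abs_le.2 ⟨by linarith, by linarith⟩),
          hEeq (L' x) (abs_le.2 ⟨by linarith, by linarith⟩)]
        obtain ⟨a, hae⟩ : ∃ a, a = L x + 1 := ⟨_, rfl⟩
        obtain ⟨b, hbe⟩ : ∃ b, b = L' x + 1 := ⟨_, rfl⟩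
        have e1 : L x = a - 1 := by linarith
        have e2 : L' x = b - 1 := by linarith
        have hw' := hw x hx'
        rw [← hae] at a1 a2
        rw [← hbe] at b1 b2
        rw [e1, e2] at hw' ⊢
        have e3 : (a - 1) ^ 3 - (a - 1) - ((b - 1) ^ 3 - (b - 1)) - 2 * (a - 1 - (b - 1)) =
          (a - 1 - (b - 1)) * (-3 * (a + b) + a ^ 2 + a * b + b ^ 2) := by ring
        rw [e3, abs_mul]
        have e4 : |-3 * (a + b) + a ^ 2 + a * b + b ^ 2| ≤ 7 * x ^ 2 := by
          rw [abs_le]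
          constructor <;> nlinarith [mul_nonneg a1 b1, sq_nonneg a, sq_nonneg b, sq_nonneg x]
        calc _ ≤ (A * x ^ 2) * (7 * x ^ 2) := by gcongr
          _ = _ := by ring
    have hz : ∀ s ∈ Icc 0 δ, |(L s - L' s) / s ^ 2| ≤ 7 / 10 * A * s ^ 2 := by
      apply sm_mvt _ (fun s ↦ (s ^ 2 * (M s - M' s) - 2 * s * (L s - L' s)) / s ^ 4) _
        (fun s ↦ 7 / 5 * A * s) δ ?_ (by fun_prop) (by simp) (by simp)
      · intro x hx
        have hx0 := hx.1.ne'
        have d := ((h.1 x hx.1).sub (h'.1 x hx.1)).div ((hasDerivAt_id x).pow 2) (by simpa using hx0)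
        refine d.congr_deriv ?_
        simp
        field_simp
      · intro x hx
        refine (((hasDerivAt_id x).pow 2).const_mul (7 / 10 * A)).congr_deriv ?_
        simp
        ring
      · intro x hx
        have hx0 := hx.1
        rw [abs_div, abs_of_pos (show 0 < x ^ 4 by positivity), div_le_iff₀ (by positivity)]
        refine (hQ x (Ioo_subset_Icc_self hx)).trans_eq (by ring)
      · intro x hx
        rcases eq_or_lt_of_le hx.1 with rfl | hx0
        · rw [Metric.continuousWithinAt_iff]
          intro ε hε
          obtain ⟨η1, hη1, k1⟩ := h.asympL (ε := ε / 3) (by positivity)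
          obtain ⟨η2, hη2, k2⟩ := h'.asympL (ε := ε / 3) (by positivity)
          refine ⟨min η1 η2, by positivity, fun {y} hy hyd ↦ ?_⟩
          rw [Real.dist_eq] at hyd
          rw [Real.dist_eq]
          simp only [sub_zero, ne_eq, OfNat.ofNat_ne_zero, not_false_eq_true, zero_pow, div_zero]
            at hyd ⊢
          rw [abs_of_nonneg hy.1] at hyd
          rcases eq_or_lt_of_le hy.1 with rfl | hy0
          · simpa using hε
          have l1 := abs_le.1 (k1 y ⟨hy.1, hyd.le.trans (min_le_left _ _)⟩)
          have l2 := abs_le.1 (k2 y ⟨hy.1, hyd.le.trans (min_le_right _ _)⟩)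
          have hy2 : 0 < y ^ 2 := by positivity
          rw [abs_div, abs_of_pos hy2, div_lt_iff₀ hy2, abs_lt]
          have : 0 < ε * y ^ 2 := by positivity
          constructor <;> linarith
        · have c1 := cL x hx
          have c2 := cL' x hx
          exact (c1.sub c2).div (by fun_prop) (by positivity)
    intro s hs
    rcases eq_or_lt_of_le hs.1 with rfl | hs0
    · simp [h.2.2.2.2.1, h'.2.2.2.2.1]
    have h1 := hz s hs
    have hs2 : 0 < s ^ 2 := by positivity
    rw [abs_div, abs_of_pos hs2, div_le_iff₀ hs2] at h1
    refine h1.trans ?_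
    gcongr
    have : s ^ 2 ≤ 1 / 4 := by nlinarith [hs.2]
    nlinarith
  refine ⟨δ, hδ, fun s hs ↦ ?_⟩
  have hn : ∀ n : ℕ, ∀ s ∈ Icc 0 δ, |L s - L' s| ≤ (1 / 2) ^ n * s ^ 2 := by
    intro n
    induction n with
    | zero =>
      intro s hs
      have := ha' s hs
      have := hb' s hs
      rw [pow_zero, one_mul, abs_le]
      constructor <;> linarith
    | succ n ih =>
      intro s hs
      refine (key _ (by positivity) ih s hs).trans_eq ?_
      ring
  have hlim : Tendsto (fun n : ℕ ↦ ((1:ℝ) / 2) ^ n * s ^ 2) atTop (𝓝 (0 * s ^ 2)) :=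
    (tendsto_pow_atTop_nhds_zero_of_lt_one (by norm_num) (by norm_num)).mul_const _
  rw [zero_mul] at hlim
  have := ge_of_tendsto' hlim (fun n ↦ hn n s hs)
  linarith [abs_eq_zero.1 (le_antisymm this (abs_nonneg _))]

theorem SolS.unique {E L M L' M' : ℝ → ℝ} (h : SolS E L M) (h' : SolS E L' M')
    (hE : ContDiff ℝ (⊤ : ℕ∞) E) (hE0 : ∀ x : ℝ, 3 ≤ |x| → E x = 0)
    (hEeq : ∀ x : ℝ, |x| ≤ 2 → E x = x ^ 3 - x) : ∀ s, 0 ≤ s → L s = L' s := by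
  obtain ⟨δ, hδ, hn⟩ := h.unique_near h' hEeq
  obtain ⟨K, hK⟩ := smV_lip hE hE0
  have hd2 : 0 < δ / 2 := by positivity
  have hM : M (δ / 2) = M' (δ / 2) := by
    refine (h.1 _ hd2).unique ((h'.1 _ hd2).congr_of_eventuallyEq ?_)
    filter_upwards [Icc_mem_nhds hd2 (half_lt_self hδ)] with s hs using hn s hs
  have heq := ODE_solution_unique_univ (v := fun _ ↦ smV E) (s := fun _ ↦ univ) (K := K)
    (t₀ := Real.log (δ / 2))
    (f := fun t ↦ (L (Real.exp t), Real.exp t * M (Real.exp t)))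
    (g := fun t ↦ (L' (Real.exp t), Real.exp t * M' (Real.exp t)))
    (fun _ ↦ hK.lipschitzOnWith)
    (fun t ↦ ⟨sm_log (h.1 _ (Real.exp_pos t)) (h.2.1 _ (Real.exp_pos t)), mem_univ _⟩)
    (fun t ↦ ⟨sm_log (h'.1 _ (Real.exp_pos t)) (h'.2.1 _ (Real.exp_pos t)), mem_univ _⟩)
    (by
      simp only [Real.exp_log hd2]
      rw [hM, hn _ ⟨hd2.le, (half_lt_self hδ).le⟩])
  intro s hs
  rcases eq_or_lt_of_le hs with rfl | hs0
  · rw [h.2.2.2.2.1, h'.2.2.2.2.1]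
  · have := congrArg Prod.fst (congrFun heq (Real.log s))
    simpa [Real.exp_log hs0] using this

/-- Clamp to `[0, 1/2]`. -/
noncomputable def smC (x : ℝ) : ℝ := max 0 (min x (1 / 2))

theorem smC_nonneg (x : ℝ) : 0 ≤ smC x := le_max_left _ _

theorem smC_le (x : ℝ) : smC x ≤ 1 / 2 := max_le (by norm_num) (min_le_right _ _)

theorem smC_cont : Continuous smC := by unfold smC; fun_prop

theorem smC_eq {x : ℝ} (h0 : 0 ≤ x) (h1 : x ≤ 1 / 2) : smC x = x := by
  unfold smC; rw [min_eq_left h1, max_eq_right h0]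

theorem smC_lip (x y : ℝ) : |smC x - smC y| ≤ |x - y| := by
  unfold smC
  have h1 := abs_max_sub_max_le_max 0 (min x (1 / 2)) 0 (min y (1 / 2))
  have h2 := abs_min_sub_min_le_max x (1 / 2) y (1 / 2)
  simp only [sub_self, abs_zero] at h1 h2
  exact (h1.trans (max_le (abs_nonneg _) le_rfl)).trans (h2.trans (max_le le_rfl (abs_nonneg _)))

/-- The nonlinearity for `z = (l + 1) / s ^ 2`, clamped. -/
noncomputable def smF (τ x : ℝ) : ℝ := smC x ^ 2 * (-3 + τ ^ 2 * smC x)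

theorem smF_bound {τ : ℝ} (h0 : 0 ≤ τ) (h1 : τ ≤ 1) (x : ℝ) : smF τ x ≤ 0 ∧ |smF τ x| ≤ 3 / 4 := by
  unfold smF
  have a := smC_nonneg x
  have b := smC_le x
  have t : τ ^ 2 ≤ 1 := by nlinarith
  have t0 : 0 ≤ τ ^ 2 := sq_nonneg τ
  have t1 : 0 ≤ τ ^ 2 * smC x := by positivity
  have t2 : τ ^ 2 * smC x ≤ 1 / 2 := by nlinarith
  have t3 : smC x ^ 2 ≤ 1 / 4 := by nlinarith
  have t4 : 0 ≤ smC x ^ 2 := sq_nonneg _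
  refine ⟨by nlinarith, ?_⟩
  rw [abs_le]
  constructor <;> nlinarith

theorem smF_lip {τ : ℝ} (h0 : 0 ≤ τ) (h1 : τ ≤ 1) (x y : ℝ) :
    |smF τ x - smF τ y| ≤ 3 * |x - y| := by
  unfold smF
  have a := smC_nonneg x
  have b := smC_le x
  have a' := smC_nonneg y
  have b' := smC_le y
  have l := smC_lip x y
  set c := smC x
  set d := smC y
  have e : c ^ 2 * (-3 + τ ^ 2 * c) - d ^ 2 * (-3 + τ ^ 2 * d) =
    (-3 * (c + d) + τ ^ 2 * (c ^ 2 + c * d + d ^ 2)) * (c - d) := by ring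
  rw [e, abs_mul]
  have t : τ ^ 2 ≤ 1 := by nlinarith
  have q0 : 0 ≤ c ^ 2 + c * d + d ^ 2 := by positivity
  have q1 : c ^ 2 + c * d + d ^ 2 ≤ 3 / 4 := by nlinarith
  have t0 : 0 ≤ τ ^ 2 := sq_nonneg τ
  have r0 : 0 ≤ τ ^ 2 * (c ^ 2 + c * d + d ^ 2) := by positivity
  have r1 : τ ^ 2 * (c ^ 2 + c * d + d ^ 2) ≤ 3 / 4 := by nlinarith
  have m : |-3 * (c + d) + τ ^ 2 * (c ^ 2 + c * d + d ^ 2)| ≤ 3 := by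
    rw [abs_le]; constructor <;> linarith
  gcongr

/-- `q(σ) = σ ∫₀¹ θ⁴ F(θσ, z(θσ)) dθ`. -/
noncomputable def smQ (z : ℝ → ℝ) (σ : ℝ) : ℝ :=
  σ * ∫ θ in (0:ℝ)..1, θ ^ 4 * smF (θ * σ) (z (θ * σ))

theorem smF_cont {z : ℝ → ℝ} (hz : Continuous z) : Continuous (fun τ ↦ smF τ (z τ)) := by
  unfold smF
  have := smC_cont
  fun_prop

theorem smQ_cont {z : ℝ → ℝ} (hz : Continuous z) : Continuous (smQ z) := by
  unfold smQ
  refine continuous_id.mul ?_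
  apply intervalIntegral.continuous_parametric_intervalIntegral_of_continuous'
  have := smF_cont hz
  have h2 : Continuous (fun p : ℝ × ℝ ↦ smF (p.2 * p.1) (z (p.2 * p.1))) :=
    this.comp (continuous_snd.mul continuous_fst)
  exact (continuous_snd.pow 4).mul h2

theorem smQ_bound (z : ℝ → ℝ) {σ : ℝ} (h0 : 0 ≤ σ) (h1 : σ ≤ 1 / 2) :
    |smQ z σ| ≤ 3 / 8 ∧ smQ z σ ≤ 0 := by
  have hb : ∀ θ ∈ Icc (0:ℝ) 1, 0 ≤ θ * σ ∧ θ * σ ≤ 1 := fun θ hθ ↦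
    ⟨mul_nonneg hθ.1 h0, by nlinarith [hθ.1, hθ.2]⟩
  unfold smQ
  constructor
  · have : ‖∫ θ in (0:ℝ)..1, θ ^ 4 * smF (θ * σ) (z (θ * σ))‖ ≤ 3 / 4 * |1 - 0| := by
      apply intervalIntegral.norm_integral_le_of_norm_le_const
      intro θ hθ
      rw [uIoc_of_le zero_le_one] at hθ
      have hθ' := Ioc_subset_Icc_self hθ
      have := (smF_bound (hb θ hθ').1 (hb θ hθ').2 (z (θ * σ))).2
      rw [norm_mul, Real.norm_eq_abs, Real.norm_eq_abs, abs_of_nonneg (pow_nonneg hθ'.1 4)]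
      have h4 : θ ^ 4 ≤ 1 := pow_le_one₀ hθ'.1 hθ'.2
      calc _ ≤ 1 * (3 / 4 : ℝ) := by gcongr
        _ = _ := by norm_num
    rw [Real.norm_eq_abs] at this
    rw [abs_mul, abs_of_nonneg h0]
    norm_num at this
    nlinarith [abs_nonneg (∫ θ in (0:ℝ)..1, θ ^ 4 * smF (θ * σ) (z (θ * σ)))]
  · apply mul_nonpos_of_nonneg_of_nonpos h0
    have : 0 ≤ ∫ θ in (0:ℝ)..1, -(θ ^ 4 * smF (θ * σ) (z (θ * σ))) := by
      apply intervalIntegral.integral_nonneg zero_le_one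
      intro θ hθ
      have := (smF_bound (hb θ hθ).1 (hb θ hθ).2 (z (θ * σ))).1
      have h4 : 0 ≤ θ ^ 4 := pow_nonneg hθ.1 4
      nlinarith
    rw [intervalIntegral.integral_neg] at this
    linarith

theorem smQ_lip {z w : ℝ → ℝ} (hz : Continuous z) (hw : Continuous w) {D : ℝ}
    (hD : ∀ x, |z x - w x| ≤ D) {σ : ℝ} (h0 : 0 ≤ σ) (h1 : σ ≤ 1 / 2) :
    |smQ z σ - smQ w σ| ≤ 3 / 2 * D := by
  have hb : ∀ θ ∈ Icc (0:ℝ) 1, 0 ≤ θ * σ ∧ θ * σ ≤ 1 := fun θ hθ ↦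
    ⟨mul_nonneg hθ.1 h0, by nlinarith [hθ.1, hθ.2]⟩
  have hi : ∀ z : ℝ → ℝ, Continuous z →
      Continuous (fun θ : ℝ ↦ θ ^ 4 * smF (θ * σ) (z (θ * σ))) := fun z hz ↦ by
    have := (smF_cont hz).comp (continuous_id.mul (continuous_const (y := σ)))
    exact (continuous_id.pow 4).mul this
  unfold smQ
  rw [← mul_sub, ← intervalIntegral.integral_sub ((hi z hz).intervalIntegrable _ _)
    ((hi w hw).intervalIntegrable _ _), abs_mul, abs_of_nonneg h0]
  have : ‖∫ θ in (0:ℝ)..1, (θ ^ 4 * smF (θ * σ) (z (θ * σ)) - θ ^ 4 * smF (θ * σ) (w (θ * σ)))‖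
      ≤ (3 * D) * |1 - 0| := by
    apply intervalIntegral.norm_integral_le_of_norm_le_const
    intro θ hθ
    rw [uIoc_of_le zero_le_one] at hθ
    have hθ' := Ioc_subset_Icc_self hθ
    have := smF_lip (hb θ hθ').1 (hb θ hθ').2 (z (θ * σ)) (w (θ * σ))
    rw [← mul_sub, norm_mul, Real.norm_eq_abs, Real.norm_eq_abs,
      abs_of_nonneg (pow_nonneg hθ'.1 4)]
    have h4 : θ ^ 4 ≤ 1 := pow_le_one₀ hθ'.1 hθ'.2
    calc _ ≤ 1 * (3 * |z (θ * σ) - w (θ * σ)|) := by gcongr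
      _ ≤ _ := by linarith [hD (θ * σ)]
  rw [Real.norm_eq_abs] at this
  norm_num at this
  nlinarith [abs_nonneg (∫ θ in (0:ℝ)..1,
    (θ ^ 4 * smF (θ * σ) (z (θ * σ)) - θ ^ 4 * smF (θ * σ) (w (θ * σ))))]

theorem sm_fixed : ∃ z : ℝ → ℝ, Continuous z ∧
    ∀ s ∈ Icc (0:ℝ) (1 / 2), z s = 1 / 2 + ∫ σ in (0:ℝ)..s, smQ z σ := by
  have hcl : ∀ s (σ : ℝ), σ ∈ uIoc 0 (smC s) → 0 ≤ σ ∧ σ ≤ 1 / 2 := by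
    intro s σ hσ
    rw [uIoc_of_le (smC_nonneg s)] at hσ
    exact ⟨hσ.1.le, hσ.2.trans (smC_le s)⟩
  have habs : ∀ s, |smC s - 0| ≤ 1 / 2 := fun s ↦ by
    rw [sub_zero, abs_of_nonneg (smC_nonneg s)]; exact smC_le s
  let T : BoundedContinuousFunction ℝ ℝ → BoundedContinuousFunction ℝ ℝ := fun z ↦
    BoundedContinuousFunction.ofNormedAddCommGroup
      (fun s ↦ 1 / 2 + ∫ σ in (0:ℝ)..(smC s), smQ z σ)
      (by
        have h1 : Continuous (fun x : ℝ ↦ ∫ σ in (0:ℝ)..x, smQ z σ) :=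
          intervalIntegral.continuous_primitive
            (fun a b ↦ (smQ_cont z.continuous).intervalIntegrable a b) 0
        exact continuous_const.add (h1.comp smC_cont)) 1
      (by
        intro s
        have : ‖∫ σ in (0:ℝ)..(smC s), smQ z σ‖ ≤ 3 / 8 * |smC s - 0| := by
          apply intervalIntegral.norm_integral_le_of_norm_le_const
          intro σ hσ
          exact (smQ_bound z (hcl s σ hσ).1 (hcl s σ hσ).2).1
        refine (norm_add_le _ _).trans ?_
        have h3 : ‖(1 / 2 : ℝ)‖ = 1 / 2 := by norm_num
        rw [h3]
        linarith [habs s])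
  have hT : ContractingWith (3 / 4) T := by
    refine ⟨by
      rw [← NNReal.coe_lt_coe]; norm_num, ?_⟩
    apply LipschitzWith.of_dist_le_mul
    intro z w
    rw [BoundedContinuousFunction.dist_le (by positivity)]
    intro s
    have hD : ∀ x, |z x - w x| ≤ dist z w := fun x ↦ by
      rw [← Real.dist_eq]; exact BoundedContinuousFunction.dist_coe_le_dist x
    have e : T z s - T w s = ∫ σ in (0:ℝ)..(smC s), (smQ z σ - smQ w σ) := by
      rw [intervalIntegral.integral_sub ((smQ_cont z.continuous).intervalIntegrable _ _)
        ((smQ_cont w.continuous).intervalIntegrable _ _)]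
      simp [T]
    rw [dist_eq_norm, e]
    have : ‖∫ σ in (0:ℝ)..(smC s), (smQ z σ - smQ w σ)‖ ≤ (3 / 2 * dist z w) * |smC s - 0| := by
      apply intervalIntegral.norm_integral_le_of_norm_le_const
      intro σ hσ
      exact smQ_lip z.continuous w.continuous hD (hcl s σ hσ).1 (hcl s σ hσ).2
    refine this.trans ?_
    push_cast
    nlinarith [habs s, dist_nonneg (x := z) (y := w)]
  have hfix : T hT.fixedPoint = hT.fixedPoint := hT.fixedPoint_isFixedPt
  refine ⟨hT.fixedPoint, hT.fixedPoint.continuous, fun s hs ↦ ?_⟩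
  have := DFunLike.congr_fun hfix s
  rw [← this]
  simp only [T, BoundedContinuousFunction.coe_ofNormedAddCommGroup]
  rw [smC_eq hs.1 hs.2]

theorem sm_deriv_zero {g : ℝ → ℝ} (hg : Continuous g) : HasDerivAt (fun s ↦ s * g s) (g 0) 0 := by
  rw [hasDerivAt_iff_tendsto_slope]
  have : Tendsto g (𝓝[≠] 0) (𝓝 (g 0)) := hg.continuousAt.tendsto.mono_left nhdsWithin_le_nhds
  refine this.congr' ?_
  filter_upwards [self_mem_nhdsWithin] with s hs
  have : s ≠ 0 := hs
  simp [slope_def_field]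
  field_simp

theorem sm_local {E : ℝ → ℝ} (hEeq : ∀ x : ℝ, |x| ≤ 2 → E x = x ^ 3 - x) :
    ∃ L M : ℝ → ℝ, (∀ s ∈ Ioo (0:ℝ) (1 / 2), HasDerivAt L (M s) s ∧
      HasDerivAt M (E (L s) / s ^ 2) s) ∧
      HasDerivAt L 0 0 ∧ HasDerivAt M 1 0 ∧ L 0 = -1 ∧ M 0 = 0 := by
  obtain ⟨z, hz, hfix⟩ := sm_fixed
  have hq := smQ_cont hz
  have hφ := smF_cont hz
  have hz0 : z 0 = 1 / 2 := by simpa using hfix 0 ⟨le_rfl, by norm_num⟩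
  have hzb : ∀ s ∈ Icc (0:ℝ) (1 / 2), 0 ≤ z s ∧ z s ≤ 1 / 2 := by
    intro s hs
    rw [hfix s hs]
    have h1 : ‖∫ σ in (0:ℝ)..s, smQ z σ‖ ≤ 3 / 8 * |s - 0| := by
      apply intervalIntegral.norm_integral_le_of_norm_le_const
      intro σ hσ
      rw [uIoc_of_le hs.1] at hσ
      exact (smQ_bound z hσ.1.le (hσ.2.trans hs.2)).1
    have h2 : 0 ≤ ∫ σ in (0:ℝ)..s, -smQ z σ := by
      apply intervalIntegral.integral_nonneg hs.1
      intro σ hσ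
      linarith [(smQ_bound z hσ.1 (hσ.2.trans hs.2)).2]
    rw [intervalIntegral.integral_neg] at h2
    rw [sub_zero, abs_of_nonneg hs.1, Real.norm_eq_abs] at h1
    have h3 := (abs_le.1 h1).1
    constructor <;> linarith [hs.2]
  have hI : ∀ s, s ^ 4 * smQ z s = ∫ τ in (0:ℝ)..s, τ ^ 4 * smF τ (z τ) := by
    intro s
    have := intervalIntegral.smul_integral_comp_mul_right (a := 0) (b := 1)
      (fun τ ↦ τ ^ 4 * smF τ (z τ)) s
    rw [zero_mul, one_mul] at this
    rw [← this, smQ, smul_eq_mul, ← mul_assoc, mul_comm (s ^ 4) s, mul_assoc,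
      ← intervalIntegral.integral_const_mul]
    congr 2
    ext θ
    ring
  refine ⟨fun s ↦ s * (s * z s) - 1, fun s ↦ s * (2 * z s + s * smQ z s), ?_, ?_, ?_, by simp,
    by simp⟩
  · intro s hs
    have hs' := Ioo_subset_Icc_self hs
    have hs0 := hs.1.ne'
    have dz : HasDerivAt z (smQ z s) s := by
      have h1 : HasDerivAt (fun x ↦ 1 / 2 + ∫ σ in (0:ℝ)..x, smQ z σ) (smQ z s) s :=
        (hq.integral_hasStrictDerivAt 0 s).hasDerivAt.const_add _
      refine h1.congr_of_eventuallyEq ?_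
      filter_upwards [Icc_mem_nhds hs.1 hs.2] with x hx using hfix x hx
    constructor
    · refine (((hasDerivAt_id s).mul ((hasDerivAt_id s).mul dz)).sub_const 1).congr_deriv ?_
      simp
      ring
    · have dI : HasDerivAt (fun x ↦ ∫ τ in (0:ℝ)..x, τ ^ 4 * smF τ (z τ))
          (s ^ 4 * smF s (z s)) s :=
        (((continuous_id.pow 4).mul hφ).integral_hasStrictDerivAt 0 s).hasDerivAt
      have d1 : HasDerivAt (fun x ↦ x * (2 * z x) +
          (∫ τ in (0:ℝ)..x, τ ^ 4 * smF τ (z τ)) / x ^ 2) _ s :=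
        ((hasDerivAt_id s).mul (dz.const_mul 2)).add
          (dI.div ((hasDerivAt_id s).pow 2) (by simpa using hs0))
      have hev : (fun s ↦ s * (2 * z s + s * smQ z s)) =ᶠ[𝓝 s] (fun x ↦ x * (2 * z x) +
          (∫ τ in (0:ℝ)..x, τ ^ 4 * smF τ (z τ)) / x ^ 2) := by
        filter_upwards [Ioi_mem_nhds hs.1] with x hx
        have hx0 : x ≠ 0 := (mem_Ioi.1 hx).ne'
        rw [← hI x]
        field_simp
      have d2 := d1.congr_of_eventuallyEq hev
      refine d2.congr_deriv ?_
      obtain ⟨b0, b1⟩ := hzb s hs'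
      have s2 : s ^ 2 ≤ 1 / 4 := by nlinarith [hs.1, hs.2]
      have u0 : 0 ≤ s * (s * z s) := mul_nonneg hs.1.le (mul_nonneg hs.1.le b0)
      have u1 : s * (s * z s) ≤ 1 := by nlinarith
      rw [hEeq _ (abs_le.2 ⟨by linarith, by linarith⟩), ← hI s]
      simp only [smF, smC_eq b0 b1]
      simp
      field_simp
      ring
  · have := (sm_deriv_zero (g := fun s ↦ s * z s) (by fun_prop)).sub_const 1
    simpa using this
  · have := sm_deriv_zero (g := fun s ↦ 2 * z s + s * smQ z s) (by fun_prop)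
    simpa [hz0] using this

theorem SolS.exists {E : ℝ → ℝ} (hE : ContDiff ℝ (⊤ : ℕ∞) E)
    (hE0 : ∀ x : ℝ, 3 ≤ |x| → E x = 0)
    (hEeq : ∀ x : ℝ, |x| ≤ 2 → E x = x ^ 3 - x) : ∃ L M, SolS E L M := by
  obtain ⟨L0, M0, hd, hL0, hM0, hl, hm⟩ := sm_local hEeq
  obtain ⟨K, hK⟩ := smV_lip hE hE0
  have hc : ContDiff ℝ 1 (smV E) := by
    have h1 : ContDiff ℝ 1 E := hE.of_le (by exact_mod_cast le_top)
    unfold smV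
    fun_prop
  have hv0 : smV E 0 = 0 := by
    have := hEeq 0 (by simp)
    simp [smV, this]
  obtain ⟨γ, hγ0, hγ⟩ := sm_global_curve (smV E) K hK hc hv0 (L0 (1 / 4), 1 / 4 * M0 (1 / 4))
  set c := Real.log (1 / 4) with hcdef
  have hΓ : ∀ t, HasDerivAt (fun t ↦ γ (t - c)) (smV E (γ (t - c))) t := fun t ↦
    (hγ (t - c)).comp_sub_const t c
  have hexp : ∀ t, t < Real.log (1 / 2) → Real.exp t < 1 / 2 := fun t ht ↦ by
    rwa [← Real.lt_log_iff_exp_lt (by norm_num)]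
  have hagree : ∀ s ∈ Ioo (0:ℝ) (1 / 2), γ (Real.log s - c) = (L0 s, s * M0 s) := by
    intro s hs
    have hc2 : c < Real.log (1 / 2) := Real.log_lt_log (by norm_num) (by norm_num)
    have hs2 : Real.log s < Real.log (1 / 2) := Real.log_lt_log hs.1 hs.2
    have hcl : min (Real.log s) c - 1 < c := by linarith [min_le_right (Real.log s) c]
    have hsl : min (Real.log s) c - 1 < Real.log s := by linarith [min_le_left (Real.log s) c]
    have := ODE_solution_unique_of_mem_Ioo (v := fun _ ↦ smV E) (s := fun _ ↦ univ) (K := K)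
      (a := min (Real.log s) c - 1) (b := Real.log (1 / 2)) (t₀ := c)
      (f := fun t ↦ γ (t - c))
      (g := fun t ↦ (L0 (Real.exp t), Real.exp t * M0 (Real.exp t)))
      (fun _ _ ↦ hK.lipschitzOnWith) ⟨hcl, hc2⟩
      (fun t _ ↦ ⟨hΓ t, mem_univ _⟩)
      (fun t ht ↦ ⟨sm_log (hd _ ⟨Real.exp_pos t, hexp t ht.2⟩).1
        (hd _ ⟨Real.exp_pos t, hexp t ht.2⟩).2, mem_univ _⟩)
      (by
        have e : Real.exp c = 1 / 4 := Real.exp_log (by norm_num)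
        simp only [sub_self, hγ0, e]) ⟨hsl, hs2⟩
    simpa [Real.exp_log hs.1] using this
  have hp : ∀ s, 0 < s → HasDerivAt (fun s ↦ γ (Real.log s - c))
      (s⁻¹ • smV E (γ (Real.log s - c))) s := fun s hs ↦
    (hΓ (Real.log s)).scomp s (Real.hasDerivAt_log hs.ne')
  have hp1 : ∀ s, 0 < s → HasDerivAt (fun s ↦ (γ (Real.log s - c)).1)
      (s⁻¹ * (γ (Real.log s - c)).2) s := fun s hs ↦ by
    have := (ContinuousLinearMap.fst ℝ ℝ ℝ).hasFDerivAt.comp_hasDerivAt s (hp s hs)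
    simpa [smV, Function.comp_def] using this
  have hp2 : ∀ s, 0 < s → HasDerivAt (fun s ↦ (γ (Real.log s - c)).2)
      (s⁻¹ * ((γ (Real.log s - c)).2 + E (γ (Real.log s - c)).1)) s := fun s hs ↦ by
    have := (ContinuousLinearMap.snd ℝ ℝ ℝ).hasFDerivAt.comp_hasDerivAt s (hp s hs)
    simpa [smV, Function.comp_def] using this
  let L : ℝ → ℝ := fun s ↦ if s ≤ 0 then -1 else (γ (Real.log s - c)).1
  let M : ℝ → ℝ := fun s ↦ if s ≤ 0 then 0 else (γ (Real.log s - c)).2 / s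
  have hLp : ∀ s, 0 < s → L s = (γ (Real.log s - c)).1 := fun s hs ↦ if_neg (not_le.2 hs)
  have hMp : ∀ s, 0 < s → M s = (γ (Real.log s - c)).2 / s := fun s hs ↦ if_neg (not_le.2 hs)
  have hL00 : L 0 = -1 := if_pos le_rfl
  have hM00 : M 0 = 0 := if_pos le_rfl
  have hmem : Iio (1 / 2 : ℝ) ∈ 𝓝[Ici 0] (0:ℝ) :=
    mem_nhdsWithin_of_mem_nhds (Iio_mem_nhds (by norm_num))
  refine ⟨L, M, fun s hs ↦ ?_, fun s hs ↦ ?_, ?_, ?_, hL00, hM00⟩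
  · have := (hp1 s hs).congr_of_eventuallyEq (f₁ := L)
      (by filter_upwards [Ioi_mem_nhds hs] with x hx using hLp x hx)
    refine this.congr_deriv ?_
    rw [hMp s hs]; ring
  · have := ((hp2 s hs).div (hasDerivAt_id s) hs.ne').congr_of_eventuallyEq (f₁ := M)
      (by filter_upwards [Ioi_mem_nhds hs] with x hx using hMp x hx)
    refine this.congr_deriv ?_
    rw [hLp s hs]
    have := hs.ne'
    simp only [id]
    field_simp
    ring
  · refine hL0.hasDerivWithinAt.congr_of_eventuallyEq ?_ (by rw [hL00, hl])
    filter_upwards [hmem, self_mem_nhdsWithin] with x hx hx0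
    rcases eq_or_lt_of_le (show (0:ℝ) ≤ x from hx0) with rfl | hx1
    · rw [hL00, hl]
    · rw [hLp x hx1, hagree x ⟨hx1, hx⟩]
  · refine hM0.hasDerivWithinAt.congr_of_eventuallyEq ?_ (by rw [hM00, hm])
    filter_upwards [hmem, self_mem_nhdsWithin] with x hx hx0
    rcases eq_or_lt_of_le (show (0:ℝ) ≤ x from hx0) with rfl | hx1
    · rw [hM00, hm]
    · rw [hMp x hx1, hagree x ⟨hx1, hx⟩]
      field_simp

theorem SolModel.toS {E l : ℝ → ℝ} (h : SolModel E l) :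
    SolS E (fun s ↦ l (s - 1)) (fun s ↦ derivWithin l (Ici (-1)) (s - 1)) := by
  obtain ⟨h1, h2, h3, h4, h5⟩ := h
  have hu : UniqueDiffOn ℝ (Ici (-1 : ℝ)) := uniqueDiffOn_Ici _
  have hl : DifferentiableOn ℝ l (Ici (-1)) := h1.differentiableOn (by norm_num)
  have hl' : DifferentiableOn ℝ (derivWithin l (Ici (-1))) (Ici (-1)) :=
    (h1.derivWithin hu (m := 1) (by norm_num)).differentiableOn (by norm_num)
  have hsh : ∀ s : ℝ, HasDerivWithinAt (fun s : ℝ ↦ s - 1) 1 (Ici 0) s := fun s ↦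
    ((hasDerivAt_id s).sub_const 1).hasDerivWithinAt
  have hmaps : MapsTo (fun s : ℝ ↦ s - 1) (Ici 0) (Ici (-1)) := fun s hs ↦ by
    have : (0:ℝ) ≤ s := hs
    show (-1:ℝ) ≤ s - 1
    linarith
  have key : ∀ f : ℝ → ℝ, DifferentiableOn ℝ f (Ici (-1)) → ∀ s : ℝ, 0 ≤ s →
      HasDerivWithinAt (fun s ↦ f (s - 1)) (derivWithin f (Ici (-1)) (s - 1)) (Ici 0) s := by
    intro f hf s hs
    have := (hf (s - 1) (hmaps hs)).hasDerivWithinAt.comp s (hsh s) hmaps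
    simpa [Function.comp_def] using this
  refine ⟨fun s hs ↦ ?_, fun s hs ↦ ?_, ?_, ?_, ?_, ?_⟩
  · exact (key l hl s hs.le).hasDerivAt (Ici_mem_nhds hs)
  · have := (key _ hl' s hs.le).hasDerivAt (Ici_mem_nhds hs)
    rw [h2 (s - 1) (by linarith)] at this
    simpa using this
  · have := key l hl 0 le_rfl
    rwa [show (0:ℝ) - 1 = -1 by norm_num, h4] at this
  · have := key _ hl' 0 le_rfl
    rwa [show (0:ℝ) - 1 = -1 by norm_num, h5] at this
  · simpa using h3
  · simpa using h4

theorem SolS.limN {E L M : ℝ → ℝ} (h : SolS E L M)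
    (hEeq : ∀ x : ℝ, |x| ≤ 2 → E x = x ^ 3 - x) :
    Tendsto (fun s ↦ E (L s) / s ^ 2) (𝓝[>] 0) (𝓝 1) := by
  have ha : Tendsto (fun s ↦ (L s + 1) / s ^ 2) (𝓝[>] 0) (𝓝 (1 / 2)) := by
    rw [Metric.tendsto_nhds]
    intro ε hε
    obtain ⟨δ, hδ, hh⟩ := h.asympL (ε := ε / 2) (by positivity)
    filter_upwards [Ioc_mem_nhdsGT hδ] with s hs
    have hs0 : 0 < s := hs.1
    have := hh s ⟨hs.1.le, hs.2⟩
    rw [Real.dist_eq, show (L s + 1) / s ^ 2 - 1 / 2 = (L s + 1 - s ^ 2 / 2) / s ^ 2 by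
      field_simp, abs_div, abs_of_pos (by positivity : 0 < s ^ 2), div_lt_iff₀ (by positivity)]
    have : 0 < ε * s ^ 2 := by positivity
    linarith
  have hL : Tendsto L (𝓝[>] 0) (𝓝 (-1)) := by
    have := (h.contL 0 self_mem_Ici).mono_left (nhdsWithin_mono 0 (Ioi_subset_Ici_self))
    rwa [h.2.2.2.2.1] at this
  have hlim : Tendsto (fun s ↦ (L s + 1) / s ^ 2 * (L s * (L s - 1))) (𝓝[>] 0) (𝓝 1) := by
    have := ha.mul (hL.mul (hL.sub_const 1))
    norm_num at this
    exact this
  refine hlim.congr' ?_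
  have : ∀ᶠ s in 𝓝[>] (0:ℝ), L s ∈ Ioo (-2 : ℝ) 0 :=
    hL.eventually (Ioo_mem_nhds (by norm_num) (by norm_num))
  filter_upwards [this] with s hs
  rw [hEeq _ (abs_le.2 ⟨hs.1.le, by linarith [hs.2]⟩)]
  ring

theorem SolS.toModel {E L M : ℝ → ℝ} (h : SolS E L M) (hE : Continuous E)
    (hEeq : ∀ x : ℝ, |x| ≤ 2 → E x = x ^ 3 - x) :
    SolModel E (fun r ↦ L (r + 1)) ∧
      ∀ r, -1 ≤ r → derivWithin (fun r ↦ L (r + 1)) (Ici (-1)) r = M (r + 1) := by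
  let N : ℝ → ℝ := fun s ↦ if s ≤ 0 then 1 else E (L s) / s ^ 2
  have hN : ∀ s, 0 < s → N s = E (L s) / s ^ 2 := fun s hs ↦ if_neg (not_le.2 hs)
  have hN0 : N 0 = 1 := if_pos le_rfl
  have hu : UniqueDiffOn ℝ (Ici (-1 : ℝ)) := uniqueDiffOn_Ici _
  have hNc : ContinuousOn N (Ici 0) := by
    intro s hs
    rcases eq_or_lt_of_le (show (0:ℝ) ≤ s from hs) with rfl | hs0
    · rw [← Ioi_insert, continuousWithinAt_insert_self]
      show Tendsto N _ _
      rw [hN0]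
      refine (h.limN hEeq).congr' ?_
      filter_upwards [self_mem_nhdsWithin] with x hx using (hN x hx).symm
    · have : ContinuousAt (fun s ↦ E (L s) / s ^ 2) s :=
        (hE.continuousAt.comp (h.1 s hs0).continuousAt).div (by fun_prop) (by positivity)
      refine (this.congr ?_).continuousWithinAt
      filter_upwards [Ioi_mem_nhds hs0] with x hx using (hN x hx).symm
  have hsh : ∀ s : ℝ, HasDerivWithinAt (fun s : ℝ ↦ s + 1) 1 (Ici (-1)) s := fun s ↦
    ((hasDerivAt_id s).add_const 1).hasDerivWithinAt
  have hmaps : MapsTo (fun s : ℝ ↦ s + 1) (Ici (-1)) (Ici 0) := fun s hs ↦ by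
    have : (-1:ℝ) ≤ s := hs
    show (0:ℝ) ≤ s + 1
    linarith
  have key : ∀ f g : ℝ → ℝ, (∀ s, 0 ≤ s → HasDerivWithinAt f (g s) (Ici 0) s) → ∀ s : ℝ, -1 ≤ s →
      HasDerivWithinAt (fun s ↦ f (s + 1)) (g (s + 1)) (Ici (-1)) s := by
    intro f g hf s hs
    have := (hf (s + 1) (hmaps hs)).comp s (hsh s) hmaps
    simpa [Function.comp_def] using this
  have d1 : ∀ r, -1 ≤ r → HasDerivWithinAt (fun r ↦ L (r + 1)) (M (r + 1)) (Ici (-1)) r := by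
    refine key L M fun s hs ↦ ?_
    rcases eq_or_lt_of_le hs with rfl | hs0
    · rw [h.2.2.2.2.2]; exact h.2.2.1
    · exact (h.1 s hs0).hasDerivWithinAt
  have d2 : ∀ r, -1 ≤ r → HasDerivWithinAt (fun r ↦ M (r + 1)) (N (r + 1)) (Ici (-1)) r := by
    refine key M N fun s hs ↦ ?_
    rcases eq_or_lt_of_le hs with rfl | hs0
    · rw [hN0]; exact h.2.2.2.1
    · rw [hN s hs0]; exact (h.2.1 s hs0).hasDerivWithinAt
  have e1 : ∀ r, -1 ≤ r → derivWithin (fun r ↦ L (r + 1)) (Ici (-1)) r = M (r + 1) :=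
    fun r hr ↦ (d1 r hr).derivWithin (hu r hr)
  have e2 : ∀ r, -1 ≤ r →
      derivWithin (derivWithin (fun r ↦ L (r + 1)) (Ici (-1))) (Ici (-1)) r = N (r + 1) :=
    fun r hr ↦ by
      rw [derivWithin_congr (s := Ici (-1)) (f := fun r ↦ M (r + 1)) (fun x hx ↦ e1 x hx) (e1 r hr)]
      exact (d2 r hr).derivWithin (hu r hr)
  have c1 : ContDiffOn ℝ 1 (fun r ↦ M (r + 1)) (Ici (-1)) := by
    have : ContDiffOn ℝ (0 + 1) (fun r ↦ M (r + 1)) (Ici (-1)) := by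
      rw [contDiffOn_succ_iff_derivWithin hu]
      refine ⟨fun r hr ↦ (d2 r hr).differentiableWithinAt, by simp, ?_⟩
      rw [contDiffOn_zero]
      refine ContinuousOn.congr (f := fun r ↦ N (r + 1)) ?_
        (fun r hr ↦ (d2 r hr).derivWithin (hu r hr))
      exact hNc.comp (by fun_prop) hmaps
    simpa using this
  have c2 : ContDiffOn ℝ 2 (fun r ↦ L (r + 1)) (Ici (-1)) := by
    have : ContDiffOn ℝ (1 + 1) (fun r ↦ L (r + 1)) (Ici (-1)) := by
      rw [contDiffOn_succ_iff_derivWithin hu]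
      exact ⟨fun r hr ↦ (d1 r hr).differentiableWithinAt, by simp, c1.congr e1⟩
    rwa [one_add_one_eq_two] at this
  refine ⟨⟨c2, fun r hr ↦ ?_, ?_, ?_, ?_⟩, e1⟩
  · rw [e2 r hr.le, hN _ (by linarith)]
  · simp [h.2.2.2.2.1]
  · rw [e1 _ le_rfl]; simp [h.2.2.2.2.2]
  · rw [e2 _ le_rfl]; simp [hN0]

end

/-- the model solution `l̃`.  `E` is the fixed smooth truncation of
`x ↦ x³ - x`.  The solution `l̃` of the model initial-value problem exists, is unique,
has `l̃' > 0` on `(-1,∞)`, and exceeds `1` somewhere. -/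
theorem stmt_12 (E : ℝ → ℝ) (hE : ContDiff ℝ (⊤ : ℕ∞) E)
    (hEeq : ∀ x : ℝ, |x| ≤ 2 → E x = x ^ 3 - x)
    (hEle : ∀ x : ℝ, 2 ≤ |x| → |x| ≤ 3 → |E x| ≤ |x ^ 3 - x|)
    (hE0 : ∀ x : ℝ, 3 ≤ |x| → E x = 0)
    (hEneg : ∀ x : ℝ, x < -1 → E x ≤ 0)
    (hEpos : ∀ x : ℝ, 1 < x → 0 ≤ E x) :
    ∃ l : ℝ → ℝ, SolModel E l ∧
      (∀ l' : ℝ → ℝ, SolModel E l' → Set.EqOn l' l (Set.Ici (-1))) ∧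
      (∀ r : ℝ, -1 < r → 0 < derivWithin l (Set.Ici (-1)) r) ∧
      (∃ rPlus : ℝ, -1 < rPlus ∧ 1 < l rPlus) := by
  obtain ⟨L, M, h⟩ := SolS.exists hE hE0 hEeq
  obtain ⟨hm, hd⟩ := h.toModel hE.continuous hEeq
  refine ⟨fun r ↦ L (r + 1), hm, fun l' hl' r hr ↦ ?_, fun r hr ↦ ?_, ?_⟩
  · have hr' : (-1 : ℝ) ≤ r := hr
    have := hl'.toS.unique h hE hE0 hEeq (r + 1) (by linarith)
    simpa using this
  · rw [hd r hr.le]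
    exact h.pos hEeq hEpos _ (by linarith)
  · obtain ⟨s, hs, hs1⟩ := h.exceed hEeq hEpos
    exact ⟨s - 1, by linarith, by simpa using hs1⟩
end

section
/- There exists a smooth function σ₀ : [−1,1] → ℝ, positive on (−1,1), with the following properties. (1) σ₀(r) = (r+1)² for all r ∈ [−1,−7/8]. (2) σ₀ is even about r = 0. For each α ∈ ℝ, let l_α denote the unique C² solution on [−1,1) of l'' = E(l)/σ₀ with l(−1) = −1, l'(−1) = 0, l''(−1) = α (one-sided at −1). (3) If α > 0, then l_α'(r) > 0 for all r ∈ (−1,0]. (4) There exists α₀ > 0 such that for all α ≥ α₀, l_α(−7/8) > 1. (5) For any α, if l_α(7/8) = 0 then l_α'(7/8) < 5/7. -/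
/-- A `C²` solution on `[-1,1)` of `l'' = E(l)/σ₀` on `(-1,1)` with `l(-1) = -1`,
`l'(-1) = 0`, `l''(-1) = α` (one-sided derivatives at `-1`, taken within `[-1,1)`). -/
def SolSigma (E σ₀ : ℝ → ℝ) (α : ℝ) (l : ℝ → ℝ) : Prop :=
  ContDiffOn ℝ 2 l (Set.Ico (-1) 1) ∧
  (∀ r ∈ Set.Ioo (-1 : ℝ) 1,
    derivWithin (derivWithin l (Set.Ico (-1) 1)) (Set.Ico (-1) 1) r
      = E (l r) / σ₀ r) ∧
  l (-1) = -1 ∧ derivWithin l (Set.Ico (-1) 1) (-1) = 0 ∧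
  derivWithin (derivWithin l (Set.Ico (-1) 1)) (Set.Ico (-1) 1) (-1) = α

namespace Stmt13
open Set Filter Topology

noncomputable def chi (r : ℝ) : ℝ := Real.smoothTransition ((r + 7 / 8) * 65536)
noncomputable def tau (r : ℝ) : ℝ := (1 + r) ^ 2 * (1 - chi r) + 1000 * chi r
noncomputable def sig (r : ℝ) : ℝ := tau r + tau (-r) - 1000

lemma chi_contDiff : ContDiff ℝ (⊤ : ℕ∞) chi := by
  unfold chi
  exact Real.smoothTransition.contDiff.comp (by fun_prop)

lemma tau_contDiff : ContDiff ℝ (⊤ : ℕ∞) tau := by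
  have := chi_contDiff
  unfold tau
  fun_prop

lemma sig_contDiff : ContDiff ℝ (⊤ : ℕ∞) sig := by
  have := tau_contDiff
  unfold sig
  exact (this.add (this.comp contDiff_neg)).sub contDiff_const

lemma chi_nonneg (r : ℝ) : 0 ≤ chi r := Real.smoothTransition.nonneg _
lemma chi_le_one (r : ℝ) : chi r ≤ 1 := Real.smoothTransition.le_one _

lemma chi_mono : Monotone chi := fun a b h =>
  Real.smoothTransition.monotone (by linarith)

lemma chi_zero {r : ℝ} (h : r ≤ -7 / 8) : chi r = 0 :=
  Real.smoothTransition.zero_of_nonpos (by linarith)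

lemma chi_one {r : ℝ} (h : -7 / 8 + 1 / 65536 ≤ r) : chi r = 1 :=
  Real.smoothTransition.one_of_one_le (by linarith)

lemma tau_const {r : ℝ} (h : -7 / 8 + 1 / 65536 ≤ r) : tau r = 1000 := by
  simp [tau, chi_one h]

lemma sig_even (r : ℝ) : sig (-r) = sig r := by
  simp only [sig, neg_neg]; ring

lemma sig_eq_tau {r : ℝ} (h : r ≤ 7 / 8 - 1 / 65536) : sig r = tau r := by
  simp [sig, tau_const (r := -r) (by linarith)]

lemma tau_pos {r : ℝ} (h : -1 < r) : 0 < tau r := by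
  unfold tau
  have h0 := chi_nonneg r
  have h1 := chi_le_one r
  have : 0 < (1 + r) ^ 2 := by have : 0 < 1 + r := by linarith
                               positivity
  rcases eq_or_lt_of_le h0 with h | h
  · rw [← h]; linarith
  · nlinarith [mul_nonneg this.le (sub_nonneg.2 h1)]

lemma sig_pos {r : ℝ} (h : -1 < r) (h' : r < 1) : 0 < sig r := by
  rcases le_total r 0 with h0 | h0
  · rw [sig_eq_tau (by linarith)]; exact tau_pos h
  · rw [← sig_even, sig_eq_tau (by linarith)]; exact tau_pos (by linarith)

lemma sig_left {r : ℝ} (h : r ≤ -7 / 8) : sig r = (r + 1) ^ 2 := by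
  rw [sig_eq_tau (by linarith)]; simp [tau, chi_zero h]; ring

lemma sig_mid {r : ℝ} (h : -7 / 8 + 1 / 65536 ≤ r) (h' : r ≤ 7 / 8 - 1 / 65536) :
    sig r = 1000 := by
  rw [sig_eq_tau h', tau_const h]

lemma tau_monoOn : MonotoneOn tau (Icc (-1) 0) := by
  intro a ha b hb hab
  unfold tau
  have h0 := chi_nonneg a
  have h1 := chi_le_one b
  have h2 := chi_mono hab
  have hb1 : (1 + b) ^ 2 ≤ 1 := by nlinarith [hb.1, hb.2]
  have hab2 : (1 + a) ^ 2 ≤ (1 + b) ^ 2 := by nlinarith [ha.1, hb.1]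
  nlinarith [mul_nonneg (sub_nonneg.2 h2) (sub_nonneg.2 (hb1.trans (by norm_num : (1:ℝ) ≤ 1000))),
    mul_nonneg (sub_nonneg.2 hab2) (sub_nonneg.2 (h2.trans h1))]

lemma sig_monoOn : MonotoneOn sig (Icc (-1) 0) := by
  intro a ha b hb hab
  rw [sig_eq_tau (by linarith [ha.2]), sig_eq_tau (by linarith [hb.2])]
  exact tau_monoOn ha hb hab

lemma sig_ge {r : ℝ} (h : -7 / 8 ≤ r) (h' : r ≤ 7 / 8) : 1 / 64 ≤ sig r := by
  have h1 : sig (-7 / 8) = 1 / 64 := by rw [sig_left le_rfl]; norm_num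
  rw [← h1]
  rcases le_total r 0 with h0 | h0
  · exact sig_monoOn (by constructor <;> norm_num) ⟨by linarith, h0⟩ h
  · rw [← sig_even r]
    exact sig_monoOn (by constructor <;> norm_num) ⟨by linarith, by linarith⟩ (by linarith)

lemma sig_hasDerivAt (r : ℝ) : HasDerivAt sig (deriv sig r) r :=
  (sig_contDiff.differentiable (by simp)).differentiableAt.hasDerivAt

lemma sig_deriv_nonneg {r : ℝ} (h : -1 < r) (h' : r < 0) : 0 ≤ deriv sig r := by
  have h1 : derivWithin sig (Icc (-1) 0) r = deriv sig r :=
    derivWithin_of_mem_nhds (Icc_mem_nhds h h')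
  rw [← h1]
  exact sig_monoOn.derivWithin_nonneg

lemma sig_deriv_left {r : ℝ} (h' : r < -7 / 8) : deriv sig r = 2 * (r + 1) := by
  have h1 : sig =ᶠ[𝓝 r] fun r => (r + 1) ^ 2 := by
    filter_upwards [Iio_mem_nhds h'] with x hx using sig_left (le_of_lt hx)
  rw [h1.deriv_eq]
  have := ((hasDerivAt_id r).add_const 1).pow 2
  simp [this.deriv]

/-! consequences of being a solution -/

section sol
variable {E : ℝ → ℝ} {α : ℝ} {l : ℝ → ℝ}

/-- convenient form -/
structure Sol (E : ℝ → ℝ) (α : ℝ) (l v q : ℝ → ℝ) : Prop where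
  hl : ∀ r ∈ Ico (-1 : ℝ) 1, HasDerivWithinAt l (v r) (Ico (-1) 1) r
  hv : ∀ r ∈ Ico (-1 : ℝ) 1, HasDerivWithinAt v (q r) (Ico (-1) 1) r
  hq : ContinuousOn q (Ico (-1) 1)
  eq : ∀ r ∈ Ioo (-1 : ℝ) 1, q r = E (l r) / sig r
  l0 : l (-1) = -1
  v0 : v (-1) = 0
  q0 : q (-1) = α

lemma sol_of (h : SolSigma E sig α l) : Sol E α l (derivWithin l (Ico (-1) 1))
    (derivWithin (derivWithin l (Ico (-1) 1)) (Ico (-1) 1)) := by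
  obtain ⟨h1, h2, h3, h4, h5⟩ := h
  have hu : UniqueDiffOn ℝ (Ico (-1 : ℝ) 1) := uniqueDiffOn_Ico _ _
  have h6 : ContDiffOn ℝ 1 (derivWithin l (Ico (-1) 1)) (Ico (-1) 1) :=
    ((contDiffOn_succ_iff_derivWithin (n := 1) hu).1 (by norm_num; exact h1)).2.2
  refine ⟨fun r hr => ?_, fun r hr => ?_, ?_, h2, h3, h4, h5⟩
  · exact ((h1.differentiableOn (by norm_num)) r hr).hasDerivWithinAt
  · exact ((h6.differentiableOn (by norm_num)) r hr).hasDerivWithinAt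
  · exact h6.continuousOn_derivWithin hu le_rfl

lemma Sol.solSigma {v q} (h : Sol E α l v q) : SolSigma E sig α l := by
  have hu : UniqueDiffOn ℝ (Ico (-1 : ℝ) 1) := uniqueDiffOn_Ico _ _
  have e1 : EqOn (derivWithin l (Ico (-1) 1)) v (Ico (-1) 1) := fun r hr =>
    (h.hl r hr).derivWithin (hu r hr)
  have e2 : EqOn (derivWithin (derivWithin l (Ico (-1) 1)) (Ico (-1) 1)) q (Ico (-1) 1) :=
    fun r hr => by
      rw [derivWithin_congr e1 (e1 hr)]
      exact (h.hv r hr).derivWithin (hu r hr)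
  have m : (-1 : ℝ) ∈ Ico (-1 : ℝ) 1 := by constructor <;> norm_num
  refine ⟨?_, fun r hr => ?_, h.l0, ?_, ?_⟩
  · have : ContDiffOn ℝ (1 + 1) l (Ico (-1) 1) := by
      rw [contDiffOn_succ_iff_derivWithin hu]
      refine ⟨fun r hr => (h.hl r hr).differentiableWithinAt, by simp, ?_⟩
      have : ContDiffOn ℝ (0 + 1) v (Ico (-1) 1) := by
        rw [contDiffOn_succ_iff_derivWithin hu]
        refine ⟨fun r hr => (h.hv r hr).differentiableWithinAt, by simp, ?_⟩
        rw [contDiffOn_zero]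
        exact h.hq.congr fun r hr => (h.hv r hr).derivWithin (hu r hr)
      exact (this.congr e1).of_le (by simp)
    exact this.of_le (by norm_num)
  · rw [e2 ⟨hr.1.le, hr.2⟩, h.eq r hr]
  · rw [e1 m, h.v0]
  · rw [e2 m, h.q0]

end sol
end Stmt13

namespace Stmt13
open Set Filter Topology

lemma le_of_deriv {f f' : ℝ → ℝ} {a b : ℝ} (hab : a ≤ b) (hc : ContinuousOn f (Icc a b))
    (hd : ∀ x ∈ Ioo a b, HasDerivAt f (f' x) x) (h0 : ∀ x ∈ Ioo a b, 0 ≤ f' x) : f a ≤ f b := by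
  rcases eq_or_lt_of_le hab with rfl | h
  · exact le_rfl
  obtain ⟨c, hc1, hc2⟩ := exists_hasDerivAt_eq_slope f f' h hc hd
  have := h0 c hc1
  rw [hc2, le_div_iff₀ (by linarith)] at this
  linarith

lemma lt_of_deriv {f f' : ℝ → ℝ} {a b : ℝ} (h : a < b) (hc : ContinuousOn f (Icc a b))
    (hd : ∀ x ∈ Ioo a b, HasDerivAt f (f' x) x) (h0 : ∀ x ∈ Ioo a b, 0 < f' x) : f a < f b := by
  obtain ⟨c, hc1, hc2⟩ := exists_hasDerivAt_eq_slope f f' h hc hd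
  have := h0 c hc1
  rw [hc2, lt_div_iff₀ (by linarith)] at this
  linarith

lemma slope_le {f f' : ℝ → ℝ} {a b C : ℝ} (hab : a ≤ b) (hc : ContinuousOn f (Icc a b))
    (hd : ∀ x ∈ Ioo a b, HasDerivAt f (f' x) x) (h0 : ∀ x ∈ Ioo a b, f' x ≤ C) :
    f b - f a ≤ C * (b - a) := by
  rcases eq_or_lt_of_le hab with rfl | h
  · simp
  obtain ⟨c, hc1, hc2⟩ := exists_hasDerivAt_eq_slope f f' h hc hd
  have := h0 c hc1
  rwa [hc2, div_le_iff₀ (by linarith)] at this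

lemma last_nonneg {f : ℝ → ℝ} {a b : ℝ} (hab : a ≤ b) (hc : ContinuousOn f (Icc a b))
    (ha : 0 ≤ f a) (hb : f b < 0) :
    ∃ c ∈ Ico a b, 0 ≤ f c ∧ ∀ x ∈ Ioc c b, f x < 0 := by
  have hS : IsCompact (Icc a b ∩ f ⁻¹' Ici 0) :=
    isCompact_Icc.of_isClosed_subset
      (hc.preimage_isClosed_of_isClosed isClosed_Icc isClosed_Ici) inter_subset_left
  obtain ⟨c, hcS, hcm⟩ := hS.exists_isGreatest ⟨a, ⟨⟨le_rfl, hab⟩, ha⟩⟩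
  refine ⟨c, ⟨hcS.1.1, lt_of_le_of_ne hcS.1.2 ?_⟩, hcS.2, fun x hx => ?_⟩
  · rintro rfl
    have := hcS.2
    simp only [mem_preimage, mem_Ici] at this
    linarith
  · by_contra hx'
    have := hcm ⟨⟨hcS.1.1.trans hx.1.le, hx.2⟩, not_lt.1 hx'⟩
    linarith [hx.1]

section
variable {E : ℝ → ℝ} {α : ℝ} {l v q : ℝ → ℝ}

lemma Sol.lA (h : Sol E α l v q) {r : ℝ} (h1 : -1 < r) (h2 : r < 1) : HasDerivAt l (v r) r :=
  (h.hl r ⟨h1.le, h2⟩).hasDerivAt (Ico_mem_nhds h1 h2)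

lemma Sol.vA (h : Sol E α l v q) {r : ℝ} (h1 : -1 < r) (h2 : r < 1) : HasDerivAt v (q r) r :=
  (h.hv r ⟨h1.le, h2⟩).hasDerivAt (Ico_mem_nhds h1 h2)

lemma Sol.cl (h : Sol E α l v q) : ContinuousOn l (Ico (-1) 1) := fun r hr =>
  (h.hl r hr).continuousWithinAt
lemma Sol.cv (h : Sol E α l v q) : ContinuousOn v (Ico (-1) 1) := fun r hr =>
  (h.hv r hr).continuousWithinAt

lemma Sol.nhds_le : 𝓝[>] (-1 : ℝ) ≤ 𝓝[Ico (-1) 1 \ {-1}] (-1 : ℝ) := by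
  have : 𝓝[>] (-1 : ℝ) = 𝓝[Ioo (-1) 1] (-1 : ℝ) := (nhdsWithin_Ioo_eq_nhdsGT (by norm_num)).symm
  rw [this]
  apply nhdsWithin_mono
  intro x hx
  exact ⟨⟨hx.1.le, hx.2⟩, fun h => by simp at h; linarith [hx.1]⟩

lemma Sol.slope_v (h : Sol E α l v q) :
    Tendsto (fun r => v r / (r + 1)) (𝓝[>] (-1)) (𝓝 α) := by
  have h1 := h.hv (-1) (by constructor <;> norm_num)
  rw [hasDerivWithinAt_iff_tendsto_slope, h.q0] at h1
  refine (h1.mono_left Sol.nhds_le).congr fun r => ?_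
  rw [slope_def_field, h.v0]; simp

lemma Sol.tends (h : Sol E α l v q) :
    Tendsto (fun r => (l r + 1) / (r + 1) ^ 2) (𝓝[>] (-1)) (𝓝 (α / 2)) := by
  refine HasDerivAt.lhopital_zero_right_on_Ioo (a := -1) (b := 1) (f' := v)
    (g' := fun r => 2 * (r + 1)) (by norm_num)
    (fun r hr => (h.lA hr.1 hr.2).add_const 1) (fun r hr => ?_) (fun r hr => ?_) ?_ ?_ ?_
  · exact HasDerivAt.congr_deriv (((hasDerivAt_id r).add_const 1).pow 2) (by simp)
  · have := hr.1
    simp only [ne_eq, mul_eq_zero, not_or]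
    constructor <;> [norm_num; linarith]
  · have h1 := (h.cl (-1) (by constructor <;> norm_num)).mono_left
      (nhdsWithin_mono _ sdiff_subset |> Sol.nhds_le.trans)
    have := h1.add_const 1
    simpa [h.l0] using this
  · have : Tendsto (fun r : ℝ => (r + 1) ^ 2) (𝓝 (-1)) (𝓝 ((-1 + 1) ^ 2)) :=
      Continuous.tendsto (by fun_prop) _
    simpa using this.mono_left nhdsWithin_le_nhds
  · have := h.slope_v.div_const 2
    refine this.congr fun r => ?_
    rw [div_div, mul_comm]

/-- primitive of `E` is nonnegative -/
lemma F_exists (hE : Continuous E) (hEeq : ∀ x : ℝ, |x| ≤ 2 → E x = x ^ 3 - x)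
    (hEneg : ∀ x : ℝ, x < -1 → E x ≤ 0)
    (hEpos : ∀ x : ℝ, 1 < x → 0 ≤ E x) :
    ∃ F : ℝ → ℝ, (∀ x, HasDerivAt F (E x) x) ∧ F (-1) = 0 ∧ ∀ x, 0 ≤ F x := by
  have hd : ∀ x, HasDerivAt (fun x => ∫ t in (-1)..x, E t) (E x) x := fun x =>
    intervalIntegral.integral_hasDerivAt_right (hE.intervalIntegrable _ _)
      (hE.stronglyMeasurableAtFilter _ _) hE.continuousAt
  set F : ℝ → ℝ := fun x => ∫ t in (-1)..x, E t with hF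
  have hF0 : F (-1) = 0 := by simp [hF]
  have hFc : Continuous F := continuous_iff_continuousAt.2 fun x => (hd x).continuousAt
  have hmid : ∀ x ∈ Icc (-1 : ℝ) 1, F x = (x ^ 2 - 1) ^ 2 / 4 := by
    intro x hx
    have hg : ∀ y ∈ Ioo (-1) x, HasDerivAt (fun y => F y - (y ^ 2 - 1) ^ 2 / 4) 0 y := by
      intro y hy
      have h1 := (((((hasDerivAt_id y).pow 2).sub_const 1).pow 2).div_const 4)
      have h2 := (hd y).sub h1
      have h3 : |y| ≤ 2 := by rw [abs_le]; constructor <;> linarith [hy.1, hy.2, hx.2]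
      rw [hEeq y h3] at h2
      refine HasDerivAt.congr_deriv h2 ?_
      simp; ring
    have hc : ContinuousOn (fun y => F y - (y ^ 2 - 1) ^ 2 / 4) (Icc (-1) x) :=
      (hFc.sub (by fun_prop)).continuousOn
    have h1 := le_of_deriv hx.1 hc hg (fun _ _ => le_rfl)
    have h2 := slope_le (C := 0) hx.1 hc hg (fun _ _ => le_rfl)
    simp only [hF0] at h1 h2
    norm_num at h1 h2
    linarith
  refine ⟨F, hd, hF0, fun x => ?_⟩
  rcases le_total x (-1) with h | h
  · have := slope_le (C := 0) h hFc.continuousOn (fun y _ => hd y) (fun y hy => hEneg y hy.2)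
    linarith
  rcases le_total x 1 with h' | h'
  · rw [hmid x ⟨h, h'⟩]; positivity
  · have h1 := le_of_deriv h' hFc.continuousOn (fun y _ => hd y) (fun y hy => hEpos y hy.1)
    have h2 := hmid 1 (by constructor <;> norm_num)
    norm_num at h2
    linarith

lemma Sol.v_pos (h : Sol E α l v q) (hE : Continuous E)
    (hEeq : ∀ x : ℝ, |x| ≤ 2 → E x = x ^ 3 - x)
    (hEneg : ∀ x : ℝ, x < -1 → E x ≤ 0)
    (hEpos : ∀ x : ℝ, 1 < x → 0 ≤ E x) (hα : 0 < α) {r : ℝ} (hr : r ∈ Ioc (-1 : ℝ) 0) :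
    0 < v r := by
  obtain ⟨F, hF, hF0, hFn⟩ := F_exists hE hEeq hEneg hEpos
  have hFc : Continuous F := continuous_iff_continuousAt.2 fun x => (hF x).continuousAt
  set H : ℝ → ℝ := fun r => sig r * v r ^ 2 / 2 - F (l r) with hH
  have hHd : ∀ r ∈ Ioo (-1 : ℝ) 1, HasDerivAt H (deriv sig r * v r ^ 2 / 2) r := by
    intro r hr
    have h1 := (((sig_hasDerivAt r).mul ((h.vA hr.1 hr.2).pow 2)).div_const 2).sub
      ((hF (l r)).comp r (h.lA hr.1 hr.2))
    refine HasDerivAt.congr_deriv h1 ?_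
    have := (sig_pos hr.1 hr.2).ne'
    rw [h.eq r hr]
    simp only [Pi.pow_apply]
    field_simp
    ring_nf
    try norm_num
  have hHc : ContinuousOn H (Ico (-1) 1) :=
    ((sig_contDiff.continuous.continuousOn.mul (h.cv.pow 2)).div_const 2).sub
      (hFc.comp_continuousOn h.cl)
  have hH1 : H (-1) = 0 := by simp [hH, h.v0, h.l0, hF0]
  -- near -1
  have hev : ∀ᶠ r in 𝓝[>] (-1 : ℝ), 0 < v r := by
    filter_upwards [h.slope_v.eventually (lt_mem_nhds hα), self_mem_nhdsWithin] with r h1 h2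
    have h2 : -1 < r := h2
    have : v r = v r / (r + 1) * (r + 1) := by
      rw [div_mul_cancel₀]; linarith
    rw [this]; exact mul_pos h1 (by linarith)
  obtain ⟨e, he, hes⟩ := mem_nhdsGT_iff_exists_Ioo_subset.1 hev
  have he : -1 < e := he
  have key : ∀ r ∈ Ioc (-1 : ℝ) 0, 0 < H r := by
    intro r hr
    set d := min (min e r) (-7/8) with hd
    have d1 : -1 < d := by simp only [hd, lt_min_iff]; exact ⟨⟨he, hr.1⟩, by norm_num⟩
    have d2 : d ≤ r := (min_le_left _ _).trans (min_le_right _ _)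
    have d3 : d ≤ -7/8 := min_le_right _ _
    have d4 : d ≤ e := (min_le_left _ _).trans (min_le_left _ _)
    have h1 : H (-1) < H d := by
      refine lt_of_deriv d1 (hHc.mono fun x hx => ⟨hx.1, by linarith [hx.2]⟩)
        (fun x hx => hHd x ⟨hx.1, by linarith [hx.2]⟩) fun x hx => ?_
      rw [sig_deriv_left (by linarith [hx.2])]
      have := hes ⟨hx.1, by linarith [hx.2]⟩
      have : 0 < v x := this
      have := hx.1
      have : 0 < x + 1 := by linarith
      positivity
    have h2 : H d ≤ H r := by
      refine le_of_deriv d2 (hHc.mono fun x hx => ⟨by linarith [hx.1], by linarith [hx.2, hr.2]⟩)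
        (fun x hx => hHd x ⟨by linarith [hx.1], by linarith [hx.2, hr.2]⟩) fun x hx => ?_
      have := sig_deriv_nonneg (r := x) (by linarith [hx.1]) (by linarith [hx.2, hr.2])
      positivity
    linarith
  have hne : ∀ r ∈ Ioc (-1 : ℝ) 0, v r ≠ 0 := by
    intro r hr h0
    have := key r hr
    simp only [hH, h0] at this
    have := hFn (l r)
    linarith
  by_contra hcon
  push Not at hcon
  set d := min r ((-1 + e) / 2) with hd
  have d1 : -1 < d := by simp only [hd, lt_min_iff]; exact ⟨hr.1, by linarith⟩
  have d2 : d ≤ r := min_le_left _ _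
  have d3 : d < e := (min_le_right _ _).trans_lt (by linarith)
  have hd0 : 0 < v d := hes ⟨d1, d3⟩
  obtain ⟨c, hc, hc0⟩ := intermediate_value_Icc' d2
    (h.cv.mono fun x hx => ⟨by linarith [hx.1], by linarith [hx.2, hr.2]⟩) ⟨hcon, hd0.le⟩
  exact hne c ⟨by linarith [hc.1], by linarith [hc.2, hr.2]⟩ hc0

lemma Sol.large (h : Sol E α l v q) (hE : Continuous E)
    (hEeq : ∀ x : ℝ, |x| ≤ 2 → E x = x ^ 3 - x)
    (hEneg : ∀ x : ℝ, x < -1 → E x ≤ 0)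
    (hEpos : ∀ x : ℝ, 1 < x → 0 ≤ E x) (hα : 641 ≤ α) : 1 < l (-7/8) := by
  by_contra hcon
  push Not at hcon
  have hv : ∀ r ∈ Ioc (-1 : ℝ) 0, 0 < v r := fun r hr =>
    h.v_pos hE hEeq hEneg hEpos (by linarith) hr
  have sub : Icc (-1 : ℝ) (-7/8) ⊆ Ico (-1) 1 := fun x hx => ⟨hx.1, by linarith [hx.2]⟩
  have hlo : ∀ r ∈ Ioc (-1 : ℝ) (-7/8), -1 < l r := by
    intro r hr
    rw [← h.l0]
    exact lt_of_deriv hr.1 (h.cl.mono fun x hx => ⟨hx.1, by linarith [hx.2, hr.2]⟩)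
      (fun x hx => h.lA hx.1 (by linarith [hx.2, hr.2]))
      fun x hx => hv x ⟨hx.1, by linarith [hx.2, hr.2]⟩
  have hhi : ∀ r ∈ Ioc (-1 : ℝ) (-7/8), l r ≤ 1 := by
    intro r hr
    refine le_trans ?_ hcon
    exact le_of_deriv hr.2 (h.cl.mono fun x hx => ⟨by linarith [hx.1, hr.1], by linarith [hx.2]⟩)
      (fun x hx => h.lA (by linarith [hx.1, hr.1]) (by linarith [hx.2]))
      fun x hx => (hv x ⟨by linarith [hx.1, hr.1], by linarith [hx.2]⟩).le
  obtain ⟨B, hB⟩ := isCompact_Icc.bddAbove_image (h.cv.mono sub)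
  have hB' : ∀ r ∈ Icc (-1 : ℝ) (-7/8), v r ≤ B := fun r hr => hB ⟨r, hr, rfl⟩
  have hlB : ∀ r ∈ Ioc (-1 : ℝ) (-7/8), l r + 1 ≤ B * (r + 1) := by
    intro r hr
    have := slope_le (C := B) hr.1.le (h.cl.mono fun x hx => ⟨hx.1, by linarith [hx.2, hr.2]⟩)
      (fun x hx => h.lA hx.1 (by linarith [hx.2, hr.2]))
      fun x hx => hB' x ⟨hx.1.le, by linarith [hx.2, hr.2]⟩
    rw [h.l0] at this
    linarith
  set D : ℝ → ℝ := fun r => (r + 1) * v r - 2 * (l r + 1) + 3/5 * (l r + 1) ^ 2 with hD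
  set J : ℝ → ℝ := fun r => (r + 1) * D r with hJ
  have hJc : ContinuousOn J (Icc (-1) (-7/8)) := by
    have h1 := h.cl.mono sub
    have h2 := h.cv.mono sub
    simp only [hJ, hD]
    fun_prop
  have hJd : ∀ r ∈ Ioo (-1 : ℝ) (-7/8),
      HasDerivAt J (7/25 * (l r + 1) ^ 3 + 6/5 * (l r + 1) * D r) r := by
    intro r hr
    have r1 : r < 1 := by linarith [hr.2]
    have hl := (h.lA hr.1 r1).add_const 1
    have hi := (hasDerivAt_id r).add_const 1
    have h1 := hi.mul (((hi.mul (h.vA hr.1 r1)).sub (hl.const_mul 2)).add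
      ((hl.pow 2).const_mul (3/5)))
    refine HasDerivAt.congr_deriv h1 ?_
    have a1 := hlo r ⟨hr.1, hr.2.le⟩
    have a2 := hhi r ⟨hr.1, hr.2.le⟩
    have hq : q r = ((l r) ^ 3 - l r) / (r + 1) ^ 2 := by
      rw [h.eq r ⟨hr.1, r1⟩, sig_left hr.2.le, hEeq]
      rw [abs_le]; constructor <;> linarith
    have : r + 1 ≠ 0 := by linarith [hr.1]
    simp only [hD, hq, Pi.add_apply, Pi.sub_apply, Pi.mul_apply, id, Pi.pow_apply]
    field_simp
    ring
  have hDn : ∀ r ∈ Ioc (-1 : ℝ) (-7/8), 0 ≤ D r := by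
    intro r hr
    by_contra hneg
    push Not at hneg
    have hp : 0 < r + 1 := by linarith [hr.1]
    have hJneg : J r < 0 := mul_neg_of_pos_of_neg hp hneg
    have sub2 : Icc (-1) r ⊆ Icc (-1 : ℝ) (-7/8) := Icc_subset_Icc le_rfl hr.2
    obtain ⟨c, hc, hc0, hcn⟩ := last_nonneg hr.1.le (hJc.mono sub2) (by simp [hJ]) hJneg
    have := le_of_deriv (f := fun x => J x * Real.exp (-(6/5 * B) * x))
      (f' := fun x => (7/25 * (l x + 1) ^ 3 + 6/5 * (l x + 1) * D x) * Real.exp (-(6/5 * B) * x)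
        + J x * (Real.exp (-(6/5 * B) * x) * (-(6/5 * B)))) hc.2.le
      (((hJc.mono sub2).mono (Icc_subset_Icc hc.1 le_rfl)).mul (by fun_prop))
      (fun x hx => by
        have e1 := hJd x ⟨by linarith [hx.1, hc.1], by linarith [hx.2, hr.2]⟩
        have e2 : HasDerivAt (fun x => Real.exp (-(6/5 * B) * x))
            (Real.exp (-(6/5 * B) * x) * (-(6/5 * B))) x := by
          exact HasDerivAt.congr_deriv (((hasDerivAt_id x).const_mul (-(6/5 * B))).exp) (by simp)
        exact e1.mul e2)
      (fun x hx => by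
        have x1 : x ∈ Ioc (-1 : ℝ) (-7/8) := ⟨by linarith [hx.1, hc.1], by linarith [hx.2, hr.2]⟩
        have b1 := hcn x ⟨hx.1, hx.2.le⟩
        have b2 := hlB x x1
        have b3 := hlo x x1
        have b4 : 0 < x + 1 := by linarith [x1.1]
        have b5 : D x < 0 := by
          by_contra hh
          push Not at hh
          have := mul_nonneg b4.le hh
          simp only [hJ] at b1
          linarith
        have b6 : 0 ≤ (7/25 * (l x + 1) ^ 3 + 6/5 * (l x + 1) * D x) - 6/5 * B * J x := by
          simp only [hJ]
          have : 0 < l x + 1 := by linarith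
          have c1 : 0 ≤ (l x + 1) ^ 3 := by positivity
          nlinarith [mul_nonneg (sub_nonneg.2 b2) (neg_nonneg.2 b5.le)]
        have := mul_nonneg b6 (Real.exp_pos (-(6/5 * B) * x)).le
        linarith)
    have e1 : J r * Real.exp (-(6/5 * B) * r) < 0 := mul_neg_of_neg_of_pos hJneg (Real.exp_pos _)
    have e2 : 0 ≤ J c * Real.exp (-(6/5 * B) * c) := mul_nonneg hc0 (Real.exp_pos _).le
    beta_reduce at this
    linarith
  -- the quotient is monotone
  set Q : ℝ → ℝ := fun r => (l r + 1) / (r + 1) ^ 2 / (2 - 3/5 * (l r + 1)) with hQ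
  have hQd : ∀ r ∈ Ioo (-1 : ℝ) 1, l r ≤ 1 → HasDerivAt Q
      (2 * D r / ((r + 1) ^ 3 * (2 - 3/5 * (l r + 1)) ^ 2)) r := by
    intro r hr hl1
    have hl := (h.lA hr.1 hr.2).add_const 1
    have hi := (hasDerivAt_id r).add_const 1
    have n1 : r + 1 ≠ 0 := by linarith [hr.1]
    have n2 : 2 - 3/5 * (l r + 1) ≠ 0 := by linarith
    have h1 := (hl.div (hi.pow 2) (pow_ne_zero 2 n1)).div ((hl.const_mul (3/5)).const_sub 2) n2
    refine HasDerivAt.congr_deriv h1 ?_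
    have n3 : 5 * 2 - 3 * (l r + 1) ≠ 0 := by linarith
    simp only [hD, Pi.div_apply, Pi.pow_apply, id]
    field_simp
    ring
  have hlim : Tendsto Q (𝓝[>] (-1)) (𝓝 (α / 2 / 2)) := by
    refine h.tends.div ?_ (by norm_num)
    have h1 := (h.cl (-1) (by constructor <;> norm_num)).mono_left
      (nhdsWithin_mono _ sdiff_subset |> Sol.nhds_le.trans)
    have := ((h1.add_const 1).const_mul (3/5)).const_sub 2
    simpa [h.l0] using this
  have hfin : α / 2 / 2 ≤ Q (-7/8) := by
    refine le_of_tendsto hlim ?_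
    filter_upwards [Ioo_mem_nhdsGT (show (-1 : ℝ) < -7/8 by norm_num)] with r hr
    have hd : ∀ x ∈ Icc r (-7/8), HasDerivAt Q _ x := fun x hx =>
      hQd x ⟨by linarith [hx.1, hr.1], by linarith [hx.2]⟩
        (hhi x ⟨by linarith [hx.1, hr.1], by linarith [hx.2]⟩)
    refine le_of_deriv hr.2.le (fun x hx => (hd x hx).continuousAt.continuousWithinAt)
      (fun x hx => hd x ⟨hx.1.le, hx.2.le⟩) fun x hx => ?_
    have x1 : x ∈ Ioc (-1 : ℝ) (-7/8) := ⟨by linarith [hx.1, hr.1], by linarith [hx.2]⟩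
    have := hDn x x1
    have : 0 < x + 1 := by linarith [x1.1]
    positivity
  have a1 : Q (-7/8) ≤ 160 := by
    simp only [hQ]
    rw [div_le_iff₀ (by linarith), div_le_iff₀ (by norm_num)]
    norm_num
    linarith
  linarith

lemma E_bound (hEeq : ∀ x : ℝ, |x| ≤ 2 → E x = x ^ 3 - x)
    (hEle : ∀ x : ℝ, 2 ≤ |x| → |x| ≤ 3 → |E x| ≤ |x ^ 3 - x|)
    (hE0 : ∀ x : ℝ, 3 ≤ |x| → E x = 0) (x : ℝ) : |E x| ≤ 24 := by
  have key : |x| ≤ 3 → |x ^ 3 - x| ≤ 30 ∧ (|x| ≤ 3 → |x ^ 3 - x| ≤ 24) := by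
    intro h
    have h2 := abs_le.1 h
    have : |x ^ 3 - x| ≤ 24 := by
      rw [abs_le]
      constructor <;> nlinarith [mul_nonneg (sub_nonneg.2 h2.2) (sq_nonneg (x + 3/2)),
        mul_nonneg (sub_nonneg.2 h2.1) (sq_nonneg (x - 3/2)), sq_nonneg x]
    exact ⟨by linarith, fun _ => this⟩
  rcases le_total |x| 2 with h | h
  · rw [hEeq x h]; exact (key (by linarith)).2 (by linarith)
  rcases le_total |x| 3 with h' | h'
  · exact (hEle x h h').trans ((key h').2 h')
  · rw [hE0 x h']; norm_num

lemma Sol.small (h : Sol E α l v q) (hEneg : ∀ x : ℝ, x < -1 → E x ≤ 0)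
    (hb : ∀ x, |E x| ≤ 24) (hl0 : l (7/8) = 0) : v (7/8) < 5/7 := by
  by_contra hcon
  push Not at hcon
  have hq : ∀ r ∈ Ioo (-1 : ℝ) 1, ∀ C, 0 < C → C ≤ sig r → q r ≤ 24 / C := by
    intro r hr C hC hCs
    rw [h.eq r hr]
    have hs := sig_pos hr.1 hr.2
    have : E (l r) / sig r ≤ 24 / sig r := by
      gcongr; exact (abs_le.1 (hb _)).2
    exact this.trans (by gcongr)
  have sub : ∀ {a b : ℝ}, -1 < a → b < 1 → Icc a b ⊆ Ico (-1) 1 := fun ha hb x hx =>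
    ⟨by linarith [hx.1], by linarith [hx.2]⟩
  have step : ∀ a b C : ℝ, -1 < a → a ≤ b → b < 1 → 0 < C →
      (∀ x ∈ Ioo a b, C ≤ sig x) → v b - v a ≤ 24 / C * (b - a) := by
    intro a b C ha hab hb1 hC hs
    exact slope_le hab (h.cv.mono (sub ha hb1))
      (fun x hx => h.vA (by linarith [hx.1]) (by linarith [hx.2]))
      fun x hx => hq x ⟨by linarith [hx.1], by linarith [hx.2]⟩ C hC (hs x hx)
  have s3 : ∀ r ∈ Icc (7/8 - 1/65536 : ℝ) (7/8), 5/7 - 3/128 ≤ v r := by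
    intro r hr
    have := step r (7/8) (1/64) (by linarith [hr.1]) hr.2 (by norm_num) (by norm_num)
      fun x hx => sig_ge (by linarith [hx.1, hr.1]) (by linarith [hx.2])
    have := hr.1
    norm_num at *
    linarith
  have s2 : ∀ r ∈ Icc (-7/8 + 1/65536 : ℝ) (7/8 - 1/65536), 5/7 - 3/128 - 42/1000 ≤ v r := by
    intro r hr
    have := step r (7/8 - 1/65536) 1000 (by linarith [hr.1]) hr.2 (by norm_num) (by norm_num)
      fun x hx => (sig_mid (by linarith [hx.1, hr.1]) (by linarith [hx.2])).ge
    have := hr.1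
    have := s3 (7/8 - 1/65536) (by constructor <;> norm_num)
    norm_num at *
    linarith
  have s1 : ∀ r ∈ Icc (-7/8 : ℝ) (-7/8 + 1/65536), 5/7 - 6/128 - 42/1000 ≤ v r := by
    intro r hr
    have := step r (-7/8 + 1/65536) (1/64) (by linarith [hr.1]) hr.2 (by norm_num) (by norm_num)
      fun x hx => sig_ge (by linarith [hx.1, hr.1]) (by linarith [hx.2])
    have := hr.1
    have := s2 (-7/8 + 1/65536) (by constructor <;> norm_num)
    norm_num at *
    linarith
  have s : ∀ r ∈ Icc (-7/8 : ℝ) (7/8), 3/5 ≤ v r := by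
    intro r hr
    rcases le_total r (-7/8 + 1/65536) with h1 | h1
    · have := s1 r ⟨hr.1, h1⟩
      linarith
    rcases le_total r (7/8 - 1/65536) with h2 | h2
    · have := s2 r ⟨h1, h2⟩
      linarith
    · have := s3 r ⟨h2, hr.2⟩
      linarith
  have hlm : l (-7/8) < -1 := by
    have := le_of_deriv (f := fun x => l x - 3/5 * x) (f' := fun x => v x - 3/5)
      (show (-7/8 : ℝ) ≤ 7/8 by norm_num)
      ((h.cl.mono (sub (by norm_num) (by norm_num))).sub (by fun_prop))
      (fun x hx => by
        have e1 := h.lA (r := x) (by linarith [hx.1]) (by linarith [hx.2])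
        exact HasDerivAt.congr_deriv (e1.sub ((hasDerivAt_id x).const_mul (3/5))) (by simp))
      (fun x hx => by linarith [s x ⟨hx.1.le, hx.2.le⟩])
    simp only [hl0] at this
    linarith
  have hv0 := s (-7/8) (by constructor <;> norm_num)
  have sub' : Icc (-1 : ℝ) (-7/8) ⊆ Ico (-1) 1 := fun x hx => ⟨hx.1, by linarith [hx.2]⟩
  obtain ⟨c, hc, hc0, hcn⟩ := last_nonneg (f := fun x => l x + 1) (a := -1) (b := -7/8)
    (by norm_num) ((h.cl.mono sub').add continuousOn_const) (by simp [h.l0]) (by linarith)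
  have hvc : ∀ x ∈ Ioo c (-7/8), 0 ≤ v x := by
    intro x hx
    have := slope_le (C := 0) hx.2.le
      (h.cv.mono fun y hy => sub' ⟨by linarith [hy.1, hx.1, hc.1], hy.2⟩)
      (fun y hy => h.vA (by linarith [hy.1, hx.1, hc.1]) (by linarith [hy.2]))
      (fun y hy => by
        have y1 : y ∈ Ioo (-1 : ℝ) 1 := ⟨by linarith [hy.1, hx.1, hc.1], by linarith [hy.2]⟩
        rw [h.eq y y1]
        refine div_nonpos_of_nonpos_of_nonneg (hEneg _ ?_) (sig_pos y1.1 y1.2).le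
        linarith [hcn y ⟨by linarith [hy.1, hx.1], hy.2.le⟩])
    linarith
  have := le_of_deriv hc.2.le (h.cl.mono fun y hy => sub' ⟨by linarith [hy.1, hc.1], hy.2⟩)
    (fun y hy => h.lA (by linarith [hy.1, hc.1]) (by linarith [hy.2])) hvc
  linarith

end
end Stmt13

namespace Stmt13
open Set Filter Topology

/-- solution of the first order system on a compact interval -/
structure Seg (E : ℝ → ℝ) (a b : ℝ) (l v : ℝ → ℝ) : Prop where
  hl : ∀ r ∈ Icc a b, HasDerivWithinAt l (v r) (Icc a b) r
  hv : ∀ r ∈ Icc a b, HasDerivWithinAt v (E (l r) / sig r) (Icc a b) r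

lemma sig_min {a b : ℝ} (ha : -1 < a) (hb : b < 1) :
    ∃ m : ℝ, 0 < m ∧ ∀ r ∈ Icc a b, m ≤ sig r := by
  rcases lt_or_ge b a with h | h
  · exact ⟨1, one_pos, fun r hr => by linarith [hr.1, hr.2]⟩
  obtain ⟨x, hx, hm⟩ := isCompact_Icc.exists_isMinOn (nonempty_Icc.2 h)
    (sig_contDiff.continuous.continuousOn (s := Icc a b))
  exact ⟨sig x, sig_pos (by linarith [hx.1]) (by linarith [hx.2]), fun r hr => hm hr⟩

lemma fld_lip {E c : ℝ → ℝ} {K : NNReal} (hE : LipschitzWith K E) (hc : LipschitzWith 1 c)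
    {a b m : ℝ} (hm : 0 < m) (h : ∀ r ∈ Icc a b, m ≤ sig r) {r : ℝ} (hr : r ∈ Icc a b) :
    LipschitzWith (max 1 (K * m⁻¹.toNNReal)) (fun p : ℝ × ℝ => (c p.2, E p.1 / sig r)) := by
  apply LipschitzWith.of_dist_le_mul
  intro p p'
  have h1 := hc.dist_le_mul p.2 p'.2
  have h2 := hE.dist_le_mul p.1 p'.1
  have hs : m ≤ sig r := h r hr
  have e1 : dist p.2 p'.2 ≤ dist p p' := le_max_right _ _
  have e2 : dist p.1 p'.1 ≤ dist p p' := le_max_left _ _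
  rw [NNReal.coe_max, NNReal.coe_mul, Real.coe_toNNReal _ (inv_pos.2 hm).le]
  rw [Prod.dist_eq (x := (c p.2, E p.1 / sig r))]
  refine max_le ?_ ?_
  · calc dist (c p.2) (c p'.2) ≤ 1 * dist p.2 p'.2 := by simpa using h1
      _ ≤ 1 * dist p p' := by gcongr
      _ ≤ _ := by gcongr; exact le_max_left _ _
  · have : dist (E p.1 / sig r) (E p'.1 / sig r) = dist (E p.1) (E p'.1) / sig r := by
      rw [Real.dist_eq, Real.dist_eq, ← sub_div, abs_div, abs_of_pos (hm.trans_le hs)]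
    simp only
    rw [this]
    calc dist (E p.1) (E p'.1) / sig r ≤ dist (E p.1) (E p'.1) / m := by gcongr
      _ ≤ (K * dist p p') / m := by
          gcongr
          exact h2.trans (by gcongr)
      _ = K * m⁻¹ * dist p p' := by field_simp
      _ ≤ _ := by gcongr; exact le_max_right _ _

lemma Seg.unique {E : ℝ → ℝ} {K : NNReal} (hE : LipschitzWith K E) {a b : ℝ} (ha : -1 < a)
    (hb : b < 1) {l v l' v' : ℝ → ℝ} (h : Seg E a b l v) (h' : Seg E a b l' v')
    (e1 : l a = l' a) (e2 : v a = v' a) : ∀ r ∈ Icc a b, l r = l' r ∧ v r = v' r := by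
  obtain ⟨m, hm, hs⟩ := sig_min ha hb
  have key : ∀ {l v : ℝ → ℝ}, Seg E a b l v → ∀ t ∈ Icc a b,
      HasDerivWithinAt (fun t => (l t, v t)) (v t, E (l t) / sig t) (Icc a b) t :=
    fun h t ht => (h.hl t ht).prodMk (h.hv t ht)
  have := ODE_solution_unique_of_mem_Icc_right (v := fun r (p : ℝ × ℝ) => (p.2, E p.1 / sig r))
    (s := fun _ => univ) (f := fun t => (l t, v t)) (g := fun t => (l' t, v' t)) (a := a) (b := b)
    (K := max 1 (K * m⁻¹.toNNReal))
    (fun t ht => (fld_lip hE LipschitzWith.id hm hs (Ico_subset_Icc_self ht)).lipschitzOnWith)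
    (fun t ht => (key h t ht).continuousWithinAt)
    (fun t ht => (key h t (Ico_subset_Icc_self ht)).mono_of_mem_nhdsWithin
      (Icc_mem_nhdsGE_of_mem ht))
    (fun _ _ => mem_univ _)
    (fun t ht => (key h' t ht).continuousWithinAt)
    (fun t ht => (key h' t (Ico_subset_Icc_self ht)).mono_of_mem_nhdsWithin
      (Icc_mem_nhdsGE_of_mem ht))
    (fun _ _ => mem_univ _) (by rw [e1, e2])
  intro r hr
  have := this hr
  simpa using this

lemma Seg.mono {E : ℝ → ℝ} {a b a' b' : ℝ} {l v : ℝ → ℝ} (h : Seg E a b l v) (h1 : a ≤ a')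
    (h2 : b' ≤ b) : Seg E a' b' l v :=
  ⟨fun r hr => (h.hl r (Icc_subset_Icc h1 h2 hr)).mono (Icc_subset_Icc h1 h2),
    fun r hr => (h.hv r (Icc_subset_Icc h1 h2 hr)).mono (Icc_subset_Icc h1 h2)⟩

lemma Seg.exist {E : ℝ → ℝ} {K : NNReal} (hE : LipschitzWith K E) (hb24 : ∀ x, |E x| ≤ 24)
    {a b : ℝ} (ha : -1 < a) (hab : a ≤ b) (hb : b < 1) (x0 v0 : ℝ) :
    ∃ l v, Seg E a b l v ∧ l a = x0 ∧ v a = v0 := by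
  obtain ⟨m, hm, hs⟩ := sig_min ha hb
  set M := 24 / m with hM
  have hM0 : 0 < M := by positivity
  set B := |v0| + M * (b - a) with hB
  have hB0 : 0 ≤ B := by
    have := mul_nonneg hM0.le (sub_nonneg.2 hab)
    positivity
  set c : ℝ → ℝ := fun v => max (-B) (min v B) with hc
  have hcl : LipschitzWith 1 c := (LipschitzWith.id.min_const B).const_max (-B)
  have hcb : ∀ v, |c v| ≤ B := fun v => by
    rw [abs_le]
    exact ⟨le_max_left _ _, max_le (by linarith) (min_le_right _ _)⟩
  have hcid : ∀ v, |v| ≤ B → c v = v := fun v hv => by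
    have := abs_le.1 hv
    simp only [hc]
    rw [min_eq_left this.2, max_eq_right this.1]
  have hEb : ∀ x, ∀ r ∈ Icc a b, |E x / sig r| ≤ M := by
    intro x r hr
    have := hs r hr
    rw [abs_div, abs_of_pos (hm.trans_le this), hM]
    gcongr
    exact hb24 x
  set L : NNReal := (max B M).toNNReal with hL
  have hLc : (L : ℝ) = max B M := Real.coe_toNNReal _ (hB0.trans (le_max_left _ _))
  have hPL : IsPicardLindelof (fun r (p : ℝ × ℝ) => (c p.2, E p.1 / sig r))
      (tmin := a) (tmax := b) ⟨a, le_rfl, hab⟩ (x0, v0) (L * (b - a).toNNReal) 0 L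
      (max 1 (K * m⁻¹.toNNReal)) := by
    refine ⟨fun t ht => (fld_lip hE hcl hm hs ht).lipschitzOnWith, fun x _ => ?_,
      fun t ht x _ => ?_, ?_⟩
    · refine ContinuousOn.prodMk continuousOn_const (ContinuousOn.div continuousOn_const
        sig_contDiff.continuous.continuousOn fun t ht => (hm.trans_le (hs t ht)).ne')
    · rw [Prod.norm_def, hLc]
      exact max_le_max (hcb _) (hEb _ t ht)
    · simp only [sub_self, NNReal.coe_mul, NNReal.coe_zero, sub_zero]
      rw [Real.coe_toNNReal _ (sub_nonneg.2 hab), max_eq_left (sub_nonneg.2 hab)]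
  obtain ⟨f, hf0, hf⟩ := hPL.exists_eq_forall_mem_Icc_hasDerivWithinAt₀
  have hf0 : f a = (x0, v0) := hf0
  have h1 : ∀ t ∈ Icc a b, HasDerivWithinAt (fun t => (f t).1) (c (f t).2) (Icc a b) t :=
    fun t ht => (hf t ht).fst
  have h2 : ∀ t ∈ Icc a b, HasDerivWithinAt (fun t => (f t).2) (E (f t).1 / sig t) (Icc a b) t :=
    fun t ht => (hf t ht).snd
  refine ⟨fun t => (f t).1, fun t => (f t).2, ⟨fun t ht => ?_, h2⟩, by simp [hf0], by simp [hf0]⟩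
  have h3 := norm_image_sub_le_of_norm_deriv_le_segment' h2
    (fun x hx => hEb _ x (Ico_subset_Icc_self hx)) t ht
  have h4 : |(f t).2| ≤ B := by
    rw [hf0, Real.norm_eq_abs] at h3
    have h5 := abs_add_le ((f t).2 - v0) v0
    rw [sub_add_cancel] at h5
    have : M * (t - a) ≤ M * (b - a) := by
      gcongr; exact ht.2
    simp only at h3
    linarith
  have := h1 t ht
  rwa [hcid _ h4] at this

end Stmt13

namespace Stmt13
open Set Filter Topology

lemma abs_slope {f f' : ℝ → ℝ} {a b C : ℝ} (hab : a ≤ b) (hc : ContinuousOn f (Icc a b))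
    (hd : ∀ x ∈ Ioo a b, HasDerivAt f (f' x) x) (h0 : ∀ x ∈ Ioo a b, |f' x| ≤ C) :
    |f b - f a| ≤ C * (b - a) := by
  have h1 := slope_le hab hc hd (fun x hx => (abs_le.1 (h0 x hx)).2)
  have h2 := slope_le (f := fun x => -f x) (f' := fun x => -f' x) (C := C) hab hc.neg
    (fun x hx => (hd x hx).neg) (fun x hx => by linarith [(abs_le.1 (h0 x hx)).1])
  rw [abs_le]
  constructor <;> linarith

lemma cubic_diff {u u' B d : ℝ} (hu : |u| ≤ B) (hu' : |u'| ≤ B) (hB : B ≤ 1) (hd : |u - u'| ≤ d) :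
    |(u ^ 3 - 3 * u ^ 2) - (u' ^ 3 - 3 * u' ^ 2)| ≤ 9 * B * d := by
  have e : (u ^ 3 - 3 * u ^ 2) - (u' ^ 3 - 3 * u' ^ 2)
      = (u * u + u * u' + u' * u' - 3 * u - 3 * u') * (u - u') := by ring
  have hB0 : 0 ≤ B := (abs_nonneg u).trans hu
  rw [e, abs_mul]
  have h1 : |u * u + u * u' + u' * u' - 3 * u - 3 * u'| ≤ 9 * B := by
    have a1 := mul_le_mul hu hu (abs_nonneg _) hB0
    have a2 := mul_le_mul hu hu' (abs_nonneg _) hB0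
    have a3 := mul_le_mul hu' hu' (abs_nonneg _) hB0
    rw [← abs_mul] at a1 a2 a3
    rw [abs_le] at *
    have : B * B ≤ B := by nlinarith
    constructor <;> linarith [a1.1, a1.2]
  exact mul_le_mul h1 hd (abs_nonneg _) (by positivity)

lemma Sol.near {E : ℝ → ℝ} {α : ℝ} {l v q l' v' q' : ℝ → ℝ} (h : Sol E α l v q)
    (h' : Sol E α l' v' q') (hEeq : ∀ x : ℝ, |x| ≤ 2 → E x = x ^ 3 - x) :
    ∃ e, -1 < e ∧ e ≤ -7/8 ∧ ∀ r ∈ Icc (-1) e, l r = l' r := by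
  set A := |α| / 2 + 1 with hA
  have hA1 : 1 ≤ A := by have := abs_nonneg α; linarith
  have hev : ∀ {l v q : ℝ → ℝ}, Sol E α l v q → ∀ᶠ r in 𝓝[>] (-1 : ℝ),
      |(l r + 1) / (r + 1) ^ 2| < A := fun h =>
    h.tends.abs.eventually (gt_mem_nhds (by rw [abs_div, hA]; norm_num))
  obtain ⟨δ, hδ, hδs⟩ := mem_nhdsGT_iff_exists_Ioo_subset.1 ((hev h).and (hev h'))
  have hδ : -1 < δ := hδ
  set ε := min (1/8) (min ((δ + 1) / 2) (1 / (10 * A))) with hε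
  have e0 : 0 < ε := by
    refine lt_min (by norm_num) (lt_min (by linarith) (by positivity))
  have e1 : ε ≤ 1/8 := min_le_left _ _
  have e2 : ε ≤ (δ + 1) / 2 := (min_le_right _ _).trans (min_le_left _ _)
  have e3 : ε * (10 * A) ≤ 1 := by
    rw [← le_div_iff₀ (by positivity)]
    exact (min_le_right _ _).trans (min_le_right _ _)
  have hb : ∀ {l : ℝ → ℝ} {r : ℝ}, -1 < r → |(l r + 1) / (r + 1) ^ 2| < A →
      |l r + 1| ≤ A * (r + 1) ^ 2 := by
    intro l r hr hh
    have : 0 < (r + 1) ^ 2 := pow_pos (by linarith) 2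
    rw [abs_div, abs_of_pos this, div_lt_iff₀ this] at hh
    exact hh.le
  have hb1 : ∀ r ∈ Ioc (-1) (-1 + ε), |l r + 1| ≤ A * (r + 1) ^ 2 ∧ |l' r + 1| ≤ A * (r + 1) ^ 2 :=
    fun r hr => by
      have := hδs ⟨hr.1, by linarith [hr.2]⟩
      exact ⟨hb hr.1 this.1, hb hr.1 this.2⟩
  set w : ℝ → ℝ := fun r => (l r - l' r) / (r + 1) ^ 2 with hw
  set z : ℝ → ℝ := fun r => (r + 1) ^ 2 * (v r - v' r) - 2 * (r + 1) * (l r - l' r) with hz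
  have w0 : w (-1) = 0 := by simp [hw]
  have z0 : z (-1) = 0 := by simp [hz]
  have hwd : ∀ r ∈ Ioc (-1) (-1 + ε), HasDerivAt w (z r / (r + 1) ^ 4) r := by
    intro r hr
    have n1 : r + 1 ≠ 0 := by linarith [hr.1]
    have r1 : r < 1 := by linarith [hr.2]
    have h1 := ((h.lA hr.1 r1).sub (h'.lA hr.1 r1)).div
      (((hasDerivAt_id r).add_const 1).pow 2) (pow_ne_zero 2 n1)
    refine HasDerivAt.congr_deriv h1 ?_
    simp only [hz, Pi.pow_apply, Pi.sub_apply, id]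
    field_simp
    norm_num
    ring
  have hzd : ∀ r ∈ Ioc (-1) (-1 + ε), HasDerivAt z
      (((l r + 1) ^ 3 - 3 * (l r + 1) ^ 2) - ((l' r + 1) ^ 3 - 3 * (l' r + 1) ^ 2)) r := by
    intro r hr
    have n1 : r + 1 ≠ 0 := by linarith [hr.1]
    have r1 : r < 1 := by linarith [hr.2]
    have hi := (hasDerivAt_id r).add_const 1
    have h1 := ((hi.pow 2).mul ((h.vA hr.1 r1).sub (h'.vA hr.1 r1))).sub
      ((hi.const_mul 2).mul ((h.lA hr.1 r1).sub (h'.lA hr.1 r1)))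
    refine HasDerivAt.congr_deriv h1 ?_
    have hb2 := hb1 r hr
    have hs1 : A * (r + 1) ^ 2 ≤ 1 := by
      have : r + 1 ≤ ε := by linarith [hr.2]
      have : 0 < r + 1 := by linarith [hr.1]
      nlinarith
    have c1 := abs_le.1 (hb2.1.trans hs1)
    have c2 := abs_le.1 (hb2.2.trans hs1)
    rw [h.eq r ⟨hr.1, r1⟩, h'.eq r ⟨hr.1, r1⟩, sig_left (by linarith [hr.2]),
      hEeq (l r) (abs_le.2 ⟨by linarith, by linarith⟩),
      hEeq (l' r) (abs_le.2 ⟨by linarith, by linarith⟩)]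
    simp only [Pi.pow_apply, Pi.sub_apply, id]
    field_simp
    ring
  have sub : Icc (-1) (-1 + ε) ⊆ Ico (-1 : ℝ) 1 := fun x hx => ⟨hx.1, by linarith [hx.2]⟩
  have hzc : ContinuousOn z (Icc (-1) (-1 + ε)) := by
    have h1 := h.cl.mono sub
    have h2 := h.cv.mono sub
    have h3 := h'.cl.mono sub
    have h4 := h'.cv.mono sub
    simp only [hz]
    fun_prop
  have hwc : ContinuousOn w (Icc (-1) (-1 + ε)) := by
    intro r hr
    rcases eq_or_lt_of_le hr.1 with rfl | hr1
    · rw [← continuousWithinAt_sdiff_self]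
      unfold ContinuousWithinAt
      rw [w0]
      have h1 := h.tends.sub h'.tends
      rw [sub_self] at h1
      refine Tendsto.congr (fun r => ?_) (h1.mono_left (nhdsWithin_mono _ ?_))
      · simp only [hw]; rw [← sub_div]; congr 1; ring
      · intro x hx
        exact lt_of_le_of_ne hx.1.1 (fun hh => hx.2 hh.symm)
    · exact (hwd r ⟨hr1, hr.2⟩).continuousAt.continuousWithinAt
  obtain ⟨x, hx, hmax⟩ := isCompact_Icc.exists_isMaxOn
    (nonempty_Icc.2 (by linarith : (-1 : ℝ) ≤ -1 + ε)) hwc.abs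
  set m := |w x| with hm
  have hm0 : 0 ≤ m := abs_nonneg _
  have hmw : ∀ r ∈ Icc (-1) (-1 + ε), |w r| ≤ m := fun r hr => hmax hr
  have hmd : ∀ r ∈ Ioc (-1) (-1 + ε), |l r - l' r| ≤ m * (r + 1) ^ 2 := by
    intro r hr
    have h1 := hmw r ⟨hr.1.le, hr.2⟩
    have : 0 < (r + 1) ^ 2 := pow_pos (by linarith [hr.1]) 2
    simp only [hw] at h1
    rwa [abs_div, abs_of_pos this, div_le_iff₀ this] at h1
  have hzb : ∀ r ∈ Ioc (-1) (-1 + ε), |z r| ≤ 9 * A * m * (r + 1) ^ 5 := by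
    intro r hr
    have := abs_slope (C := 9 * A * m * (r + 1) ^ 4) hr.1.le
      (hzc.mono (Icc_subset_Icc le_rfl hr.2)) (fun y hy => hzd y ⟨hy.1, by linarith [hy.2, hr.2]⟩)
      (fun y hy => by
        have y1 : y ∈ Ioc (-1) (-1 + ε) := ⟨hy.1, by linarith [hy.2, hr.2]⟩
        have y0 : 0 < y + 1 := by linarith [hy.1]
        have hs1 : A * (y + 1) ^ 2 ≤ 1 := by
          have : y + 1 ≤ ε := by linarith [y1.2]
          nlinarith
        have c := cubic_diff (hb1 y y1).1 (hb1 y y1).2 hs1 (d := m * (y + 1) ^ 2)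
          (by have := hmd y y1; rwa [add_sub_add_right_eq_sub])
        refine c.trans ?_
        have : (y + 1) ^ 4 ≤ (r + 1) ^ 4 := by
          gcongr; exact hy.2.le
        calc 9 * (A * (y + 1) ^ 2) * (m * (y + 1) ^ 2) = 9 * A * m * (y + 1) ^ 4 := by ring
          _ ≤ _ := by gcongr)
    rw [z0, sub_zero] at this
    calc |z r| ≤ _ := this
      _ = _ := by ring
  have hfin : m ≤ 9 * A * m * ε * ε := by
    have := abs_slope (C := 9 * A * m * ε) hx.1 (hwc.mono (Icc_subset_Icc le_rfl hx.2))
      (fun y hy => hwd y ⟨hy.1, by linarith [hy.2, hx.2]⟩)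
      (fun y hy => by
        have y1 : y ∈ Ioc (-1) (-1 + ε) := ⟨hy.1, by linarith [hy.2, hx.2]⟩
        have y0 : 0 < y + 1 := by linarith [hy.1]
        have h5 := hzb y y1
        rw [abs_div, abs_of_pos (pow_pos y0 4), div_le_iff₀ (pow_pos y0 4)]
        refine h5.trans ?_
        have : y + 1 ≤ ε := by linarith [y1.2]
        calc 9 * A * m * (y + 1) ^ 5 = 9 * A * m * (y + 1) * (y + 1) ^ 4 := by ring
          _ ≤ _ := by gcongr)
    rw [w0, sub_zero] at this
    refine this.trans ?_
    gcongr
    linarith [hx.2]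
  have hmz : m = 0 := by
    by_contra hne
    have hmp : 0 < m := lt_of_le_of_ne hm0 (Ne.symm hne)
    have : 9 * A * ε * ε < 1 := by nlinarith
    nlinarith
  refine ⟨-1 + ε, by linarith, by linarith, fun r hr => ?_⟩
  rcases eq_or_lt_of_le hr.1 with rfl | hr1
  · rw [h.l0, h'.l0]
  · have := hmd r ⟨hr1, hr.2⟩
    rw [hmz, zero_mul] at this
    have := abs_nonpos_iff.1 this
    linarith

lemma Sol.seg {E : ℝ → ℝ} {α : ℝ} {l v q : ℝ → ℝ} (h : Sol E α l v q) {a b : ℝ} (ha : -1 < a)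
    (hb : b < 1) : Seg E a b l v := by
  refine ⟨fun r hr => (h.lA (by linarith [hr.1]) (by linarith [hr.2])).hasDerivWithinAt,
    fun r hr => ?_⟩
  have r1 : r ∈ Ioo (-1 : ℝ) 1 := ⟨by linarith [hr.1], by linarith [hr.2]⟩
  rw [← h.eq r r1]
  exact (h.vA r1.1 r1.2).hasDerivWithinAt

lemma Sol.unique {E : ℝ → ℝ} {α : ℝ} {l v q l' v' q' : ℝ → ℝ} (h : Sol E α l v q)
    (h' : Sol E α l' v' q') (hEeq : ∀ x : ℝ, |x| ≤ 2 → E x = x ^ 3 - x) {K : NNReal}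
    (hE : LipschitzWith K E) : EqOn l l' (Ico (-1) 1) := by
  obtain ⟨e, e1, e2, he⟩ := h.near h' hEeq
  intro r hr
  rcases le_total r e with hre | hre
  · exact he r ⟨hr.1, hre⟩
  set c := (-1 + e) / 2 with hc
  have c1 : -1 < c := by linarith
  have c2 : c < e := by linarith
  have hvc : v c = v' c := by
    refine (h.lA c1 (by linarith)).unique ((h'.lA c1 (by linarith)).congr_of_eventuallyEq ?_)
    filter_upwards [Ioo_mem_nhds c1 c2] with y hy
    exact he y ⟨hy.1.le, hy.2.le⟩
  exact ((h.seg c1 hr.2).unique hE c1 hr.2 (h'.seg c1 hr.2) (he c ⟨c1.le, c2.le⟩) hvc r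
    ⟨by linarith, le_rfl⟩).1

end Stmt13

namespace Stmt13
open Set Filter Topology

/-- coefficients of the power series -/
noncomputable def cf : ℕ → ℝ
  | 0 => 1
  | n + 1 => (-3 * (∑ i : Fin (n + 1), cf i * cf (n - i))
      + ∑ i : Fin n, cf i * ∑ j : Fin (n - 1 - i + 1), cf j * cf (n - 1 - i - j))
        / (((n : ℝ) + 1) * (4 * n + 10))
decreasing_by all_goals omega

noncomputable def conv (a b : ℕ → ℝ) (n : ℕ) : ℝ := ∑ i ∈ Finset.range (n + 1), a i * b (n - i)

noncomputable def shift (a : ℕ → ℝ) (n : ℕ) : ℝ := if n = 0 then 0 else a (n - 1)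

noncomputable def Dc (a : ℕ → ℝ) (n : ℕ) : ℝ := ((n : ℝ) + 1) * a (n + 1)

noncomputable def P (a : ℕ → ℝ) (x : ℝ) : ℝ := ∑' n, a n * x ^ n

def PB (a : ℕ → ℝ) : Prop := ∃ C : ℝ, ∃ k : ℕ, 0 ≤ C ∧ ∀ n : ℕ, |a n| ≤ C * ((n : ℝ) + 1) ^ k

lemma cf_rec (n : ℕ) : ((n : ℝ) + 1) * (4 * n + 10) * cf (n + 1)
    = -3 * conv cf cf n + shift (conv cf (conv cf cf)) n := by
  rw [cf]
  have : ((n : ℝ) + 1) * (4 * n + 10) ≠ 0 := by positivity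
  rw [mul_div_cancel₀ _ this]
  unfold conv shift
  rcases n with _ | n
  · simp [Finset.sum_range]
  · simp only [Finset.sum_range, Nat.add_sub_cancel]
    simp

lemma conv_bound {a b : ℕ → ℝ} {n : ℕ} {C C' : ℝ} (hC : 0 ≤ C)
    (ha : ∀ i ≤ n, |a i| ≤ C) (hb : ∀ i ≤ n, |b i| ≤ C') :
    |conv a b n| ≤ ((n : ℝ) + 1) * (C * C') := by
  unfold conv
  refine (Finset.abs_sum_le_sum_abs _ _).trans ?_
  refine (Finset.sum_le_card_nsmul _ _ (C * C') fun i hi => ?_).trans ?_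
  · rw [Finset.mem_range] at hi
    rw [abs_mul]
    exact mul_le_mul (ha i (by omega)) (hb _ (by omega)) (abs_nonneg _) hC
  · simp

lemma cf_bound (n : ℕ) : |cf n| ≤ 1 := by
  induction n using Nat.strong_induction_on with
  | _ n ih =>
    rcases n with _ | n
    · rw [cf]; simp
    have h1 := cf_rec n
    have hc : ∀ m ≤ n, |conv cf cf m| ≤ (m : ℝ) + 1 := fun m hm => by
      have := conv_bound (n := m) (a := cf) (b := cf) (C := 1) (C' := 1) zero_le_one
        (fun i hi => ih i (by omega)) (fun i hi => ih i (by omega))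
      simpa using this
    have hs : |shift (conv cf (conv cf cf)) n| ≤ (n : ℝ) * n := by
      unfold shift
      rcases n with _ | n
      · simp
      · simp only [Nat.add_sub_cancel]
        have := conv_bound (n := n) (a := cf) (b := conv cf cf) (C := 1) (C' := (n : ℝ) + 1)
          zero_le_one (fun i hi => ih i (by omega))
          (fun i hi => (hc i (by omega)).trans (by gcongr))
        simpa using this
    have h2 := hc n le_rfl
    have pos : 0 < ((n : ℝ) + 1) * (4 * n + 10) := by positivity
    have h3 : |((n : ℝ) + 1) * (4 * n + 10) * cf (n + 1)| ≤ 3 * ((n : ℝ) + 1) + n * n := by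
      rw [h1]
      refine (abs_add_le _ _).trans ?_
      rw [abs_mul]
      norm_num
      linarith
    rw [abs_mul, abs_of_pos pos] at h3
    by_contra hcon
    push Not at hcon
    have : (0 : ℝ) ≤ n := by positivity
    nlinarith [mul_lt_mul_of_pos_left hcon pos]

lemma PB.cf : PB cf := ⟨1, 0, zero_le_one, fun n => by simpa using cf_bound n⟩

lemma PB.conv {a b : ℕ → ℝ} (ha : PB a) (hb : PB b) : PB (conv a b) := by
  obtain ⟨C, k, hC, h⟩ := ha
  obtain ⟨C', k', hC', h'⟩ := hb
  refine ⟨C * C', k + k' + 1, by positivity, fun n => ?_⟩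
  refine (conv_bound (C := C * ((n : ℝ) + 1) ^ k) (C' := C' * ((n : ℝ) + 1) ^ k') (by positivity)
    (fun i hi => (h i).trans (by gcongr)) (fun i hi => (h' i).trans (by gcongr))).trans ?_
  apply le_of_eq; ring

lemma PB.Dc {a : ℕ → ℝ} (ha : PB a) : PB (Dc a) := by
  obtain ⟨C, k, hC, h⟩ := ha
  refine ⟨C * 2 ^ k, k + 1, by positivity, fun n => ?_⟩
  unfold Stmt13.Dc
  rw [abs_mul, abs_of_pos (by positivity)]
  have h1 := h (n + 1)
  have h2 : ((n + 1 : ℕ) : ℝ) + 1 ≤ 2 * (n + 1) := by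
    push_cast; linarith [(by positivity : (0 : ℝ) ≤ n)]
  calc ((n : ℝ) + 1) * |a (n + 1)| ≤ (n + 1) * (C * (((n + 1 : ℕ) : ℝ) + 1) ^ k) := by gcongr
    _ ≤ (n + 1) * (C * (2 * (n + 1)) ^ k) := by gcongr
    _ = _ := by rw [mul_pow]; ring

lemma summ (k : ℕ) : Summable (fun n : ℕ => ((n : ℝ) + 1) ^ k * (1 / 2) ^ n) := by
  have h := summable_pow_mul_geometric_of_norm_lt_one k (r := (1/2 : ℝ)) (by norm_num)
  have h2 := ((summable_nat_add_iff 1).2 h).mul_left 2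
  refine h2.congr fun n => ?_
  push_cast
  rw [pow_succ]; ring

lemma PB.summable {a : ℕ → ℝ} (ha : PB a) {x : ℝ} (hx : |x| < 1 / 2) :
    Summable (fun n => ‖a n * x ^ n‖) := by
  obtain ⟨C, k, hC, h⟩ := ha
  refine Summable.of_nonneg_of_le (fun _ => norm_nonneg _) (fun n => ?_) ((summ k).mul_left C)
  rw [norm_mul, norm_pow, Real.norm_eq_abs, Real.norm_eq_abs, ← mul_assoc]
  gcongr
  exact h n

lemma mul_D {a : ℕ → ℝ} (ha : PB a) {x : ℝ} (hx : |x| < 1 / 2) :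
    x * P (Dc a) x = ∑' n : ℕ, (n * a n) * x ^ n := by
  have h1 := ((PB.Dc ha).summable hx).of_norm
  have e : ∀ n : ℕ, ((n + 1 : ℕ) * a (n + 1)) * x ^ (n + 1) = x * (Dc a n * x ^ n) := fun n => by
    unfold Stmt13.Dc; push_cast; ring
  have h2 : Summable (fun n : ℕ => (n * a n) * x ^ n) := by
    rw [← summable_nat_add_iff 1]
    exact (h1.mul_left x).congr fun n => (e n).symm
  rw [h2.tsum_eq_zero_add]
  simp only [e]
  rw [tsum_mul_left]
  simp [P]

lemma P_deriv {a : ℕ → ℝ} (ha : PB a) {x : ℝ} (hx : |x| < 1 / 2) :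
    HasDerivAt (P a) (P (Dc a) x) x := by
  have ha' := ha
  obtain ⟨C, k, hC, h⟩ := ha
  have hopen : IsOpen (Metric.ball (0 : ℝ) (1/2)) := Metric.isOpen_ball
  have key := hasDerivAt_tsum_of_isPreconnected (𝕜 := ℝ) (F := ℝ)
    (u := fun n : ℕ => 2 * C * (((n : ℝ) + 1) ^ (k + 1) * (1 / 2) ^ n))
    (g := fun n y => a n * y ^ n) (g' := fun n y => a n * (n * y ^ (n - 1)))
    (t := Metric.ball (0 : ℝ) (1/2)) (y₀ := 0) (y := x) ((summ (k + 1)).mul_left _) hopen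
    (convex_ball _ _).isPreconnected
    (fun n y _ => (hasDerivAt_pow n y).const_mul _) (fun n y hy => by
      rw [mem_ball_zero_iff, Real.norm_eq_abs] at hy
      rw [norm_mul, norm_mul, norm_pow, Real.norm_eq_abs, Real.norm_eq_abs, Real.norm_eq_abs]
      rcases n with _ | n
      · simp; positivity
      · rw [Nat.add_sub_cancel]
        have e1 := h (n + 1)
        have : |((n + 1 : ℕ) : ℝ)| ≤ ((n + 1 : ℕ) : ℝ) + 1 := by
          rw [abs_of_nonneg (by positivity)]; linarith
        calc |a (n + 1)| * (|((n + 1 : ℕ) : ℝ)| * |y| ^ n)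
            ≤ (C * (((n + 1 : ℕ) : ℝ) + 1) ^ k) * ((((n + 1 : ℕ) : ℝ) + 1) * (1 / 2) ^ n) := by
              gcongr
          _ = _ := by rw [pow_succ (1/2 : ℝ)]; ring)
    (by simp) (((ha'.summable (x := 0) (by norm_num))).of_norm) (by simpa using hx)
  refine HasDerivAt.congr_deriv key ?_
  have h1 := ((PB.Dc ha').summable hx).of_norm
  have e : ∀ n : ℕ, a (n + 1) * ((n + 1 : ℕ) * x ^ (n + 1 - 1)) = Dc a n * x ^ n := fun n => by
    unfold Stmt13.Dc; simp only [Nat.add_sub_cancel]; push_cast; ring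
  have h2 : Summable (fun n : ℕ => a n * (n * x ^ (n - 1))) := by
    rw [← summable_nat_add_iff 1]
    exact h1.congr fun n => (e n).symm
  rw [h2.tsum_eq_zero_add]
  simp only [e]
  simp [P]

lemma P_mul {a b : ℕ → ℝ} (ha : PB a) (hb : PB b) {x : ℝ} (hx : |x| < 1 / 2) :
    P a x * P b x = P (conv a b) x := by
  unfold P
  rw [tsum_mul_tsum_eq_tsum_sum_range_of_summable_norm (ha.summable hx) (hb.summable hx)]
  congr 1; ext n
  unfold conv
  rw [Finset.sum_mul]
  refine Finset.sum_congr rfl fun i hi => ?_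
  rw [Finset.mem_range] at hi
  have : x ^ n = x ^ i * x ^ (n - i) := by rw [← pow_add]; congr 1; omega
  rw [this]; ring

lemma P_shift {a : ℕ → ℝ} (ha : PB a) {x : ℝ} (hx : |x| < 1 / 2) :
    Summable (fun n => shift a n * x ^ n) ∧ x * P a x = P (shift a) x := by
  have h1 := (ha.summable hx).of_norm
  have e : ∀ n, shift a (n + 1) * x ^ (n + 1) = x * (a n * x ^ n) := fun n => by
    simp [shift, pow_succ]; ring
  have h2 : Summable (fun n : ℕ => shift a n * x ^ n) := by
    rw [← summable_nat_add_iff 1]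
    exact (h1.mul_left x).congr fun n => (e n).symm
  refine ⟨h2, ?_⟩
  unfold P
  rw [h2.tsum_eq_zero_add]
  simp only [e]
  rw [tsum_mul_left]
  simp [shift]

lemma P_ode {x : ℝ} (hx : |x| < 1 / 2) :
    4 * x * P (Dc (Dc cf)) x + 10 * P (Dc cf) x
      = -3 * P cf x ^ 2 + x * P cf x ^ 3 := by
  have b1 := PB.cf
  have b2 := b1.conv b1
  have b3 := b1.conv b2
  have e2 : P cf x ^ 2 = P (conv cf cf) x := by rw [pow_two, P_mul b1 b1 hx]
  have e3 : P cf x ^ 3 = P (conv cf (conv cf cf)) x := by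
    rw [pow_succ', e2, P_mul b1 b2 hx]
  obtain ⟨s3, e4⟩ := P_shift b3 hx
  rw [e2, e3, e4, mul_assoc, mul_D b1.Dc hx]
  have s1 := (b1.Dc.summable hx).of_norm
  have s2 := (b2.summable hx).of_norm
  have s4 : Summable (fun n : ℕ => (n * Dc cf n) * x ^ n) := by
    rw [← summable_nat_add_iff 1]
    refine ((b1.Dc.Dc.summable hx).of_norm.mul_left x).congr fun n => ?_
    unfold Dc; push_cast; ring
  unfold P
  rw [← tsum_mul_left, ← tsum_mul_left, ← tsum_mul_left,
    ← (s4.mul_left 4).tsum_add (s1.mul_left 10), ← (s2.mul_left (-3)).tsum_add s3]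
  congr 1; ext n
  have := cf_rec n
  have e5 : Dc cf n = ((n : ℝ) + 1) * cf (n + 1) := rfl
  rw [e5]
  linear_combination x ^ n * this

lemma P_zero : P cf 0 = 1 := by
  unfold P
  rw [tsum_eq_single 0]
  · simp [cf]
  · intro n hn; simp [hn]

lemma local_sol (α : ℝ) : ∃ l v q : ℝ → ℝ, ∃ δ : ℝ, 0 < δ ∧ δ ≤ 1/8 ∧
    (∀ r, |r + 1| < δ → HasDerivAt l (v r) r ∧ HasDerivAt v (q r) r ∧ ContinuousAt q r ∧
      |l r| ≤ 2 ∧ (r + 1) ^ 2 * q r = l r ^ 3 - l r) ∧ l (-1) = -1 ∧ v (-1) = 0 ∧ q (-1) = α := by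
  set X : ℝ → ℝ := fun r => α * (r + 1) ^ 2 / 2 with hX
  set p0 := P cf with hp0
  set p1 := P (Dc cf) with hp1
  set p2 := P (Dc (Dc cf)) with hp2
  have hXd : ∀ r, HasDerivAt X (α * (r + 1)) r := fun r => by
    refine HasDerivAt.congr_deriv
      (((((hasDerivAt_id r).add_const 1).pow 2).const_mul α).div_const 2) ?_
    simp; ring
  have hX1 : X (-1) = 0 := by simp [hX]
  have d0 : ∀ r, |X r| < 1/2 → HasDerivAt (fun r => p0 (X r)) (p1 (X r) * (α * (r + 1))) r :=
    fun r hr => (P_deriv PB.cf hr).comp r (hXd r)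
  have d1 : ∀ r, |X r| < 1/2 → HasDerivAt (fun r => p1 (X r)) (p2 (X r) * (α * (r + 1))) r :=
    fun r hr => (P_deriv PB.cf.Dc hr).comp r (hXd r)
  have d2 : ∀ r, |X r| < 1/2 → ContinuousAt (fun r => p2 (X r)) r :=
    fun r hr => ((P_deriv PB.cf.Dc.Dc hr).comp r (hXd r)).continuousAt
  set l : ℝ → ℝ := fun r => -1 + X r * p0 (X r) with hl
  set v : ℝ → ℝ := fun r => (p0 (X r) + X r * p1 (X r)) * (α * (r + 1)) with hv
  set q : ℝ → ℝ := fun r => α * (p0 (X r) + X r * p1 (X r))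
    + (α * (r + 1)) ^ 2 * (2 * p1 (X r) + X r * p2 (X r)) with hq
  have dl : ∀ r, |X r| < 1/2 → HasDerivAt l (v r) r := fun r hr => by
    refine HasDerivAt.congr_deriv (((hXd r).mul (d0 r hr)).const_add (-1)) ?_
    simp only [hv]; ring
  have dv : ∀ r, |X r| < 1/2 → HasDerivAt v (q r) r := fun r hr => by
    refine HasDerivAt.congr_deriv (((d0 r hr).add ((hXd r).mul (d1 r hr))).mul
      (((hasDerivAt_id r).add_const 1).const_mul α)) ?_
    simp only [hq, Pi.add_apply, Pi.mul_apply, id]; ring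
  have hlm : l (-1) = -1 := by simp [hl, hX1]
  have hm : |X (-1)| < 1/2 := by rw [hX1]; norm_num
  have hev : ∀ᶠ r in 𝓝 (-1 : ℝ), |X r| < 1/2 ∧ |l r| < 2 := by
    refine Filter.Eventually.and ?_ ?_
    · exact (hXd (-1)).continuousAt.abs.eventually (gt_mem_nhds hm)
    · refine (dl (-1) hm).continuousAt.abs.eventually (gt_mem_nhds ?_)
      beta_reduce; rw [hlm]; norm_num
  obtain ⟨δ, hδ, hδs⟩ := Metric.eventually_nhds_iff.1 hev
  refine ⟨l, v, q, min δ (1/8), lt_min hδ (by norm_num), min_le_right _ _, fun r hr => ?_, hlm,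
    by simp [hv], ?_⟩
  · obtain ⟨r1, r2⟩ := hδs (y := r) (by
      rw [Real.dist_eq, sub_neg_eq_add]; exact hr.trans_le (min_le_left _ _))
    have c0 := (d0 r r1).continuousAt
    have c1 := (d1 r r1).continuousAt
    have c2 := d2 r r1
    have cX := (hXd r).continuousAt
    refine ⟨dl r r1, dv r r1, ?_, r2.le, ?_⟩
    · exact (continuousAt_const.mul (c0.add (cX.mul c1))).add
        ((by fun_prop : ContinuousAt (fun r : ℝ => (α * (r + 1)) ^ 2) r).mul
          ((continuousAt_const.mul c1).add (cX.mul c2)))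
    · have ode := P_ode r1
      rw [← hp0, ← hp1, ← hp2] at ode
      simp only [hq, hl]
      have e : α * (r + 1) ^ 2 = 2 * X r := by simp only [hX]; ring
      linear_combination (X r) ^ 2 * ode + (p0 (X r) + X r * p1 (X r)
        + (α * (r + 1) ^ 2 + 2 * X r) * (2 * p1 (X r) + X r * p2 (X r))) * e
  · simp [hq, hX1, hp0, P_zero]

end Stmt13

namespace Stmt13
open Set Filter Topology

lemma Sol.exist {E : ℝ → ℝ} {K : NNReal} (hE : LipschitzWith K E) (hb24 : ∀ x, |E x| ≤ 24)
    (hEeq : ∀ x : ℝ, |x| ≤ 2 → E x = x ^ 3 - x) (α : ℝ) : ∃ l v q, Sol E α l v q := by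
  obtain ⟨l0, v0, q0, δ, hδ, hδ8, hloc, hl0, hv0, hq0⟩ := local_sol α
  have heq : ∀ r, -1 < r → r < -1 + δ → q0 r = E (l0 r) / sig r := by
    intro r h1 h2
    obtain ⟨-, -, -, h3, h4⟩ := hloc r (by rw [abs_of_pos] <;> linarith)
    rw [hEeq _ h3, sig_left (by linarith), ← h4]
    have : r + 1 ≠ 0 := by linarith
    field_simp
  set a := -1 + δ / 3 with ha
  have a1 : -1 < a := by linarith
  have hseg0 : ∀ b, b < -1 + δ → Seg E a b l0 v0 := by
    intro b hb
    refine ⟨fun r hr => ?_, fun r hr => ?_⟩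
    · exact (hloc r (by rw [abs_of_pos] <;> linarith [hr.1, hr.2])).1.hasDerivWithinAt
    · rw [← heq r (by linarith [hr.1]) (by linarith [hr.2])]
      exact (hloc r (by rw [abs_of_pos] <;> linarith [hr.1, hr.2])).2.1.hasDerivWithinAt
  have hex : ∀ b, ∃ l v, a ≤ b → b < 1 → Seg E a b l v ∧ l a = l0 a ∧ v a = v0 a := by
    intro b
    by_cases h : a ≤ b ∧ b < 1
    · obtain ⟨l, v, h1⟩ := Seg.exist hE hb24 a1 h.1 h.2 (l0 a) (v0 a)
      exact ⟨l, v, fun _ _ => h1⟩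
    · exact ⟨l0, l0, fun h1 h2 => absurd ⟨h1, h2⟩ h⟩
  choose F V hFV using hex
  set l : ℝ → ℝ := fun r => if r ≤ a then l0 r else F ((r + 1) / 2) r with hl
  set v : ℝ → ℝ := fun r => if r ≤ a then v0 r else V ((r + 1) / 2) r with hv
  set q : ℝ → ℝ := fun r => if r ≤ a then q0 r else E (l r) / sig r with hq
  have cA : ∀ r, r < -1 + δ → l r = l0 r ∧ v r = v0 r := by
    intro r hr
    rcases le_or_gt r a with h | h
    · simp [hl, hv, h]
    · simp only [hl, hv, not_le.2 h, if_false]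
      obtain ⟨s1, s2, s3⟩ := hFV ((r + 1) / 2) (by linarith) (by linarith)
      exact (s1.mono le_rfl (by linarith)).unique hE a1 (by linarith) (hseg0 r hr) s2 s3 r
        ⟨h.le, le_rfl⟩
  have cAq : ∀ r, r < -1 + δ → q r = q0 r := by
    intro r hr
    rcases le_or_gt r a with h | h
    · simp [hq, h]
    · have : q r = E (l r) / sig r := by simp [hq, not_le.2 h]
      rw [this, (cA r hr).1, heq r (by linarith) hr]
  have cB : ∀ b r, a < r → r ≤ b → b < 1 → l r = F b r ∧ v r = V b r := by
    intro b r h1 h2 h3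
    simp only [hl, hv, not_le.2 h1, if_false]
    obtain ⟨s1, s2, s3⟩ := hFV ((r + 1) / 2) (by linarith) (by linarith)
    obtain ⟨t1, t2, t3⟩ := hFV b (by linarith) h3
    exact (s1.mono le_rfl (by linarith)).unique hE a1 (by linarith) (t1.mono le_rfl h2)
      (s2.trans t2.symm) (s3.trans t3.symm) r ⟨h1.le, le_rfl⟩
  have near : ∀ r, -1 ≤ r → r < -1 + δ →
      HasDerivAt l (v r) r ∧ HasDerivAt v (q r) r ∧ ContinuousAt q r := by
    intro r h1 h2
    obtain ⟨d1, d2, d3, -⟩ := hloc r (by rw [abs_of_nonneg] <;> linarith)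
    rw [(cA r h2).2, cAq r h2]
    have ev := Iio_mem_nhds h2
    refine ⟨d1.congr_of_eventuallyEq ?_, d2.congr_of_eventuallyEq ?_, d3.congr ?_⟩
    · filter_upwards [ev] with y hy using (cA y hy).1
    · filter_upwards [ev] with y hy using (cA y hy).2
    · filter_upwards [ev] with y hy using (cAq y hy).symm
  have far : ∀ r, a < r → r < 1 →
      HasDerivAt l (v r) r ∧ HasDerivAt v (q r) r ∧ ContinuousAt q r := by
    intro r h1 h2
    set b := (r + 1) / 2 with hb
    have b1 : r < b := by linarith
    have b2 : b < 1 := by linarith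
    obtain ⟨s, -, -⟩ := hFV b (by linarith) b2
    have hqr : ∀ y, a < y → q y = E (l y) / sig y := fun y hy => by simp [hq, not_le.2 hy]
    have d1 := (s.hl r ⟨h1.le, b1.le⟩).hasDerivAt (Icc_mem_nhds h1 b1)
    have d2 := (s.hv r ⟨h1.le, b1.le⟩).hasDerivAt (Icc_mem_nhds h1 b1)
    have e1 := cB b r h1 b1.le b2
    rw [← e1.2] at d1
    rw [← e1.1, ← hqr r h1] at d2
    have ev := Ioo_mem_nhds h1 b1
    have d3 : HasDerivAt l (v r) r := by
      refine d1.congr_of_eventuallyEq ?_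
      filter_upwards [ev] with y hy using (cB b y hy.1 hy.2.le b2).1
    refine ⟨d3, d2.congr_of_eventuallyEq ?_, ?_⟩
    · filter_upwards [ev] with y hy using (cB b y hy.1 hy.2.le b2).2
    · have : ContinuousAt (fun y => E (l y) / sig y) r :=
        (hE.continuous.continuousAt.comp d3.continuousAt).div sig_contDiff.continuous.continuousAt
          (sig_pos (by linarith) h2).ne'
      refine this.congr ?_
      filter_upwards [ev] with y hy using (hqr y hy.1).symm
  have all : ∀ r ∈ Ico (-1 : ℝ) 1,
      HasDerivAt l (v r) r ∧ HasDerivAt v (q r) r ∧ ContinuousAt q r := by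
    intro r hr
    rcases lt_or_ge r (-1 + δ) with h | h
    · exact near r hr.1 h
    · exact far r (by linarith) hr.2
  have hm : (-1 : ℝ) < -1 + δ := by linarith
  refine ⟨l, v, q, ⟨fun r hr => (all r hr).1.hasDerivWithinAt,
    fun r hr => (all r hr).2.1.hasDerivWithinAt,
    fun r hr => (all r hr).2.2.continuousWithinAt, fun r hr => ?_, ?_, ?_, ?_⟩⟩
  · rcases le_or_gt r a with h | h
    · rw [cAq r (by linarith), (cA r (by linarith)).1, heq r hr.1 (by linarith)]
    · simp [hq, not_le.2 h]
  · rw [(cA _ hm).1, hl0]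
  · rw [(cA _ hm).2, hv0]
  · rw [cAq _ hm, hq0]

end Stmt13

/-- a particular choice of curvature function `σ₀`.
`E` is the fixed smooth truncation of `x ↦ x³ - x`.  There exists a smooth positive
function `σ₀` on `[-1,1]`, equal to `(r+1)²` on `[-1,-7/8]` and even about `0`, such
that for each `α` there is a unique `C²` solution `l_α` of `l'' = E(l)/σ₀` with
`l(-1) = -1`, `l'(-1) = 0`, `l''(-1) = α`, and properties (3)–(5) hold. -/
theorem stmt_13 (E : ℝ → ℝ) (hE : ContDiff ℝ (⊤ : ℕ∞) E)
    (hEeq : ∀ x : ℝ, |x| ≤ 2 → E x = x ^ 3 - x)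
    (hEle : ∀ x : ℝ, 2 ≤ |x| → |x| ≤ 3 → |E x| ≤ |x ^ 3 - x|)
    (hE0 : ∀ x : ℝ, 3 ≤ |x| → E x = 0)
    (hEneg : ∀ x : ℝ, x < -1 → E x ≤ 0)
    (hEpos : ∀ x : ℝ, 1 < x → 0 ≤ E x) :
    ∃ σ₀ : ℝ → ℝ,
      ContDiffOn ℝ (⊤ : ℕ∞) σ₀ (Set.Icc (-1) 1) ∧
      (∀ r ∈ Set.Ioo (-1 : ℝ) 1, 0 < σ₀ r) ∧
      (∀ r ∈ Set.Icc (-1 : ℝ) (-7 / 8), σ₀ r = (r + 1) ^ 2) ∧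
      (∀ r ∈ Set.Icc (-1 : ℝ) 1, σ₀ (-r) = σ₀ r) ∧
      (∀ α : ℝ, ∃ l : ℝ → ℝ, SolSigma E σ₀ α l ∧
        ∀ l' : ℝ → ℝ, SolSigma E σ₀ α l' → Set.EqOn l' l (Set.Ico (-1) 1)) ∧
      (∀ α : ℝ, 0 < α → ∀ l : ℝ → ℝ, SolSigma E σ₀ α l →
        ∀ r ∈ Set.Ioc (-1 : ℝ) 0, 0 < derivWithin l (Set.Ico (-1) 1) r) ∧
      (∃ α₀ : ℝ, 0 < α₀ ∧ ∀ α : ℝ, α₀ ≤ α → ∀ l : ℝ → ℝ, SolSigma E σ₀ α l →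
        1 < l (-7 / 8)) ∧
      (∀ α : ℝ, ∀ l : ℝ → ℝ, SolSigma E σ₀ α l → l (7 / 8) = 0 →
        derivWithin l (Set.Ico (-1) 1) (7 / 8) < 5 / 7) := by
  have hb := Stmt13.E_bound hEeq hEle hE0
  have hcs : HasCompactSupport E := by
    refine HasCompactSupport.intro (K := Set.Icc (-3) 3) isCompact_Icc fun x hx => hE0 x ?_
    by_contra h
    push Not at h
    have := abs_lt.1 h
    exact hx ⟨this.1.le, this.2.le⟩
  obtain ⟨K, hK⟩ := ContDiff.lipschitzWith_of_hasCompactSupport hcs hE (by simp)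
  refine ⟨Stmt13.sig, Stmt13.sig_contDiff.contDiffOn, fun r hr => Stmt13.sig_pos hr.1 hr.2,
    fun r hr => Stmt13.sig_left hr.2, fun r _ => Stmt13.sig_even r, fun α => ?_,
    fun α hα l hl r hr => (Stmt13.sol_of hl).v_pos hE.continuous hEeq hEneg hEpos hα hr,
    ⟨641, by norm_num, fun α hα l hl =>
      (Stmt13.sol_of hl).large hE.continuous hEeq hEneg hEpos hα⟩,
    fun α l hl h0 => (Stmt13.sol_of hl).small hEneg hb h0⟩
  obtain ⟨l, v, q, h⟩ := Stmt13.Sol.exist hK hb hEeq α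
  exact ⟨l, h.solSigma, fun l' hl' => (Stmt13.sol_of hl').unique h hEeq hK⟩
end

section
/- Let σ₀, σ₁ : [−1,1] → ℝ be smooth functions, positive on (−1,1), such that for i = 0,1 the function r ↦ 1/σ_i(r) − 1/(1+r)² extends to a smooth function on [−1,1) and the function r ↦ 1/σ_i(r) − 1/(1−r)² extends to a smooth function on (−1,1]. For p ∈ [0,1] set ζ_p = (1−p)·σ₀ + p·σ₁. Then there exist α_max > 0 and β_max > 0, independent of p, such that whenever p ∈ [0,1] and l : [−1,1] → ℝ is a C² function solving l'' = E(l)/ζ_p on (−1,1) with l(−1) = −1, l(1) = 1, l'(−1) = 0, l'(1) = 0, one has l''(−1) < α_max and l''(1) > −β_max (endpoint second derivatives taken one-sided). -/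
namespace Aux14
open Set Filter Topology

theorem mono_of_deriv {f f' : ℝ → ℝ} {a b : ℝ} (hab : a ≤ b) (hc : ContinuousOn f (Icc a b))
    (hd : ∀ x ∈ Ioo a b, HasDerivAt f (f' x) x) (hp : ∀ x ∈ Ioo a b, 0 ≤ f' x) : f a ≤ f b := by
  have : MonotoneOn f (Icc a b) := by
    apply monotoneOn_of_hasDerivWithinAt_nonneg (convex_Icc a b) hc (f' := f')
    · intro x hx
      rw [interior_Icc] at hx ⊢
      exact (hd x hx).hasDerivWithinAt
    · intro x hx
      rw [interior_Icc] at hx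
      exact hp x hx
  exact this (left_mem_Icc.2 hab) (right_mem_Icc.2 hab) hab

theorem hd_congr {f g : ℝ → ℝ} {a b x : ℝ} (h : HasDerivAt f a x) (hf : ∀ y, g y = f y)
    (hb : b = a) : HasDerivAt g b x := by
  rw [funext hf, hb]; exact h

set_option maxHeartbeats 1000000 in
theorem key_left (M δ : ℝ) (hM : 0 ≤ M) (hδ : 0 < δ) (hδ1 : δ ≤ 1)
    (z z' l d1 d2 : ℝ → ℝ) (α : ℝ)
    (hlc : ContinuousOn l (Icc 0 δ)) (hd1c : ContinuousOn d1 (Icc 0 δ))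
    (hzc : ContinuousOn z (Icc 0 δ))
    (hl : ∀ x ∈ Ioc 0 δ, HasDerivAt l (d1 x) x)
    (hd1 : ∀ x ∈ Ioc 0 δ, HasDerivAt d1 (d2 x) x)
    (hz : ∀ x ∈ Ioc 0 δ, HasDerivAt z (z' x) x)
    (hd2 : ∀ x ∈ Ioc 0 δ, d2 x * z x = l x ^ 3 - l x)
    (hzpos : ∀ x ∈ Ioc 0 δ, 0 < z x)
    (hzle : ∀ x ∈ Ioc 0 δ, z x ≤ 2 * x ^ 2)
    (hz' : ∀ x ∈ Ioc 0 δ, x ≤ z' x)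
    (hzM : ∀ x ∈ Ioc 0 δ, z x * (1 - M * x ^ 2) ≤ x ^ 2)
    (hlu : ∀ x ∈ Icc 0 δ, l x ≤ 1) (hll : ∀ x ∈ Icc 0 δ, -1 ≤ l x)
    (hl0 : l 0 = -1) (hd10 : d1 0 = 0)
    (hα : HasDerivWithinAt d1 α (Ici 0) 0) :
    α ≤ 4 / (δ * Real.exp (-3)) ^ 2 * Real.exp (6 + M) := by
  by_contra hcon
  push Not at hcon
  have hαpos : 0 < α := lt_of_le_of_lt (by positivity) hcon
  -- d1 ≥ α/2 x near 0
  obtain ⟨η, hη, hηd⟩ : ∃ η > 0, ∀ x ∈ Ioo 0 η, α / 2 * x ≤ d1 x := by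
    have h1 := (hasDerivWithinAt_iff_tendsto_slope.1 hα)
    have h2 : ∀ᶠ x in 𝓝[Ici 0 \ {0}] (0:ℝ), α / 2 < slope d1 0 x :=
      h1.eventually (lt_mem_nhds (by linarith))
    have h3 : Ici (0:ℝ) \ {0} = Ioi 0 := by ext x; simp [lt_iff_le_and_ne, eq_comm]
    rw [h3] at h2
    obtain ⟨η, hη, h⟩ := mem_nhdsGT_iff_exists_Ioo_subset.1 h2
    refine ⟨η, hη, fun x hx => ?_⟩
    have := h hx
    simp only [mem_ofPred_eq, slope_def_field, hd10, sub_zero] at this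
    rw [lt_div_iff₀ hx.1] at this
    exact this.le
  -- energy
  set H : ℝ → ℝ := fun x => z x * d1 x ^ 2 / 2 - (l x ^ 2 - 1) ^ 2 / 4 with hH
  have hHc : ContinuousOn H (Icc 0 δ) := by
    rw [hH]; fun_prop
  have hHd : ∀ x ∈ Ioc 0 δ, HasDerivAt H (z' x * d1 x ^ 2 / 2) x := by
    intro x hx
    have := ((((hz x hx).mul ((hd1 x hx).pow 2)).div_const 2).sub
      (((((hl x hx).pow 2).sub_const 1).pow 2).div_const 4))
    have e := hd2 x hx
    refine hd_congr this (fun y => by simp [hH]) ?_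
    simp
    linear_combination (-d1 x) * e
  have hH0 : H 0 = 0 := by simp [hH, hl0, hd10]
  have hHle : ∀ c ∈ Icc 0 δ, ∀ y ∈ Icc c δ, H c ≤ H y := by
    intro c hc y hy
    apply mono_of_deriv hy.1 (f' := fun x => z' x * d1 x ^ 2 / 2)
    · exact hHc.mono (Icc_subset_Icc hc.1 hy.2)
    · intro x hx
      exact hHd x ⟨lt_of_le_of_lt hc.1 hx.1, hx.2.le.trans hy.2⟩
    · intro x hx
      have h0 : 0 < x := lt_of_le_of_lt hc.1 hx.1
      have := hz' x ⟨h0, hx.2.le.trans hy.2⟩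
      have : 0 ≤ z' x := by linarith
      positivity
  have hHnn : ∀ x ∈ Icc 0 δ, 0 ≤ H x := fun x hx => hH0 ▸ hHle 0 ⟨le_rfl, hδ.le⟩ x hx
  -- H positive
  have hHpos : ∀ x ∈ Ioc 0 δ, 0 < H x := by
    intro x hx
    set c := min (η / 2) x with hc
    have hc0 : 0 < c := lt_min (by linarith) hx.1
    have hcx : c ≤ x := min_le_right _ _
    have hcη : c < η := lt_of_le_of_lt (min_le_left _ _) (by linarith)
    have hst : StrictMonoOn H (Icc 0 c) := by
      apply strictMonoOn_of_hasDerivWithinAt_pos (convex_Icc 0 c)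
        (hHc.mono (Icc_subset_Icc le_rfl (hcx.trans hx.2))) (f' := fun x => z' x * d1 x ^ 2 / 2)
      · intro y hy
        rw [interior_Icc] at hy
        exact (hHd y ⟨hy.1, hy.2.le.trans (hcx.trans hx.2)⟩).hasDerivWithinAt
      · intro y hy
        rw [interior_Icc] at hy
        have h1 := hz' y ⟨hy.1, hy.2.le.trans (hcx.trans hx.2)⟩
        have h2 := hηd y ⟨hy.1, hy.2.trans hcη⟩
        have h3 : 0 < d1 y := lt_of_lt_of_le (mul_pos (by linarith) hy.1) h2
        have h4 : 0 < z' y := lt_of_lt_of_le hy.1 h1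
        positivity
    have h1 := hst (left_mem_Icc.2 hc0.le) (right_mem_Icc.2 hc0.le) hc0
    have h2 := hHle c ⟨hc0.le, hcx.trans hx.2⟩ x ⟨hcx, hx.2⟩
    linarith
  -- d1 positive
  have hd1ne : ∀ x ∈ Ioc 0 δ, d1 x ≠ 0 := by
    intro x hx h
    have := hHpos x hx
    simp only [hH, h] at this
    nlinarith [sq_nonneg (l x ^ 2 - 1)]
  have hd1pos : ∀ x ∈ Ioc 0 δ, 0 < d1 x := by
    intro x hx
    by_contra hneg
    push Not at hneg
    set c := min (η / 2) x with hc
    have hc0 : 0 < c := lt_min (by linarith) hx.1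
    have hcx : c ≤ x := min_le_right _ _
    have hcη : c < η := lt_of_le_of_lt (min_le_left _ _) (by linarith)
    have h2 := hηd c ⟨hc0, hcη⟩
    have h3 : 0 < d1 c := lt_of_lt_of_le (mul_pos (by linarith) hc0) h2
    obtain ⟨y, hy, hy0⟩ := intermediate_value_Icc' hcx
      (hd1c.mono (Icc_subset_Icc hc0.le hx.2)) (show (0:ℝ) ∈ Icc (d1 x) (d1 c) from ⟨hneg, h3.le⟩)
    exact hd1ne y ⟨lt_of_lt_of_le hc0 hy.1, hy.2.trans hx.2⟩ hy0
  have hlmono : ∀ c ∈ Icc 0 δ, ∀ y ∈ Icc c δ, l c ≤ l y := by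
    intro c hc y hy
    apply mono_of_deriv hy.1 (f' := d1)
    · exact hlc.mono (Icc_subset_Icc hc.1 hy.2)
    · intro x hx
      exact hl x ⟨lt_of_le_of_lt hc.1 hx.1, hx.2.le.trans hy.2⟩
    · intro x hx
      exact (hd1pos x ⟨lt_of_le_of_lt hc.1 hx.1, hx.2.le.trans hy.2⟩).le
  -- lower slope bound
  have hslope : ∀ x ∈ Ioc 0 δ, 1 - l x ^ 2 ≤ 2 * x * d1 x := by
    intro x hx
    have h1 := hHnn x ⟨hx.1.le, hx.2⟩
    have h2 := hd1pos x hx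
    have h3 := hzle x hx
    simp only [hH] at h1
    apply le_of_sq_le_sq _ (by have := hx.1; positivity)
    nlinarith [mul_le_mul_of_nonneg_right h3 (sq_nonneg (d1 x))]
  set m := δ * Real.exp (-3) with hm
  have hm0 : 0 < m := by positivity
  have hmδ : m ≤ δ := by
    have : Real.exp (-3) ≤ 1 := Real.exp_le_one_iff.2 (by norm_num)
    nlinarith
  have hlm : l m ≤ 0 := by
    by_contra hlm
    push Not at hlm
    have hHm : 1 / 6 ≤ H m := by
      have := mono_of_deriv hm0.le (f := fun x => H x - 1 / 4 * (l x - l x ^ 3 / 3))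
        (f' := fun x => z' x * d1 x ^ 2 / 2 - 1 / 4 * (d1 x - (3 * l x ^ 2 * d1 x) / 3)) ?_ ?_ ?_
      · simp only [hH0, hl0] at this
        have h1 := hlu m ⟨hm0.le, hmδ⟩
        nlinarith [mul_nonneg hlm.le (by nlinarith : 0 ≤ 1 - l m ^ 2 / 3)]
      · have h1 := hHc.mono (Icc_subset_Icc (le_refl 0) hmδ)
        have h2 := hlc.mono (Icc_subset_Icc (le_refl 0) hmδ)
        fun_prop
      · intro x hx
        have hx' : x ∈ Ioc 0 δ := ⟨hx.1, hx.2.le.trans hmδ⟩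
        have := (hHd x hx').sub (((hl x hx').sub (((hl x hx').pow 3).div_const 3)).const_mul (1/4))
        exact hd_congr this (fun y => by simp) (by simp)
      · intro x hx
        have hx' : x ∈ Ioc 0 δ := ⟨hx.1, hx.2.le.trans hmδ⟩
        have h1 := hd1pos x hx'
        have h2 := hslope x hx'
        have h3 := hz' x hx'
        have : 0 ≤ d1 x * (z' x * d1 x / 2 - 1 / 4 * (1 - l x ^ 2)) := by
          apply mul_nonneg h1.le
          nlinarith [mul_le_mul_of_nonneg_right h3 h1.le]
        linarith
    have := mono_of_deriv hmδ (f := fun x => l x - 2 / 5 * Real.log x)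
        (f' := fun x => d1 x - 2 / 5 * x⁻¹) ?_ ?_ ?_
    · have h1 := hlu δ ⟨hδ.le, le_rfl⟩
      rw [hm, Real.log_mul hδ.ne' (Real.exp_pos _).ne', Real.log_exp, ← hm] at this
      linarith
    · have h2 := hlc.mono (Icc_subset_Icc hm0.le (le_refl δ))
      apply h2.sub
      apply ContinuousOn.mul continuousOn_const
      apply Real.continuousOn_log.mono
      intro x hx
      exact (lt_of_lt_of_le hm0 hx.1).ne'
    · intro x hx
      have h0 := hm0.trans hx.1
      exact (hl x ⟨h0, hx.2.le⟩).sub ((Real.hasDerivAt_log h0.ne').const_mul _)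
    · intro x hx
      have h0 := hm0.trans hx.1
      have hx' : x ∈ Ioc 0 δ := ⟨h0, hx.2.le⟩
      have h1 := hd1pos x hx'
      have h2 := hHle m ⟨hm0.le, hmδ⟩ x ⟨hx.1.le, hx.2.le⟩
      have h3 := hzle x hx'
      have h4 : 2 / 5 ≤ d1 x * x := by
        apply le_of_sq_le_sq _ (by positivity)
        have h5 : 1 / 6 ≤ z x * d1 x ^ 2 / 2 - (l x ^ 2 - 1) ^ 2 / 4 := by
          simpa [hH] using hHm.trans h2
        nlinarith [mul_le_mul_of_nonneg_right h3 (sq_nonneg (d1 x)), sq_nonneg (l x ^ 2 - 1)]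
      have : 2 / 5 * x⁻¹ ≤ d1 x := by
        rw [← div_eq_mul_inv, div_le_iff₀ h0]; exact h4
      linarith
  -- D bound
  have hlx : ∀ x ∈ Ioc 0 m, l x ≤ 0 := fun x hx =>
    (hlmono x ⟨hx.1.le, hx.2.trans hmδ⟩ m ⟨hx.2, hmδ⟩).trans hlm
  have hD : ∀ x ∈ Ioc 0 m, 2 * (l x + 1) - x * d1 x ≤ 3 * (l x + 1) ^ 2 + 2 * M * x ^ 2 * (l x + 1) := by
    intro x hx
    have := mono_of_deriv hx.1.le
      (f := fun y => y * (3 * (l y + 1) ^ 2 + 2 * M * y ^ 2 * (l y + 1)) - y * (2 * (l y + 1) - y * d1 y))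
      (f' := fun y => (3 * (l y + 1) ^ 2 + 2 * M * y ^ 2 * (l y + 1)) +
        y * (3 * (2 * (l y + 1) * d1 y) + (2 * M * (2 * y) * (l y + 1) + 2 * M * y ^ 2 * d1 y))
        - ((2 * (l y + 1) - y * d1 y) + y * (2 * d1 y - (d1 y + y * d2 y)))) ?_ ?_ ?_
    · simp only [zero_mul, sub_zero] at this
      have h1 := sub_nonneg.1 this
      exact le_of_mul_le_mul_left h1 hx.1
    · have h2 := hlc.mono (Icc_subset_Icc (le_refl 0) (hx.2.trans hmδ))
      have h3 := hd1c.mono (Icc_subset_Icc (le_refl 0) (hx.2.trans hmδ))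
      fun_prop
    · intro y hy
      have hy' : y ∈ Ioc 0 δ := ⟨hy.1, hy.2.le.trans (hx.2.trans hmδ)⟩
      have hu := (hl y hy').add_const 1
      have hy1 := hasDerivAt_id' y
      have h1 := hy1.mul (((hu.pow 2).const_mul 3).add (((hy1.pow 2).const_mul (2 * M)).mul hu))
      have h2 := hy1.mul ((hu.const_mul 2).sub (hy1.mul (hd1 y hy')))
      exact hd_congr (h1.sub h2) (fun y => by simp) (by simp)
    · intro y hy
      have hy' : y ∈ Ioc 0 δ := ⟨hy.1, hy.2.le.trans (hx.2.trans hmδ)⟩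
      have hy0 := hy.1
      have h1 := hd1pos y hy'
      have h2 := hlx y ⟨hy.1, hy.2.le.trans hx.2⟩
      have h3 := hll y ⟨hy.1.le, hy'.2⟩
      obtain ⟨u, hu⟩ : ∃ u, u = l y + 1 := ⟨_, rfl⟩
      have hu0 : 0 ≤ u := by linarith
      have hu1 : u ≤ 1 := by linarith
      have hzp := hzpos y hy'
      have hk : u * (1 - u) * (2 - u) * (1 - M * y ^ 2) ≤ y ^ 2 * d2 y := by
        have e := hd2 y hy'
        have e2 : d2 y * z y = u * (1 - u) * (2 - u) := by
          rw [e, hu]; ring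
        have hd2nn : 0 ≤ d2 y := by
          have : 0 ≤ d2 y * z y := by
            rw [e2]; exact mul_nonneg (mul_nonneg hu0 (by linarith)) (by linarith)
          exact nonneg_of_mul_nonneg_left this hzp
        rw [← e2]
        have := mul_le_mul_of_nonneg_left (hzM y hy') hd2nn
        linarith
      have hk2 : 2 * u - 3 * u ^ 2 - 2 * M * y ^ 2 * u ≤ y ^ 2 * d2 y := by
        refine le_trans ?_ hk
        have : 0 ≤ u ^ 3 + M * y ^ 2 * (u * (u * (3 - u))) := by
          have : 0 ≤ 3 - u := by linarith
          positivity
        linarith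
      simp only [← hu]
      have : 0 ≤ y * (3 * (2 * u * d1 y) + (2 * M * (2 * y) * u + 2 * M * y ^ 2 * d1 y)) := by
        positivity
      linarith
  -- W monotone
  have hW : ∀ x ∈ Ioc 0 m, (l x + 1) / x ^ 2 * Real.exp (6 * (l x + 1) + M * x ^ 2) ≤
      (l m + 1) / m ^ 2 * Real.exp (6 * (l m + 1) + M * m ^ 2) := by
    intro x hx
    apply mono_of_deriv hx.2
      (f := fun y => (l y + 1) / y ^ 2 * Real.exp (6 * (l y + 1) + M * y ^ 2))
      (f' := fun y => (d1 y * y ^ 2 - (l y + 1) * (2 * y)) / (y ^ 2) ^ 2 * Real.exp (6 * (l y + 1) + M * y ^ 2)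
        + (l y + 1) / y ^ 2 * (Real.exp (6 * (l y + 1) + M * y ^ 2) * (6 * d1 y + M * (2 * y))))
    · have h2 := hlc.mono (Icc_subset_Icc hx.1.le hmδ)
      have h3 : ∀ y ∈ Icc x m, y ^ 2 ≠ 0 := fun y hy => by
        have := lt_of_lt_of_le hx.1 hy.1
        positivity
      fun_prop (disch := assumption)
    · intro y hy
      have hy0 : 0 < y := hx.1.trans hy.1
      have hy' : y ∈ Ioc 0 δ := ⟨hy0, hy.2.le.trans hmδ⟩
      have hu := (hl y hy').add_const 1
      have hy1 : HasDerivAt (fun y : ℝ => y ^ 2) (2 * y) y := by simpa using hasDerivAt_pow 2 y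
      have h1 := (hu.div hy1 (by positivity)).mul (((hu.const_mul 6).add (hy1.const_mul M)).exp)
      exact h1
    · intro y hy
      have hy0 : 0 < y := hx.1.trans hy.1
      have hy' : y ∈ Ioc 0 δ := ⟨hy0, hy.2.le.trans hmδ⟩
      have h1 := hd1pos y hy'
      have h2 := hlx y ⟨hy0, hy.2.le⟩
      have h3 := hll y ⟨hy0.le, hy'.2⟩
      have h4 := hslope y hy'
      have h5 := hD y ⟨hy0, hy.2.le⟩
      obtain ⟨u, hu⟩ : ∃ u, u = l y + 1 := ⟨_, rfl⟩
      have hu0 : 0 ≤ u := by linarith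
      have hu1 : u ≤ 1 := by linarith
      have hl' : l y = u - 1 := by linarith
      rw [hl'] at h4
      simp only [← hu] at h5 ⊢
      have e : (d1 y * y ^ 2 - u * (2 * y)) / (y ^ 2) ^ 2 * Real.exp (6 * u + M * y ^ 2)
        + u / y ^ 2 * (Real.exp (6 * u + M * y ^ 2) * (6 * d1 y + M * (2 * y)))
        = Real.exp (6 * u + M * y ^ 2) / y ^ 3 * (y * d1 y - 2 * u + u * (6 * (y * d1 y) + 2 * M * y ^ 2)) := by
        field_simp
      rw [e]
      apply mul_nonneg (by positivity)
      have h6 : u ≤ 2 * (y * d1 y) := by nlinarith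
      nlinarith [mul_le_mul_of_nonneg_left h6 hu0]
  -- conclusion
  set c := min (η / 2) m with hc
  have hc0 : 0 < c := lt_min (by linarith) hm0
  have hcm : c ≤ m := min_le_right _ _
  have hcη : c < η := lt_of_le_of_lt (min_le_left _ _) (by linarith)
  have hlow : α / 4 * c ^ 2 ≤ l c + 1 := by
    have := mono_of_deriv hc0.le (f := fun x => l x - α / 4 * x ^ 2)
      (f' := fun x => d1 x - α / 4 * (2 * x)) ?_ ?_ ?_
    · simp only [hl0] at this
      linarith
    · have h2 := hlc.mono (Icc_subset_Icc (le_refl 0) (hcm.trans hmδ))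
      fun_prop
    · intro x hx
      have hy1 : HasDerivAt (fun y : ℝ => y ^ 2) (2 * x) x := by simpa using hasDerivAt_pow 2 x
      exact (hl x ⟨hx.1, hx.2.le.trans (hcm.trans hmδ)⟩).sub (hy1.const_mul _)
    · intro x hx
      have := hηd x ⟨hx.1, hx.2.trans hcη⟩
      linarith
  have h1 := hW c ⟨hc0, hcm⟩
  have h2 : α / 4 ≤ (l c + 1) / c ^ 2 := by
    rw [le_div_iff₀ (by positivity)]; exact hlow
  have h3 : (l c + 1) / c ^ 2 ≤ (l c + 1) / c ^ 2 * Real.exp (6 * (l c + 1) + M * c ^ 2) := by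
    apply le_mul_of_one_le_right
    · linarith
    · apply Real.one_le_exp
      have := hll c ⟨hc0.le, hcm.trans hmδ⟩
      have : 0 ≤ l c + 1 := by linarith
      positivity
  have h4 : (l m + 1) / m ^ 2 * Real.exp (6 * (l m + 1) + M * m ^ 2) ≤ 1 / m ^ 2 * Real.exp (6 + M) := by
    have hm1 : m ^ 2 ≤ 1 := by nlinarith
    have := hll m ⟨hm0.le, hmδ⟩
    gcongr
    · linarith
    · linarith
    · nlinarith
  have : 4 / m ^ 2 * Real.exp (6 + M) = 4 * (1 / m ^ 2 * Real.exp (6 + M)) := by ring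
  linarith

theorem sigma_bounds (σ : ℝ → ℝ) (hσ : ContDiffOn ℝ (⊤ : ℕ∞) σ (Icc (-1) 1))
    (hpos : ∀ r ∈ Ioo (-1 : ℝ) 1, 0 < σ r)
    (hext : ∃ S : ℝ → ℝ, ContDiffOn ℝ (⊤ : ℕ∞) S (Ico (-1) 1) ∧
      ∀ r ∈ Ioo (-1 : ℝ) 1, 1 / σ r - 1 / (1 + r) ^ 2 = S r) :
    ∃ M δ : ℝ, 0 ≤ M ∧ 0 < δ ∧ δ ≤ 1 / 2 ∧ ∀ x ∈ Ioc 0 δ,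
      HasDerivAt σ (deriv σ (x - 1)) (x - 1) ∧ σ (x - 1) ≤ 2 * x ^ 2 ∧ x ≤ deriv σ (x - 1) ∧
      σ (x - 1) * (1 - M * x ^ 2) ≤ x ^ 2 := by
  obtain ⟨S, hS, hSe⟩ := hext
  have hu : UniqueDiffOn ℝ (Ico (-1:ℝ) 1) := uniqueDiffOn_Ico _ _
  have hS' : ContinuousOn (derivWithin S (Ico (-1) 1)) (Ico (-1) 1) :=
    hS.continuousOn_derivWithin hu (by simp)
  have hsub : Icc (-1:ℝ) (-1/2) ⊆ Ico (-1) 1 := fun x hx => ⟨hx.1, by linarith [hx.2]⟩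
  obtain ⟨M1, hM1⟩ := isCompact_Icc.exists_bound_of_continuousOn (hS.continuousOn.mono hsub)
  obtain ⟨M2, hM2⟩ := isCompact_Icc.exists_bound_of_continuousOn (hS'.mono hsub)
  obtain ⟨M, hM⟩ : ∃ M, M = |M1| + |M2| := ⟨_, rfl⟩
  have hM0 : 0 ≤ M := by rw [hM]; positivity
  obtain ⟨δ, hδ⟩ : ∃ δ, δ = 1 / (8 * M + 2) := ⟨_, rfl⟩
  have hδ0 : 0 < δ := by rw [hδ]; positivity
  have hδ1 : δ ≤ 1 / 2 := by rw [hδ]; gcongr; linarith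
  have hMδ : M * δ ≤ 1 / 8 := by
    rw [hδ, mul_one_div, div_le_iff₀ (by positivity)]; linarith
  refine ⟨M, δ, hM0, hδ0, hδ1, fun x hx => ?_⟩
  have hx0 := hx.1
  have hx1 : x ≤ 1 / 2 := hx.2.trans hδ1
  have hr : x - 1 ∈ Ioo (-1:ℝ) 1 := ⟨by linarith, by linarith⟩
  have hrc : x - 1 ∈ Icc (-1:ℝ) (-1/2) := ⟨by linarith, by linarith⟩
  have hMx : M * x ^ 2 ≤ 1 / 8 := by
    have : M * x ≤ 1 / 8 := (mul_le_mul_of_nonneg_left hx.2 hM0).trans hMδ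
    nlinarith
  have hσd : HasDerivAt σ (deriv σ (x - 1)) (x - 1) := by
    have := (hσ.differentiableOn (by simp)) (x - 1) ⟨hr.1.le, hr.2.le⟩
    exact (this.differentiableAt (Icc_mem_nhds hr.1 hr.2)).hasDerivAt
  have hSd : HasDerivAt S (derivWithin S (Ico (-1) 1) (x - 1)) (x - 1) := by
    have := (hS.differentiableOn (by simp)) (x - 1) ⟨hr.1.le, hr.2⟩
    exact this.hasDerivWithinAt.hasDerivAt (Ico_mem_nhds hr.1 hr.2)
  have hid : ∀ r ∈ Ioo (-1:ℝ) 1, σ r * (1 + S r * (1 + r) ^ 2) = (1 + r) ^ 2 := by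
    intro r hr
    have h1 := hpos r hr
    have h2 : 0 < 1 + r := by linarith [hr.1]
    rw [← hSe r hr]
    field_simp
    ring
  have hX : HasDerivAt (fun r : ℝ => (1 + r) ^ 2) (2 * x) (x - 1) :=
    hd_congr (((hasDerivAt_id' (x - 1)).const_add 1).pow 2) (fun y => by simp) (by simp)
  have hprod := hσd.mul ((hSd.mul hX).const_add 1)
  have heq : deriv σ (x - 1) * (1 + S (x - 1) * (1 + (x - 1)) ^ 2) + σ (x - 1) *
      (derivWithin S (Ico (-1) 1) (x - 1) * (1 + (x - 1)) ^ 2 + S (x - 1) * (2 * x)) = 2 * x := by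
    refine hprod.unique (hX.congr_of_eventuallyEq ?_)
    filter_upwards [Ioo_mem_nhds hr.1 hr.2] with r hr
    exact hid r hr
  have hi := hid _ hr
  have hp := hpos _ hr
  have hSb : |S (x - 1)| ≤ M := by
    have := hM1 _ hrc
    rw [Real.norm_eq_abs] at this
    rw [hM]; linarith [le_abs_self M1, abs_nonneg M2]
  have hSb' : |derivWithin S (Ico (-1) 1) (x - 1)| ≤ M := by
    have := hM2 _ hrc
    rw [Real.norm_eq_abs] at this
    rw [hM]; linarith [le_abs_self M2, abs_nonneg M1]
  rw [abs_le] at hSb hSb'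
  generalize derivWithin S (Ico (-1) 1) (x - 1) = T at *
  generalize deriv σ (x - 1) = s' at *
  generalize hs : σ (x - 1) = s at *
  generalize S (x - 1) = Q at *
  have e1 : 1 + (x - 1) = x := by ring
  rw [e1] at hi heq
  have hx2 : 0 < x ^ 2 := by positivity
  have q1 : Q * x ^ 2 ≤ M * x ^ 2 := mul_le_mul_of_nonneg_right hSb.2 hx2.le
  have q2 : -M * x ^ 2 ≤ Q * x ^ 2 := mul_le_mul_of_nonneg_right hSb.1 hx2.le
  have t1 : T * x ^ 2 ≤ M * x ^ 2 := mul_le_mul_of_nonneg_right hSb'.2 hx2.le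
  have hsle : s ≤ 8 / 7 * x ^ 2 := by nlinarith
  refine ⟨hσd, by linarith, ?_, ?_⟩
  · have hb : s * (T * x ^ 2 + Q * (2 * x)) ≤ 3 / 7 * x := by
      have a1 : T * x ^ 2 + Q * (2 * x) ≤ M * x ^ 2 + M * (2 * x) := by nlinarith
      have a2 : 0 ≤ M * x ^ 2 + M * (2 * x) := by positivity
      calc s * (T * x ^ 2 + Q * (2 * x)) ≤ s * (M * x ^ 2 + M * (2 * x)) := by gcongr
        _ ≤ 8 / 7 * x ^ 2 * (M * x ^ 2 + M * (2 * x)) := by gcongr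
        _ = 8 / 7 * x * (M * x ^ 2) * (x + 2) := by ring
        _ ≤ 8 / 7 * x * (1 / 8) * (1 + 2) := by gcongr; linarith
        _ = 3 / 7 * x := by ring
    have hb2 : 11 / 7 * x ≤ s' * (1 + Q * x ^ 2) := by linarith
    by_contra hc
    push Not at hc
    nlinarith
  · nlinarith

/-- maximum principle -/
theorem max_principle (l d1 d2 : ℝ → ℝ) (hlc : ContinuousOn l (Icc (-1) 1))
    (hl : ∀ r ∈ Ioo (-1:ℝ) 1, HasDerivAt l (d1 r) r)
    (hd : ∀ r ∈ Ioo (-1:ℝ) 1, HasDerivAt d1 (d2 r) r)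
    (hd2 : ∀ r ∈ Ioo (-1:ℝ) 1, 1 < l r → 0 ≤ d2 r)
    (h1 : l (-1) ≤ 1) (h2 : l 1 ≤ 1) : ∀ r ∈ Icc (-1:ℝ) 1, l r ≤ 1 := by
  intro r0 hr0
  by_contra hcon
  push Not at hcon
  obtain ⟨ε, hε⟩ : ∃ ε, ε = (l r0 - 1) / 2 := ⟨_, rfl⟩
  have hε0 : 0 < ε := by linarith
  have hvc : ContinuousOn (fun r => l r + ε * r ^ 2) (Icc (-1) 1) := by fun_prop
  obtain ⟨c, hc, hmax⟩ := isCompact_Icc.exists_isMaxOn ⟨r0, hr0⟩ hvc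
  have hcr : l r0 + ε * r0 ^ 2 ≤ l c + ε * c ^ 2 := hmax hr0
  have hc2 : c ^ 2 ≤ 1 := by nlinarith [hc.1, hc.2]
  have hlc1 : 1 < l c := by nlinarith [sq_nonneg r0]
  have hco : c ∈ Ioo (-1:ℝ) 1 := by
    refine ⟨lt_of_le_of_ne hc.1 ?_, lt_of_le_of_ne hc.2 ?_⟩
    · rintro rfl; linarith
    · rintro rfl; linarith
  have hlm : IsLocalMax (fun r => l r + ε * r ^ 2) c :=
    hmax.isLocalMax (Icc_mem_nhds hco.1 hco.2)
  have hv : ∀ r ∈ Ioo (-1:ℝ) 1, HasDerivAt (fun r => l r + ε * r ^ 2) (d1 r + ε * (2 * r)) r := by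
    intro r hr
    have hy1 : HasDerivAt (fun y : ℝ => y ^ 2) (2 * r) r := by simpa using hasDerivAt_pow 2 r
    exact (hl r hr).add (hy1.const_mul ε)
  have hev : deriv (fun r => l r + ε * r ^ 2) =ᶠ[𝓝 c] fun r => d1 r + ε * (2 * r) := by
    filter_upwards [Ioo_mem_nhds hco.1 hco.2] with r hr
    exact (hv r hr).deriv
  have hdd : deriv (deriv (fun r => l r + ε * r ^ 2)) c = d2 c + ε * 2 := by
    rw [hev.deriv_eq]
    exact ((hd c hco).add (((hasDerivAt_id' c).const_mul 2).const_mul ε)).deriv.trans (by ring)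
  have hpos : 0 < deriv (deriv (fun r => l r + ε * r ^ 2)) c := by
    rw [hdd]; linarith [hd2 c hco hlc1]
  have hmin := isLocalMin_of_deriv_deriv_pos hpos hlm.deriv_eq_zero (hv c hco).continuousAt
  have hconst : (fun r => l r + ε * r ^ 2) =ᶠ[𝓝 c] fun _ => l c + ε * c ^ 2 := by
    filter_upwards [hlm, hmin] with r h1 h2
    exact le_antisymm h1 h2
  have : deriv (deriv (fun r => l r + ε * r ^ 2)) c = 0 := by
    rw [hconst.deriv.deriv_eq]; simp
  linarith

theorem left_bound (σ₀ σ₁ : ℝ → ℝ)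
    (hσ₀ : ContDiffOn ℝ (⊤ : ℕ∞) σ₀ (Icc (-1) 1))
    (hσ₁ : ContDiffOn ℝ (⊤ : ℕ∞) σ₁ (Icc (-1) 1))
    (hσ₀pos : ∀ r ∈ Ioo (-1 : ℝ) 1, 0 < σ₀ r)
    (hσ₁pos : ∀ r ∈ Ioo (-1 : ℝ) 1, 0 < σ₁ r)
    (hσ₀ext : ∃ S : ℝ → ℝ, ContDiffOn ℝ (⊤ : ℕ∞) S (Ico (-1) 1) ∧
      ∀ r ∈ Ioo (-1 : ℝ) 1, 1 / σ₀ r - 1 / (1 + r) ^ 2 = S r)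
    (hσ₁ext : ∃ S : ℝ → ℝ, ContDiffOn ℝ (⊤ : ℕ∞) S (Ico (-1) 1) ∧
      ∀ r ∈ Ioo (-1 : ℝ) 1, 1 / σ₁ r - 1 / (1 + r) ^ 2 = S r) :
    ∃ A : ℝ, 0 < A ∧ ∀ p ∈ Icc (0 : ℝ) 1, ∀ l d1 d2 : ℝ → ℝ,
      ContinuousOn l (Icc (-1) 1) → ContinuousOn d1 (Icc (-1) 1) →
      (∀ r ∈ Ioo (-1 : ℝ) 1, HasDerivAt l (d1 r) r) →
      (∀ r ∈ Ioo (-1 : ℝ) 1, HasDerivAt d1 (d2 r) r) →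
      (∀ r ∈ Ioo (-1 : ℝ) 1, d2 r = (l r ^ 3 - l r) / ((1 - p) * σ₀ r + p * σ₁ r)) →
      (∀ r ∈ Icc (-1 : ℝ) 1, l r ≤ 1) → (∀ r ∈ Icc (-1 : ℝ) 1, -1 ≤ l r) →
      l (-1) = -1 → d1 (-1) = 0 → HasDerivWithinAt d1 (d2 (-1)) (Icc (-1) 1) (-1) →
      d2 (-1) < A := by
  obtain ⟨M0, δ0, hM0, hδ0, hδ0', h0⟩ := sigma_bounds σ₀ hσ₀ hσ₀pos hσ₀ext
  obtain ⟨M1, δ1, hM1, hδ1, hδ1', h1⟩ := sigma_bounds σ₁ hσ₁ hσ₁pos hσ₁ext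
  obtain ⟨M, hM⟩ : ∃ M, M = M0 + M1 := ⟨_, rfl⟩
  obtain ⟨δ, hδ⟩ : ∃ δ, δ = min δ0 δ1 := ⟨_, rfl⟩
  have hδpos : 0 < δ := by rw [hδ]; exact lt_min hδ0 hδ1
  have hδl0 : δ ≤ δ0 := hδ ▸ min_le_left _ _
  have hδl1 : δ ≤ δ1 := hδ ▸ min_le_right _ _
  refine ⟨4 / (δ * Real.exp (-3)) ^ 2 * Real.exp (6 + M) + 1, by positivity, ?_⟩
  intro p hp l d1 d2 hlc hd1c hl hd1 hd2 hlu hll hl0 hd10 hα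
  have hp0 := hp.1
  have hp1 : 0 ≤ 1 - p := by linarith [hp.2]
  have hsub : ∀ x ∈ Icc 0 δ, x - 1 ∈ Icc (-1:ℝ) 1 := fun x hx =>
    ⟨by linarith [hx.1], by linarith [hx.2]⟩
  have hsub' : ∀ x ∈ Ioc 0 δ, x - 1 ∈ Ioo (-1:ℝ) 1 := fun x hx =>
    ⟨by linarith [hx.1], by linarith [hx.2]⟩
  have hsh : ∀ x : ℝ, HasDerivAt (fun x => x - 1) (1:ℝ) x := fun x => (hasDerivAt_id' x).sub_const 1
  have hzp : ∀ r ∈ Ioo (-1:ℝ) 1, 0 < (1 - p) * σ₀ r + p * σ₁ r := by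
    intro r hr
    have a := hσ₀pos r hr
    have b := hσ₁pos r hr
    rcases hp0.eq_or_lt with h | h
    · rw [← h]; simpa using a
    · have := mul_nonneg hp1 a.le
      have := mul_pos h b
      linarith
  have hcs : ∀ f : ℝ → ℝ, ContinuousOn f (Icc (-1) 1) →
      ContinuousOn (fun x => f (x - 1)) (Icc 0 δ) := fun f hf =>
    hf.comp (by fun_prop) hsub
  have hds : ∀ (f : ℝ → ℝ) (f' x : ℝ), HasDerivAt f f' (x - 1) →
      HasDerivAt (fun x => f (x - 1)) f' x := fun f f' x hf => by
    simpa using hf.comp_sub_const x 1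
  have := key_left M δ (by linarith) hδpos (by linarith)
    (fun x => (1 - p) * σ₀ (x - 1) + p * σ₁ (x - 1))
    (fun x => (1 - p) * deriv σ₀ (x - 1) + p * deriv σ₁ (x - 1))
    (fun x => l (x - 1)) (fun x => d1 (x - 1)) (fun x => d2 (x - 1)) (d2 (-1))
    (hcs l hlc) (hcs d1 hd1c)
    (((hcs _ hσ₀.continuousOn).const_mul _).add ((hcs _ hσ₁.continuousOn).const_mul _))
    (fun x hx => hds _ _ _ (hl _ (hsub' x hx)))
    (fun x hx => hds _ _ _ (hd1 _ (hsub' x hx)))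
    (fun x hx => ((hds _ _ _ (h0 x ⟨hx.1, hx.2.trans hδl0⟩).1).const_mul _).add
      ((hds _ _ _ (h1 x ⟨hx.1, hx.2.trans hδl1⟩).1).const_mul _))
    (fun x hx => by
      rw [hd2 _ (hsub' x hx), div_mul_cancel₀]
      exact (hzp _ (hsub' x hx)).ne')
    (fun x hx => hzp _ (hsub' x hx))
    (fun x hx => by
      have a := (h0 x ⟨hx.1, hx.2.trans hδl0⟩).2.1
      have b := (h1 x ⟨hx.1, hx.2.trans hδl1⟩).2.1
      nlinarith [mul_le_mul_of_nonneg_left a hp1, mul_le_mul_of_nonneg_left b hp0])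
    (fun x hx => by
      have a := (h0 x ⟨hx.1, hx.2.trans hδl0⟩).2.2.1
      have b := (h1 x ⟨hx.1, hx.2.trans hδl1⟩).2.2.1
      nlinarith [mul_le_mul_of_nonneg_left a hp1, mul_le_mul_of_nonneg_left b hp0])
    (fun x hx => by
      have a := (h0 x ⟨hx.1, hx.2.trans hδl0⟩).2.2.2
      have b := (h1 x ⟨hx.1, hx.2.trans hδl1⟩).2.2.2
      have a' : σ₀ (x - 1) * (1 - M * x ^ 2) ≤ x ^ 2 := by
        have : 0 ≤ σ₀ (x - 1) * (M1 * x ^ 2) :=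
          mul_nonneg (hσ₀pos _ (hsub' x hx)).le (by positivity)
        rw [hM]; linarith
      have b' : σ₁ (x - 1) * (1 - M * x ^ 2) ≤ x ^ 2 := by
        have : 0 ≤ σ₁ (x - 1) * (M0 * x ^ 2) :=
          mul_nonneg (hσ₁pos _ (hsub' x hx)).le (by positivity)
        rw [hM]; linarith
      have := mul_le_mul_of_nonneg_left a' hp1
      have := mul_le_mul_of_nonneg_left b' hp0
      linarith)
    (fun x hx => hlu _ (hsub x hx)) (fun x hx => hll _ (hsub x hx))
    (by simpa using hl0) (by simpa using hd10) ?_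
  · linarith
  · have hα' : HasDerivWithinAt d1 (d2 (-1)) (Icc (-1) 1) ((0:ℝ) - 1) := by
      rw [zero_sub]; exact hα
    have h3 : HasDerivWithinAt (fun x => d1 (x - 1)) (d2 (-1) * 1) (Icc 0 1) 0 :=
      HasDerivWithinAt.comp (h₂ := d1) (h := fun x => x - 1) 0 hα' (hsh 0).hasDerivWithinAt
        (fun x hx => ⟨by linarith [hx.1], by linarith [hx.2]⟩)
    rw [mul_one] at h3
    exact h3.mono_of_mem_nhdsWithin (Icc_mem_nhdsGE (by norm_num))


end Aux14


/-- uniform a priori bounds on the shooting parameters for the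
`SO(3)` boundary-value problem.  `E` is the fixed smooth truncation of `x ↦ x³ - x`;
`σ₀, σ₁` are smooth on `[-1,1]`, positive on `(-1,1)`, with `1/σᵢ - 1/(1+r)²`
extending smoothly to `[-1,1)` and `1/σᵢ - 1/(1-r)²` extending smoothly to `(-1,1]`;
`ζ_p = (1-p)σ₀ + pσ₁`.  There are `α_max, β_max > 0`, independent of `p ∈ [0,1]`,
such that any `C²` solution of the boundary-value problem satisfies
`l''(-1) < α_max` and `l''(1) > -β_max` (one-sided second derivatives, taken within
`[-1,1]`). -/
theorem stmt_14 (E : ℝ → ℝ) (hE : ContDiff ℝ (⊤ : ℕ∞) E)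
    (hEeq : ∀ x : ℝ, |x| ≤ 2 → E x = x ^ 3 - x)
    (hEle : ∀ x : ℝ, 2 ≤ |x| → |x| ≤ 3 → |E x| ≤ |x ^ 3 - x|)
    (hE0 : ∀ x : ℝ, 3 ≤ |x| → E x = 0)
    (hEneg : ∀ x : ℝ, x < -1 → E x ≤ 0)
    (hEpos : ∀ x : ℝ, 1 < x → 0 ≤ E x)
    (σ₀ σ₁ : ℝ → ℝ)
    (hσ₀ : ContDiffOn ℝ (⊤ : ℕ∞) σ₀ (Set.Icc (-1) 1))
    (hσ₁ : ContDiffOn ℝ (⊤ : ℕ∞) σ₁ (Set.Icc (-1) 1))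
    (hσ₀pos : ∀ r ∈ Set.Ioo (-1 : ℝ) 1, 0 < σ₀ r)
    (hσ₁pos : ∀ r ∈ Set.Ioo (-1 : ℝ) 1, 0 < σ₁ r)
    (hσ₀extL : ∃ S : ℝ → ℝ, ContDiffOn ℝ (⊤ : ℕ∞) S (Set.Ico (-1) 1) ∧
      ∀ r ∈ Set.Ioo (-1 : ℝ) 1, 1 / σ₀ r - 1 / (1 + r) ^ 2 = S r)
    (hσ₁extL : ∃ S : ℝ → ℝ, ContDiffOn ℝ (⊤ : ℕ∞) S (Set.Ico (-1) 1) ∧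
      ∀ r ∈ Set.Ioo (-1 : ℝ) 1, 1 / σ₁ r - 1 / (1 + r) ^ 2 = S r)
    (hσ₀extR : ∃ S : ℝ → ℝ, ContDiffOn ℝ (⊤ : ℕ∞) S (Set.Ioc (-1) 1) ∧
      ∀ r ∈ Set.Ioo (-1 : ℝ) 1, 1 / σ₀ r - 1 / (1 - r) ^ 2 = S r)
    (hσ₁extR : ∃ S : ℝ → ℝ, ContDiffOn ℝ (⊤ : ℕ∞) S (Set.Ioc (-1) 1) ∧
      ∀ r ∈ Set.Ioo (-1 : ℝ) 1, 1 / σ₁ r - 1 / (1 - r) ^ 2 = S r) :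
    ∃ αmax βmax : ℝ, 0 < αmax ∧ 0 < βmax ∧
      ∀ p ∈ Set.Icc (0 : ℝ) 1, ∀ l : ℝ → ℝ,
        ContDiffOn ℝ 2 l (Set.Icc (-1) 1) →
        (∀ r ∈ Set.Ioo (-1 : ℝ) 1,
          derivWithin (derivWithin l (Set.Icc (-1) 1)) (Set.Icc (-1) 1) r
            = E (l r) / ((1 - p) * σ₀ r + p * σ₁ r)) →
        l (-1) = -1 → l 1 = 1 →
        derivWithin l (Set.Icc (-1) 1) (-1) = 0 →
        derivWithin l (Set.Icc (-1) 1) 1 = 0 →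
        derivWithin (derivWithin l (Set.Icc (-1) 1)) (Set.Icc (-1) 1) (-1) < αmax ∧
        -βmax < derivWithin (derivWithin l (Set.Icc (-1) 1)) (Set.Icc (-1) 1) 1 := by
  have hrefl : ∀ σ : ℝ → ℝ, ContDiffOn ℝ (⊤ : ℕ∞) σ (Set.Icc (-1) 1) →
      ContDiffOn ℝ (⊤ : ℕ∞) (fun r => σ (-r)) (Set.Icc (-1) 1) := fun σ h =>
    h.comp contDiff_neg.contDiffOn (fun r hr => ⟨by linarith [hr.2], by linarith [hr.1]⟩)
  have hneg : ∀ r ∈ Set.Ioo (-1 : ℝ) 1, -r ∈ Set.Ioo (-1 : ℝ) 1 := fun r hr =>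
    ⟨by linarith [hr.2], by linarith [hr.1]⟩
  have hnegc : ∀ r ∈ Set.Icc (-1 : ℝ) 1, -r ∈ Set.Icc (-1 : ℝ) 1 := fun r hr =>
    ⟨by linarith [hr.2], by linarith [hr.1]⟩
  have hext : ∀ σ : ℝ → ℝ, (∃ S : ℝ → ℝ, ContDiffOn ℝ (⊤ : ℕ∞) S (Set.Ioc (-1) 1) ∧
      ∀ r ∈ Set.Ioo (-1 : ℝ) 1, 1 / σ r - 1 / (1 - r) ^ 2 = S r) →
      ∃ S : ℝ → ℝ, ContDiffOn ℝ (⊤ : ℕ∞) S (Set.Ico (-1) 1) ∧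
      ∀ r ∈ Set.Ioo (-1 : ℝ) 1, 1 / (fun r => σ (-r)) r - 1 / (1 + r) ^ 2 = S r := by
    rintro σ ⟨S, hS, hSe⟩
    refine ⟨fun r => S (-r), hS.comp contDiff_neg.contDiffOn
      (fun r hr => ⟨by linarith [hr.2], by linarith [hr.1]⟩), fun r hr => ?_⟩
    simpa using hSe (-r) (hneg r hr)
  obtain ⟨A, hA, hA'⟩ := Aux14.left_bound σ₀ σ₁ hσ₀ hσ₁ hσ₀pos hσ₁pos hσ₀extL hσ₁extL
  obtain ⟨B, hB, hB'⟩ := Aux14.left_bound (fun r => σ₀ (-r)) (fun r => σ₁ (-r)) (hrefl _ hσ₀) (hrefl _ hσ₁)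
    (fun r hr => hσ₀pos _ (hneg r hr)) (fun r hr => hσ₁pos _ (hneg r hr))
    (hext _ hσ₀extR) (hext _ hσ₁extR)
  refine ⟨A, B, hA, hB, ?_⟩
  intro p hp l hl hode hl0 hl1 hd0 hd1
  have hu : UniqueDiffOn ℝ (Set.Icc (-1:ℝ) 1) := uniqueDiffOn_Icc (by norm_num)
  have hD : ContDiffOn ℝ 1 (derivWithin l (Set.Icc (-1) 1)) (Set.Icc (-1) 1) :=
    hl.derivWithin hu (by norm_num)
  have hlw : ∀ r ∈ Set.Icc (-1:ℝ) 1,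
      HasDerivWithinAt l (derivWithin l (Set.Icc (-1) 1) r) (Set.Icc (-1) 1) r := fun r hr =>
    ((hl.differentiableOn (by norm_num)) r hr).hasDerivWithinAt
  have hDw : ∀ r ∈ Set.Icc (-1:ℝ) 1,
      HasDerivWithinAt (derivWithin l (Set.Icc (-1) 1))
        (derivWithin (derivWithin l (Set.Icc (-1) 1)) (Set.Icc (-1) 1) r) (Set.Icc (-1) 1) r :=
    fun r hr => ((hD.differentiableOn (by norm_num)) r hr).hasDerivWithinAt
  have hlc := hl.continuousOn
  have hDc := hD.continuousOn
  generalize derivWithin (derivWithin l (Set.Icc (-1) 1)) (Set.Icc (-1) 1) = d2 at *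
  generalize derivWithin l (Set.Icc (-1) 1) = d1 at *
  have hla : ∀ r ∈ Set.Ioo (-1:ℝ) 1, HasDerivAt l (d1 r) r := fun r hr =>
    (hlw r ⟨hr.1.le, hr.2.le⟩).hasDerivAt (Icc_mem_nhds hr.1 hr.2)
  have hDa : ∀ r ∈ Set.Ioo (-1:ℝ) 1, HasDerivAt d1 (d2 r) r := fun r hr =>
    (hDw r ⟨hr.1.le, hr.2.le⟩).hasDerivAt (Icc_mem_nhds hr.1 hr.2)
  have hz : ∀ r ∈ Set.Ioo (-1:ℝ) 1, 0 ≤ (1 - p) * σ₀ r + p * σ₁ r := fun r hr =>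
    add_nonneg (mul_nonneg (by linarith [hp.2]) (hσ₀pos r hr).le) (mul_nonneg hp.1 (hσ₁pos r hr).le)
  have hlu : ∀ r ∈ Set.Icc (-1:ℝ) 1, l r ≤ 1 := by
    apply Aux14.max_principle l d1 d2 hlc hla hDa
    · intro r hr h
      rw [hode r hr]
      exact div_nonneg (hEpos _ h) (hz r hr)
    · rw [hl0]; norm_num
    · rw [hl1]
  have hll : ∀ r ∈ Set.Icc (-1:ℝ) 1, -1 ≤ l r := by
    have := Aux14.max_principle (fun r => -l r) (fun r => -d1 r) (fun r => -d2 r) hlc.neg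
      (fun r hr => (hla r hr).neg) (fun r hr => (hDa r hr).neg) ?_ ?_ ?_
    · intro r hr
      have := this r hr
      linarith
    · intro r hr h
      rw [hode r hr]
      have := div_nonneg (neg_nonneg.2 (hEneg (l r) (by linarith))) (hz r hr)
      rw [neg_div] at this
      exact this
    · rw [hl0]; norm_num
    · rw [hl1]; norm_num
  have hode' : ∀ r ∈ Set.Ioo (-1:ℝ) 1,
      d2 r = (l r ^ 3 - l r) / ((1 - p) * σ₀ r + p * σ₁ r) := by
    intro r hr
    have hrc : r ∈ Set.Icc (-1:ℝ) 1 := ⟨hr.1.le, hr.2.le⟩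
    rw [hode r hr, hEeq]
    rw [abs_le]
    exact ⟨by linarith [hll r hrc], by linarith [hlu r hrc]⟩
  refine ⟨hA' p hp l d1 d2 hlc hDc hla hDa hode' hlu hll hl0 hd0 (hDw _ (by norm_num)), ?_⟩
  have hcomp : ∀ (f : ℝ → ℝ) (f' r : ℝ), HasDerivAt f f' (-r) →
      HasDerivAt (fun x => f (-x)) (-f') r := fun f f' r h => by
    exact Aux14.hd_congr (HasDerivAt.comp (h₂ := f) (h := fun x => -x) r h (hasDerivAt_neg r)) (fun y => rfl) (by simp)
  have key := hB' p hp (fun r => -l (-r)) (fun r => d1 (-r)) (fun r => -d2 (-r))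
    (hlc.comp continuous_neg.continuousOn hnegc).neg (hDc.comp continuous_neg.continuousOn hnegc)
    (fun r hr => Aux14.hd_congr (hcomp _ _ _ (hla _ (hneg r hr))).neg (fun y => rfl) (by simp))
    (fun r hr => hcomp _ _ _ (hDa _ (hneg r hr)))
    (fun r hr => by
      rw [hode' _ (hneg r hr), ← neg_div]
      congr 1
      ring)
    (fun r hr => by linarith [hll _ (hnegc r hr)])
    (fun r hr => by linarith [hlu _ (hnegc r hr)])
    (by simp [hl1]) (by simp [hd1]) ?_
  · simp only [neg_neg] at key
    linarith
  · have h1 : HasDerivWithinAt d1 (d2 1) (Set.Icc (-1) 1) (-(-1)) := by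
      rw [neg_neg]; exact hDw 1 (by norm_num)
    have := HasDerivWithinAt.comp (h₂ := d1) (h := fun x => -x) (-1) h1
      (hasDerivAt_neg (-1)).hasDerivWithinAt hnegc
    simp only [neg_neg, mul_neg, mul_one] at this ⊢
    exact this
end
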